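/- arXiv:1804.06232 — 2 statements merged into one kernel-verified Lean document; each statement's English description precedes it below -/
import Mathlib

section
/- Let γ be a smooth 1-form on a neighborhood of 0 in ℝ^{2n} with γ(0)=0 and dγ = ω₀, the standard symplectic form, and let X be its associated conformal vector field, defined by ω₀(X(x), ·) = γ_x. Set A = DX(0) and let λ₁, …, λ_{2n} be the (complex) eigenvalues of A. Assume A is hyperbolic (no eigenvalue of A has zero real part) and that there is no resonance relation Σ_{i=1}^{2n} α_i λ_i = 1 with nonnegative integers α_i satisfying Σ α_i ≥ 3. Then γ is smoothly linearizable: there exists a local diffeomorphism φ of ℝ^{2n} with φ(0)=0 such that the pullback φ*γ is the linear 1-form x ↦ ω₀(Ax, ·). -/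
open scoped Topology

section Preparation

open scoped ContDiff

set_option linter.unusedSectionVars false

universe u

section Germs

variable {E F : Type u} [NormedAddCommGroup E] [NormedSpace ℝ E]
  [NormedAddCommGroup F] [NormedSpace ℝ F]

/-- Smooth cutoff functions at the origin. -/
theorem exists_smooth_cutoff [FiniteDimensional ℝ E] {s : Set E} (hs : s ∈ 𝓝 (0 : E)) :
    ∃ b : E → ℝ, ContDiff ℝ ∞ b ∧ (∀ᶠ x in 𝓝 (0 : E), b x = 1) ∧ (∀ x, 0 ≤ b x ∧ b x ≤ 1) ∧
      tsupport b ⊆ s ∧ HasCompactSupport b := by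
  obtain ⟨r, hr, hrs⟩ := Metric.nhds_basis_closedBall.mem_iff.1 hs
  let b : ContDiffBump (0 : E) := ⟨r / 2, r, by positivity, by linarith⟩
  refine ⟨b, b.contDiff, b.eventuallyEq_one, fun x => ⟨b.nonneg, b.le_one⟩, ?_,
    b.hasCompactSupport⟩
  rw [b.tsupport_eq]
  exact hrs

theorem contDiff_cutoff_smul {b : E → ℝ} (hb : ContDiff ℝ ∞ b) {f : E → F}
    (hf : ∀ x ∈ tsupport b, ContDiffAt ℝ ∞ f x) : ContDiff ℝ ∞ (fun x => b x • f x) := by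
  refine contDiff_iff_contDiffAt.2 fun x => ?_
  by_cases hx : x ∈ tsupport b
  · exact hb.contDiffAt.smul (hf x hx)
  · refine (contDiffAt_const (c := (0 : F))).congr_of_eventuallyEq ?_
    filter_upwards [notMem_tsupport_iff_eventuallyEq.1 hx] with y hy
    simp [hy]

/-- A germ of a smooth map extends to a global smooth map. -/
theorem exists_contDiff_eventuallyEq [FiniteDimensional ℝ E] {f : E → F}
    (hf : ∀ᶠ x in 𝓝 (0 : E), ContDiffAt ℝ ∞ f x) :
    ∃ g : E → F, ContDiff ℝ ∞ g ∧ g =ᶠ[𝓝 0] f := by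
  obtain ⟨b, hb, hb1, -, hbs, -⟩ := exists_smooth_cutoff hf
  refine ⟨fun x => b x • f x, contDiff_cutoff_smul hb fun x hx => hbs hx, ?_⟩
  filter_upwards [hb1] with x hx
  simp [hx]

/-- A germ of a smooth map vanishing at the origin extends to a small global smooth map. -/
theorem exists_contDiff_eventuallyEq_small [FiniteDimensional ℝ E] {f : E → F}
    (hf : ∀ᶠ x in 𝓝 (0 : E), ContDiffAt ℝ ∞ f x) (hf0 : f 0 = 0) {ε : ℝ} (hε : 0 < ε) :
    ∃ g : E → F, ContDiff ℝ ∞ g ∧ g =ᶠ[𝓝 0] f ∧ ∀ x, ‖g x‖ ≤ ε := by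
  have hc : ∀ᶠ x in 𝓝 (0 : E), ‖f x‖ < ε := by
    have := hf.self_of_nhds.continuousAt.norm
    exact this.eventually_lt continuousAt_const (by simpa [hf0] using hε)
  obtain ⟨b, hb, hb1, hb01, hbs, -⟩ := exists_smooth_cutoff (hf.and hc)
  refine ⟨fun x => b x • f x, contDiff_cutoff_smul hb fun x hx => (hbs hx).1, ?_, fun x => ?_⟩
  · filter_upwards [hb1] with x hx
    simp [hx]
  · by_cases hx : x ∈ tsupport b
    · rw [norm_smul, Real.norm_of_nonneg (hb01 x).1]
      calc b x * ‖f x‖ ≤ 1 * ‖f x‖ := by gcongr; exact (hb01 x).2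
        _ ≤ ε := by rw [one_mul]; exact (hbs hx).2.le
    · simp [image_eq_zero_of_notMem_tsupport hx, hε.le]

/-- A map is flat at the origin if it vanishes there to infinite order. -/
def FlatAtZero (f : E → F) : Prop := ∀ N : ℕ, f =O[𝓝 0] fun x => ‖x‖ ^ N

theorem FlatAtZero.congr {f g : E → F} (hf : FlatAtZero f) (h : g =ᶠ[𝓝 0] f) : FlatAtZero g :=
  fun N => h.trans_isBigO (hf N)

theorem FlatAtZero.map_zero {f : E → F} (hf : FlatAtZero f) : f 0 = 0 := by
  obtain ⟨C, hC⟩ := (hf 1).bound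
  simpa using hC.self_of_nhds

theorem isBigO_pow_norm_of_le {m n : ℕ} (h : m ≤ n) :
    (fun x : E => ‖x‖ ^ n) =O[𝓝 0] fun x => ‖x‖ ^ m := by
  refine Asymptotics.IsBigO.of_bound 1 ?_
  filter_upwards [Metric.ball_mem_nhds (0 : E) one_pos] with x hx
  rw [mem_ball_zero_iff] at hx
  simpa using pow_le_pow_of_le_one (norm_nonneg x) hx.le h

/-- A smooth germ extends to a global smooth map with uniformly bounded second derivative on a
ball: the quadratic Taylor estimate. -/
theorem exists_quadratic_bound {f : E → F} (hf : ContDiff ℝ ∞ f) (x₀ : E) :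
    ∃ C, ∃ r > 0, ∀ x ∈ Metric.ball x₀ r, ∀ y ∈ Metric.ball x₀ r,
      ‖f y - f x - fderiv ℝ f x (y - x)‖ ≤ C * ‖y - x‖ ^ 2 := by
  have h1 : ContDiff ℝ 1 (fderiv ℝ f) := hf.fderiv_right (WithTop.coe_le_coe.2 le_top)
  obtain ⟨K, t, ht, hK⟩ := (h1.contDiffAt (x := x₀)).exists_lipschitzOnWith
  obtain ⟨r, hr, hrt⟩ := Metric.mem_nhds_iff.1 ht
  refine ⟨K, r, hr, fun x hx y hy => ?_⟩
  have hconv := (convex_ball x₀ r).segment_subset hx hy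
  have := (convex_segment x y).norm_image_sub_le_of_norm_hasFDerivWithin_le'
    (f := f) (f' := fderiv ℝ f) (φ := fderiv ℝ f x) (C := K * ‖y - x‖)
    (fun z _ => ((hf.differentiable (by simp)) z).hasFDerivAt.hasFDerivWithinAt) (fun z hz => ?_)
    (left_mem_segment ℝ x y) (right_mem_segment ℝ x y)
  · calc _ ≤ _ := this
      _ = _ := by ring
  · calc ‖fderiv ℝ f z - fderiv ℝ f x‖ ≤ K * ‖z - x‖ :=
        hK.norm_sub_le (hrt (hconv hz)) (hrt hx)
      _ ≤ K * ‖y - x‖ := by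
        gcongr
        have := norm_sub_le_of_mem_segment hz
        simpa using this

/-- Interpolation: a smooth map vanishing to high order has a derivative vanishing to high order. -/
theorem isBigO_fderiv_of_isBigO {f : E → F} (hs : ContDiff ℝ ∞ f) {N : ℕ}
    (hf : f =O[𝓝 0] fun x => ‖x‖ ^ (2 * (N + 1))) :
    fderiv ℝ f =O[𝓝 0] fun x => ‖x‖ ^ N := by
  obtain ⟨C, r, hr, hC⟩ := exists_quadratic_bound hs 0
  obtain ⟨K, hK⟩ := hf.bound
  have hf0 : f 0 = 0 := by simpa using hK.self_of_nhds
  obtain ⟨δ, hδ, hδK⟩ := Metric.eventually_nhds_iff_ball.1 hK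
  set ρ := min (min r δ) 1 with hρ
  have hρ0 : 0 < ρ := by positivity
  have hC0 : 0 ≤ |C| := abs_nonneg C
  refine Asymptotics.IsBigO.of_bound (|K| * 2 ^ (2 * (N + 1)) + |K| + |C|) ?_
  filter_upwards [Metric.ball_mem_nhds (0 : E) (half_pos hρ0)] with x hx
  rw [mem_ball_zero_iff] at hx
  have hx1 : ‖x‖ < 1 := by
    have : ρ ≤ 1 := min_le_right _ _
    linarith
  rw [norm_pow, norm_norm]
  rcases (norm_nonneg x).eq_or_lt with h0 | h0
  · have hx0 : x = 0 := norm_eq_zero.1 h0.symm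
    subst hx0
    have hd : fderiv ℝ f 0 = 0 := by
      have : HasFDerivAt f (0 : E →L[ℝ] F) 0 := by
        rw [hasFDerivAt_iff_isLittleO_nhds_zero]
        have h2 : (fun h : E => f (0 + h) - f 0 - (0 : E →L[ℝ] F) h) = f := by
          ext h; simp [hf0]
        rw [h2]
        refine (hf.trans (isBigO_pow_norm_of_le (by omega : 2 ≤ _))).trans_isLittleO ?_
        have := Asymptotics.isLittleO_norm_pow_id (E' := E) one_lt_two
        exact this
      exact this.fderiv
    rw [hd, norm_zero]
    positivity
  set h := ‖x‖ ^ (N + 1) with hh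
  have hhx : h ≤ ‖x‖ := by
    simpa using pow_le_pow_of_le_one (norm_nonneg x) hx1.le (Nat.succ_le_succ (Nat.zero_le N))
  have hh0 : 0 < h := by positivity
  refine ContinuousLinearMap.opNorm_le_of_unit_norm (by positivity) fun v hv => ?_
  have hy : ‖x + h • v‖ ≤ 2 * ‖x‖ := by
    calc ‖x + h • v‖ ≤ ‖x‖ + ‖h • v‖ := norm_add_le _ _
      _ = ‖x‖ + h := by rw [norm_smul, hv, Real.norm_of_nonneg hh0.le, mul_one]
      _ ≤ _ := by linarith
  have hρr : ρ ≤ r := (min_le_left _ _).trans (min_le_left _ _)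
  have hρδ : ρ ≤ δ := (min_le_left _ _).trans (min_le_right _ _)
  have e1 := hC x (by rw [mem_ball_zero_iff]; linarith) (x + h • v)
    (by rw [mem_ball_zero_iff]; linarith)
  have e2 := hδK x (by rw [mem_ball_zero_iff]; linarith)
  have e3 := hδK (x + h • v) (by rw [mem_ball_zero_iff]; linarith)
  rw [add_sub_cancel_left, map_smul, norm_smul, hv, Real.norm_of_nonneg hh0.le, mul_one] at e1
  rw [norm_pow, norm_norm] at e2 e3
  have hpow : ‖x‖ ^ (2 * (N + 1)) = h * h := by rw [hh]; ring
  have e2' : ‖f x‖ ≤ |K| * (h * h) := by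
    rw [← hpow]; exact e2.trans (by gcongr; exact le_abs_self K)
  have e3' : ‖f (x + h • v)‖ ≤ |K| * 2 ^ (2 * (N + 1)) * (h * h) := by
    rw [← hpow, mul_assoc, ← mul_pow]
    refine e3.trans ?_
    gcongr
    exact le_abs_self K
  have e4 : h * ‖fderiv ℝ f x v‖ ≤ h * ((|K| * 2 ^ (2 * (N + 1)) + |K| + |C|) * h) := by
    calc h * ‖fderiv ℝ f x v‖ = ‖h • fderiv ℝ f x v‖ := by
          rw [norm_smul, Real.norm_of_nonneg hh0.le]
      _ = ‖(f (x + h • v) - f x) - (f (x + h • v) - f x - h • fderiv ℝ f x v)‖ := by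
          congr 1; abel
      _ ≤ ‖f (x + h • v)‖ + ‖f x‖ + ‖f (x + h • v) - f x - h • fderiv ℝ f x v‖ :=
          (norm_sub_le _ _).trans (by gcongr; exact norm_sub_le _ _)
      _ ≤ |K| * 2 ^ (2 * (N + 1)) * (h * h) + |K| * (h * h) + |C| * h ^ 2 := by
          gcongr
          exact e1.trans (by gcongr; exact le_abs_self C)
      _ = _ := by ring
  have e5 := le_of_mul_le_mul_left e4 hh0
  refine e5.trans ?_
  gcongr
  exact pow_le_pow_of_le_one (norm_nonneg x) hx1.le (Nat.le_succ N)

theorem FlatAtZero.fderiv_flat {f : E → F} (hf : FlatAtZero f) (hs : ContDiff ℝ ∞ f) :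
    FlatAtZero (fderiv ℝ f) := fun _ => isBigO_fderiv_of_isBigO hs (hf _)

theorem FlatAtZero.isBigO_iteratedFDeriv {f : E → F} (hf : FlatAtZero f) (hs : ContDiff ℝ ∞ f) (k N
    : ℕ) :
    (fun x => ‖iteratedFDeriv ℝ k f x‖) =O[𝓝 0] fun x => ‖x‖ ^ N := by
  induction k generalizing F with
  | zero => simpa using (hf N).norm_left
  | succ k ih =>
    have := ih (hf.fderiv_flat hs) (hs.fderiv_right (by simp))
    simpa [norm_iteratedFDeriv_fderiv] using this

/-- Derivatives of flat maps on a ball are bounded by every power of the norm. -/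
theorem FlatAtZero.exists_bound [FiniteDimensional ℝ E] {f : E → F} (hf : FlatAtZero f)
    (hs : ContDiff ℝ ∞ f) (k N : ℕ) (R : ℝ) :
    ∃ C, 0 ≤ C ∧ ∀ x, ‖x‖ ≤ R → ‖iteratedFDeriv ℝ k f x‖ ≤ C * ‖x‖ ^ N := by
  obtain ⟨C₁, h₁⟩ := (hf.isBigO_iteratedFDeriv hs k N).bound
  obtain ⟨δ, hδ, h₁⟩ := Metric.eventually_nhds_iff_ball.1 h₁
  have hcont := hs.continuous_iteratedFDeriv (m := k) (by exact_mod_cast le_top)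
  obtain ⟨C₂, h₂⟩ := (isCompact_closedBall (0 : E) R).exists_bound_of_continuousOn
    hcont.continuousOn
  refine ⟨|C₁| + |C₂| / δ ^ N, by positivity, fun x hx => ?_⟩
  by_cases hxδ : ‖x‖ < δ
  · have := h₁ x (by simpa using hxδ)
    rw [norm_norm, norm_pow, norm_norm] at this
    refine this.trans ?_
    gcongr
    exact (le_abs_self _).trans (le_add_of_nonneg_right (by positivity))
  · have := h₂ x (by simpa using hx)
    calc _ ≤ C₂ := this
      _ ≤ |C₂| := le_abs_self _
      _ = |C₂| / δ ^ N * δ ^ N := by field_simp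
      _ ≤ |C₂| / δ ^ N * ‖x‖ ^ N := by gcongr; exact not_lt.1 hxδ
      _ ≤ _ := by gcongr; exact le_add_of_nonneg_left (by positivity)

/-- A map which is smooth off the origin, with all derivatives flat, is smooth. -/
theorem contDiff_of_flat_derivatives {f : E → F} (h0 : f 0 = 0)
    (hs : ∀ x ≠ 0, ContDiffAt ℝ ∞ f x)
    (hb : ∀ k N : ℕ, (fun x => ‖iteratedFDeriv ℝ k f x‖) =O[𝓝[≠] 0] fun x => ‖x‖ ^ N) :
    ContDiff ℝ ∞ f := by
  rw [contDiff_infty]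
  intro n
  have key : ∀ {F : Type u} [NormedAddCommGroup F] [NormedSpace ℝ F] {f : E → F}, f 0 = 0 →
      (∀ x ≠ 0, ContDiffAt ℝ ∞ f x) →
      (∀ k N : ℕ, (fun x => ‖iteratedFDeriv ℝ k f x‖) =O[𝓝[≠] 0] fun x => ‖x‖ ^ N) →
      HasFDerivAt f (0 : E →L[ℝ] F) 0 := by
    intro F _ _ f h0 hs hb
    rw [hasFDerivAt_iff_isLittleO_nhds_zero]
    have h2 : (fun h : E => f (0 + h) - f 0 - (0 : E →L[ℝ] F) h) = f := by
      ext h; simp [h0]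
    rw [h2]
    have h3 : f =O[𝓝 0] fun x : E => ‖x‖ ^ 2 := by
      obtain ⟨C, hC⟩ := (hb 0 2).bound
      rw [eventually_nhdsWithin_iff] at hC
      refine Asymptotics.IsBigO.of_bound C ?_
      filter_upwards [hC] with x hx
      by_cases hx0 : x = 0
      · simp [hx0, h0]
      · simpa using hx hx0
    exact h3.trans_isLittleO (Asymptotics.isLittleO_norm_pow_id one_lt_two)
  induction n generalizing F with
  | zero =>
    refine contDiff_zero.2 (continuous_iff_continuousAt.2 fun x => ?_)
    by_cases hx : x = 0
    · subst hx
      exact (key h0 hs hb).continuousAt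
    · exact (hs x hx).continuousAt
  | succ n ih =>
    refine contDiff_succ_iff_fderiv.2 ⟨fun x => ?_, by simp, ih (key h0 hs hb).fderiv ?_ ?_⟩
    · by_cases hx : x = 0
      · subst hx
        exact (key h0 hs hb).differentiableAt
      · exact (hs x hx).differentiableAt (by simp)
    · exact fun x hx => (hs x hx).fderiv_right (by simp)
    · intro k N
      simpa [norm_iteratedFDeriv_fderiv] using hb (k + 1) N

end Germs

section Superposition

open BoundedContinuousFunction

variable {T : Type*} [TopologicalSpace T] {Z W : Type u} [NormedAddCommGroup Z] [NormedSpace ℝ Z]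
  [NormedAddCommGroup W] [NormedSpace ℝ W]

/-- Families of smooth maps, continuous in the parameter together with all derivatives, whose
derivatives are bounded on bounded sets uniformly in the parameter. -/
structure UniformlySmooth (F : T → Z → W) : Prop where
  smooth : ∀ t, ContDiff ℝ ∞ (F t)
  cont : ∀ k : ℕ, Continuous fun p : T × Z => iteratedFDeriv ℝ k (F p.1) p.2
  bdd : ∀ (k : ℕ) (R : ℝ), ∃ C, ∀ t z, ‖z‖ ≤ R → ‖iteratedFDeriv ℝ k (F t) z‖ ≤ C

namespace UniformlySmooth

variable {F : T → Z → W}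

theorem fderiv (hF : UniformlySmooth F) : UniformlySmooth fun t => fderiv ℝ (F t) where
  smooth t := (hF.smooth t).fderiv_right (by simp)
  cont k := by
    have h := (continuousMultilinearCurryRightEquiv' ℝ k Z W).continuous.comp (hF.cont (k + 1))
    refine h.congr fun p => ?_
    simp only [Function.comp_apply, iteratedFDeriv_succ_eq_comp_right,
      LinearIsometryEquiv.apply_symm_apply]
  bdd k R := by
    obtain ⟨C, hC⟩ := hF.bdd (k + 1) R
    exact ⟨C, fun t z hz => by simpa [norm_iteratedFDeriv_fderiv] using hC t z hz⟩

theorem exists_norm_le (hF : UniformlySmooth F) (R : ℝ) : ∃ C, ∀ t z, ‖z‖ ≤ R → ‖F t z‖ ≤ C := by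
  simpa using hF.bdd 0 R

theorem continuous_uncurry (hF : UniformlySmooth F) : Continuous fun p : T × Z => F p.1 p.2 := by
  have h := (continuousMultilinearCurryFin0 ℝ Z W).continuous.comp (hF.cont 0)
  refine h.congr fun p => ?_
  simp [continuousMultilinearCurryFin0_apply]

/-- The superposition operator induced by a uniformly smooth family. -/
noncomputable def superposition (hF : UniformlySmooth F) (f : T →ᵇ Z) : T →ᵇ W :=
  ofNormedAddCommGroup (fun t => F t (f t))
    (hF.continuous_uncurry.comp (continuous_id.prodMk f.continuous))
    (hF.exists_norm_le ‖f‖).choose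
    fun t => (hF.exists_norm_le ‖f‖).choose_spec t (f t) (f.norm_coe_le_norm t)

@[simp]
theorem superposition_apply (hF : UniformlySmooth F) (f : T →ᵇ Z) (t : T) :
    hF.superposition f t = F t (f t) := rfl

end UniformlySmooth

/-- Pointwise application of a bounded family of operators. -/
noncomputable def pointwiseApply (T : Type*) [TopologicalSpace T] (Z W : Type u)
    [NormedAddCommGroup Z] [NormedSpace ℝ Z] [NormedAddCommGroup W] [NormedSpace ℝ W] :
    (T →ᵇ (Z →L[ℝ] W)) →L[ℝ] (T →ᵇ Z) →L[ℝ] (T →ᵇ W) :=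
  LinearMap.mkContinuous₂
    (LinearMap.mk₂ ℝ
      (fun (a : T →ᵇ (Z →L[ℝ] W)) (f : T →ᵇ Z) => ofNormedAddCommGroup (fun t => a t (f t))
          (a.continuous.clm_apply f.continuous)
        (‖a‖ * ‖f‖) fun t => (a t).le_of_opNorm_le_of_le (a.norm_coe_le_norm t)
          (f.norm_coe_le_norm t))
      (fun a b f => by ext t; simp) (fun c a f => by ext t; simp)
      (fun a f g => by ext t; simp) (fun c a f => by ext t; simp)) 1
    fun a f => by
      rw [one_mul]
      exact (norm_le (by positivity)).2 fun t => (a t).le_of_opNorm_le_of_le (a.norm_coe_le_norm t)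
        (f.norm_coe_le_norm t)

@[simp]
theorem pointwiseApply_apply (a : T →ᵇ (Z →L[ℝ] W)) (f : T →ᵇ Z) (t : T) :
    pointwiseApply T Z W a f t = a t (f t) := rfl

namespace UniformlySmooth

variable {F : T → Z → W}

theorem hasFDerivAt_superposition (hF : UniformlySmooth F) (f : T →ᵇ Z) :
    HasFDerivAt hF.superposition (pointwiseApply T Z W (hF.fderiv.superposition f)) f := by
  obtain ⟨C, hC⟩ := hF.fderiv.bdd 1 (‖f‖ + 1)
  have hest : ∀ h : T →ᵇ Z, ‖h‖ ≤ 1 → ∀ t,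
      ‖F t (f t + h t) - F t (f t) - _root_.fderiv ℝ (F t) (f t) (h t)‖ ≤ |C| * ‖h‖ ^ 2 := by
    intro h hh t
    have hd : Differentiable ℝ (F t) := (hF.smooth t).differentiable (by simp)
    have hd2 : Differentiable ℝ (_root_.fderiv ℝ (F t)) :=
      (hF.fderiv.smooth t).differentiable (by simp)
    have hsub : segment ℝ (f t) (f t + h t) ⊆ Metric.closedBall 0 (‖f‖ + 1) := by
      refine (convex_closedBall _ _).segment_subset ?_ ?_ <;> rw [mem_closedBall_zero_iff]
      · linarith [f.norm_coe_le_norm t]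
      · exact (norm_add_le _ _).trans (add_le_add (f.norm_coe_le_norm t)
          ((h.norm_coe_le_norm t).trans hh))
    have hb : ∀ z ∈ segment ℝ (f t) (f t + h t),
        ‖_root_.fderiv ℝ (F t) z - _root_.fderiv ℝ (F t) (f t)‖ ≤ |C| * ‖h‖ := by
      intro z hz
      have h1 := (convex_segment (f t) (f t + h t)).norm_image_sub_le_of_norm_fderiv_le
        (f := _root_.fderiv ℝ (F t)) (C := |C|) (fun y _ => hd2 y) (fun y hy => ?_)
        (left_mem_segment ℝ _ _) hz
      · refine h1.trans ?_
        gcongr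
        have := norm_sub_le_of_mem_segment hz
        rw [add_sub_cancel_left] at this
        exact this.trans (h.norm_coe_le_norm t)
      · have := hC t y (by simpa using hsub hy)
        rw [norm_iteratedFDeriv_one] at this
        exact this.trans (le_abs_self C)
    have h2 := (convex_segment (f t) (f t + h t)).norm_image_sub_le_of_norm_hasFDerivWithin_le'
      (f := F t) (φ := _root_.fderiv ℝ (F t) (f t))
      (fun z _ => (hd z).hasFDerivAt.hasFDerivWithinAt) hb
      (left_mem_segment ℝ _ _) (right_mem_segment ℝ _ _)
    rw [add_sub_cancel_left] at h2
    refine h2.trans ?_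
    rw [mul_assoc, sq]
    gcongr
    exact h.norm_coe_le_norm t
  rw [hasFDerivAt_iff_isLittleO_nhds_zero]
  refine Asymptotics.IsBigO.trans_isLittleO (g := fun h : T →ᵇ Z => ‖h‖ ^ 2) ?_
    (Asymptotics.isLittleO_norm_pow_id one_lt_two)
  refine Asymptotics.IsBigO.of_bound |C| ?_
  filter_upwards [Metric.closedBall_mem_nhds (0 : T →ᵇ Z) one_pos] with h hh
  rw [mem_closedBall_zero_iff] at hh
  rw [norm_pow, norm_norm]
  exact (norm_le (by positivity)).2 fun t => hest h hh t

theorem contDiff_superposition (hF : UniformlySmooth F) : ContDiff ℝ ∞ hF.superposition := by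
  rw [contDiff_infty]
  intro n
  induction n generalizing W with
  | zero =>
    exact contDiff_zero.2 (continuous_iff_continuousAt.2 fun f =>
      (hF.hasFDerivAt_superposition f).continuousAt)
  | succ n ih =>
    refine contDiff_succ_iff_hasFDerivAt.2 ⟨_, ?_, hF.hasFDerivAt_superposition⟩
    exact (pointwiseApply T Z W).contDiff.comp (ih hF.fderiv)

end UniformlySmooth

end Superposition

section LocalInverse

variable {Z : Type u} [NormedAddCommGroup Z] [NormedSpace ℝ Z] [CompleteSpace Z]

/-- The inverse function theorem for smooth maps with identity derivative at the origin. -/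
theorem exists_openPartialHomeomorph {G : Z → Z} (hG : ContDiff ℝ ∞ G)
    (h1 : fderiv ℝ G 0 = ContinuousLinearMap.id ℝ Z) :
    ∃ e : OpenPartialHomeomorph Z Z, ⇑e = G ∧ 0 ∈ e.source ∧
      ∀ y ∈ e.target, ContDiffAt ℝ ∞ e.symm y := by
  have hd : HasFDerivAt G ((ContinuousLinearEquiv.refl ℝ Z : Z ≃L[ℝ] Z) : Z →L[ℝ] Z) 0 := by
    have := (hG.differentiable (by simp) 0).hasFDerivAt
    rw [h1] at this
    exact this
  let e := hG.contDiffAt.toOpenPartialHomeomorph G hd (by simp)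
  have hopen : IsOpen {x | fderiv ℝ G x ∈ Set.range ((↑) : (Z ≃L[ℝ] Z) → Z →L[ℝ] Z)} :=
    ContinuousLinearEquiv.isOpen.preimage (hG.continuous_fderiv (by simp))
  refine ⟨e.restrOpen _ hopen, rfl, ?_, fun y hy => ?_⟩
  · refine ⟨hG.contDiffAt.mem_toOpenPartialHomeomorph_source hd (by simp),
      ContinuousLinearEquiv.refl ℝ Z, ?_⟩
    rw [h1]
    rfl
  · have hx := (e.restrOpen _ hopen).map_target hy
    obtain ⟨-, L, hL⟩ := hx
    refine (e.restrOpen _ hopen).contDiffAt_symm (f₀' := L) hy ?_ hG.contDiffAt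
    rw [hL]
    exact (hG.differentiable (by simp) _).hasFDerivAt

end LocalInverse

section WaveMap

open BoundedContinuousFunction MeasureTheory Set
open scoped NNReal

variable {E : Type u} [NormedAddCommGroup E] [NormedSpace ℝ E] [CompleteSpace E]

theorem integrableOn_exp_neg_smul {f : ℝ → E} (hf : Continuous f) {C : ℝ} (hC : ∀ t, ‖f t‖ ≤ C)
    (a : ℝ) : IntegrableOn (fun t => Real.exp (-t) • f t) (Ioi a) := by
  refine Integrable.mono' ((integrableOn_exp_neg_Ioi a).const_mul C)
    (by fun_prop) (Filter.Eventually.of_forall fun t => ?_)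
  rw [norm_smul, Real.norm_eq_abs, Real.abs_exp, mul_comm]
  exact mul_le_mul_of_nonneg_right (hC t) (Real.exp_nonneg _)

theorem norm_integral_exp_neg_smul_le {f : ℝ → E} {C : ℝ} (hC : ∀ t, ‖f t‖ ≤ C) :
    ‖∫ t in Ioi (0 : ℝ), Real.exp (-t) • f t‖ ≤ C := by
  have h := norm_integral_le_of_norm_le (μ := volume.restrict (Ioi (0 : ℝ)))
    (f := fun t => Real.exp (-t) • f t)
    ((integrableOn_exp_neg_Ioi 0).const_mul C) (Filter.Eventually.of_forall fun t => by
      rw [norm_smul, Real.norm_eq_abs, Real.abs_exp, mul_comm]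
      exact mul_le_mul_of_nonneg_right (hC t) (Real.exp_nonneg _))
  rwa [integral_const_mul, integral_exp_neg_Ioi_zero, mul_one] at h

/-- The solution operator `h ↦ -∫ exp (-τ) h (s + τ) dτ` of `u' = u + h` on bounded functions. -/
noncomputable def decayIntegral (E : Type u) [NormedAddCommGroup E] [NormedSpace ℝ E]
    [CompleteSpace E] : (ℝ≥0 →ᵇ E) →L[ℝ] (ℝ≥0 →ᵇ E) :=
  LinearMap.mkContinuous
    { toFun := fun h : ℝ≥0 →ᵇ E => ofNormedAddCommGroup
        (fun s => -∫ τ in Ioi (0 : ℝ), Real.exp (-τ) • h (s + τ.toNNReal))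
        (by
          refine (continuous_of_dominated (bound := fun τ => Real.exp (-τ) * ‖h‖)
            (fun s => ?_) (fun s => ?_) ?_ ?_).neg
          · have : Continuous fun τ : ℝ => Real.exp (-τ) • h (s + τ.toNNReal) := by fun_prop
            exact this.aestronglyMeasurable
          · refine Filter.Eventually.of_forall fun τ => ?_
            rw [norm_smul, Real.norm_eq_abs, Real.abs_exp]
            exact mul_le_mul_of_nonneg_left (h.norm_coe_le_norm _) (Real.exp_nonneg _)
          · exact (integrableOn_exp_neg_Ioi 0).mul_const _
          · exact Filter.Eventually.of_forall fun τ => by fun_prop)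
        ‖h‖ (fun s => by
          rw [norm_neg]
          exact norm_integral_exp_neg_smul_le fun τ => h.norm_coe_le_norm _)
      map_add' := fun h k => by
        ext s
        simp only [coe_ofNormedAddCommGroup, coe_add, Pi.add_apply, smul_add]
        rw [integral_add, neg_add]
        · exact integrableOn_exp_neg_smul (by fun_prop) (fun t => h.norm_coe_le_norm _) _
        · exact integrableOn_exp_neg_smul (by fun_prop) (fun t => k.norm_coe_le_norm _) _
      map_smul' := fun c h => by
        ext s
        simp only [coe_ofNormedAddCommGroup, coe_smul, RingHom.id_apply, smul_comm _ c]
        rw [integral_smul, smul_neg] } 1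
    fun h => by
      rw [one_mul]
      refine (norm_le (norm_nonneg _)).2 fun s => ?_
      simp only [LinearMap.coe_mk, AddHom.coe_mk, coe_ofNormedAddCommGroup, norm_neg]
      exact norm_integral_exp_neg_smul_le fun τ => h.norm_coe_le_norm _

theorem decayIntegral_apply (h : ℝ≥0 →ᵇ E) (s : ℝ≥0) :
    decayIntegral E h s = -∫ τ in Ioi (0 : ℝ), Real.exp (-τ) • h (s + τ.toNNReal) := rfl

theorem decayIntegral_apply_toNNReal (h : ℝ≥0 →ᵇ E) {s : ℝ} (hs : 0 ≤ s) :
    decayIntegral E h s.toNNReal = Real.exp s •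
      ((∫ r in (0 : ℝ)..s, Real.exp (-r) • h r.toNNReal) -
        ∫ r in Ioi (0 : ℝ), Real.exp (-r) • h r.toNNReal) := by
  have hdi : ∀ a, IntegrableOn (fun r : ℝ => Real.exp (-r) • h r.toNNReal) (Ioi a) := fun a =>
    integrableOn_exp_neg_smul (by fun_prop) (fun t => h.norm_coe_le_norm _) _
  rw [decayIntegral_apply, ← intervalIntegral.integral_Ioi_sub_Ioi (hdi 0) hs, sub_sub_cancel_left,
      smul_neg]
  congr 1
  have hpre : (fun τ => s + τ) ⁻¹' Ioi s = Ioi (0 : ℝ) := by ext τ; simp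
  rw [← (measurePreserving_add_left volume s).setIntegral_preimage_emb
    (measurableEmbedding_addLeft s) (fun r : ℝ => Real.exp (-r) • h r.toNNReal) (Ioi s), hpre, ←
        integral_smul]
  refine setIntegral_congr_fun measurableSet_Ioi fun τ hτ => ?_
  simp only [smul_smul, ← Real.exp_add]
  rw [Real.toNNReal_add hs (le_of_lt hτ)]
  congr 2
  ring

theorem hasDerivWithinAt_decayIntegral (h : ℝ≥0 →ᵇ E) {s : ℝ} (hs : 0 ≤ s) :
    HasDerivWithinAt (fun r : ℝ => decayIntegral E h r.toNNReal)
      (decayIntegral E h s.toNNReal + h s.toNNReal) (Ici 0) s := by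
  have hc : Continuous fun r : ℝ => Real.exp (-r) • h r.toNNReal := by fun_prop
  have h1 := (hc.integral_hasStrictDerivAt 0 s).hasDerivAt.sub_const
    (∫ r in Ioi (0 : ℝ), Real.exp (-r) • h r.toNNReal)
  have h2 := ((Real.hasDerivAt_exp s).smul h1).hasDerivWithinAt (s := Ici 0)
  refine (h2.congr_deriv ?_).congr (fun r hr => decayIntegral_apply_toNNReal h hr)
    (decayIntegral_apply_toNNReal h hs)
  rw [decayIntegral_apply_toNNReal h hs, smul_smul, ← Real.exp_add, add_neg_cancel, Real.exp_zero,
    one_smul, add_comm]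

/-- The curve `s ↦ x + exp (-s) w s` attached to `(x, w)`. -/
noncomputable def asymptoticCurve (E : Type u) [NormedAddCommGroup E] [NormedSpace ℝ E] :
    E × (ℝ≥0 →ᵇ E) →L[ℝ] (ℝ≥0 →ᵇ E) :=
  LinearMap.mkContinuous
    { toFun := fun p : E × (ℝ≥0 →ᵇ E) => ofNormedAddCommGroup
        (fun s => p.1 + Real.exp (-(s : ℝ)) • p.2 s) (by fun_prop) (‖p.1‖ + ‖p.2‖) (fun s => by
          refine (norm_add_le _ _).trans (add_le_add le_rfl ?_)
          rw [norm_smul, Real.norm_eq_abs, Real.abs_exp]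
          exact (mul_le_of_le_one_left (norm_nonneg _) (by simp)).trans (p.2.norm_coe_le_norm s))
      map_add' := fun p q => by
        ext s
        simp only [coe_ofNormedAddCommGroup, coe_add, Pi.add_apply, smul_add, Prod.fst_add,
          Prod.snd_add]
        abel
      map_smul' := fun c p => by
        ext s
        simp only [coe_ofNormedAddCommGroup, coe_smul, RingHom.id_apply, Prod.smul_fst,
          Prod.smul_snd, smul_add, smul_comm _ c] } 2
    fun p => by
      refine (norm_le (by positivity)).2 fun s => ?_
      simp only [LinearMap.coe_mk, AddHom.coe_mk, coe_ofNormedAddCommGroup]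
      refine (norm_add_le _ _).trans ?_
      rw [two_mul]
      refine add_le_add (norm_fst_le p) ?_
      rw [norm_smul, Real.norm_eq_abs, Real.abs_exp]
      exact ((mul_le_of_le_one_left (norm_nonneg _) (by simp)).trans
        (p.2.norm_coe_le_norm s)).trans (norm_snd_le p)

theorem asymptoticCurve_apply (p : E × (ℝ≥0 →ᵇ E)) (s : ℝ≥0) :
    asymptoticCurve E p s = p.1 + Real.exp (-(s : ℝ)) • p.2 s := rfl

variable {F : ℝ≥0 → E → E}

/-- The fixed point equation whose solutions are the curves with prescribed asymptotics. -/
theorem exists_asymptotic_solution (hF : UniformlySmooth F) (h0 : ∀ s, F s 0 = 0)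
    (h1 : ∀ s, fderiv ℝ (F s) 0 = 0) :
    ∃ w : E → (ℝ≥0 →ᵇ E), w 0 = 0 ∧ fderiv ℝ w 0 = 0 ∧
      (∀ᶠ x in 𝓝 0, ContDiffAt ℝ ∞ w x) ∧
      (∀ᶠ x in 𝓝 0, w x = decayIntegral E (hF.superposition (asymptoticCurve E (x, w x)))) ∧
      ∀ᶠ p in 𝓝 (0 : E × (ℝ≥0 →ᵇ E)),
        p.2 = decayIntegral E (hF.superposition (asymptoticCurve E p)) → p.2 = w p.1 := by
  set N : E × (ℝ≥0 →ᵇ E) → (ℝ≥0 →ᵇ E) := fun p =>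
    decayIntegral E (hF.superposition (asymptoticCurve E p)) with hN
  have hNs : ContDiff ℝ ∞ N := (decayIntegral E).contDiff.comp
    (hF.contDiff_superposition.comp (asymptoticCurve E).contDiff)
  have hsup0 : hF.superposition 0 = 0 := by ext s; simp [h0]
  have hN0 : N 0 = 0 := by simp [hN, hsup0]
  have hsupd : HasFDerivAt hF.superposition (0 : (ℝ≥0 →ᵇ E) →L[ℝ] (ℝ≥0 →ᵇ E)) 0 := by
    refine (hF.hasFDerivAt_superposition 0).congr_fderiv ?_
    ext f s
    simp [h1]
  have hNd : HasFDerivAt N (0 : E × (ℝ≥0 →ᵇ E) →L[ℝ] (ℝ≥0 →ᵇ E)) 0 := by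
    have hs : HasFDerivAt hF.superposition (0 : (ℝ≥0 →ᵇ E) →L[ℝ] (ℝ≥0 →ᵇ E))
        (asymptoticCurve E 0) := by rwa [map_zero]
    have := (decayIntegral E).hasFDerivAt.comp (0 : E × (ℝ≥0 →ᵇ E))
      (hs.comp (0 : E × (ℝ≥0 →ᵇ E)) (asymptoticCurve E).hasFDerivAt)
    refine this.congr_fderiv ?_
    simp
  set G : E × (ℝ≥0 →ᵇ E) → E × (ℝ≥0 →ᵇ E) := fun p => (p.1, p.2 - N p) with hGdef
  have hG : ContDiff ℝ ∞ G := contDiff_fst.prodMk (contDiff_snd.sub hNs)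
  have hG1 : fderiv ℝ G 0 = ContinuousLinearMap.id ℝ _ := by
    have := (hasFDerivAt_fst (𝕜 := ℝ) (p := (0 : E × (ℝ≥0 →ᵇ E)))).prodMk
      ((hasFDerivAt_snd (𝕜 := ℝ) (p := (0 : E × (ℝ≥0 →ᵇ E)))).sub hNd)
    rw [sub_zero] at this
    exact this.fderiv
  obtain ⟨e, heG, he0, hes⟩ := exists_openPartialHomeomorph hG hG1
  have hG0 : G 0 = 0 := by simp [hGdef, hN0]
  have he00 : e 0 = 0 := by rw [heG, hG0]
  have hesymm0 : e.symm 0 = 0 := by rw [← he00, e.left_inv he0, he00]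
  have h0t : (0 : E × (ℝ≥0 →ᵇ E)) ∈ e.target := by
    rw [← he00]
    exact e.map_source he0
  have htend : Filter.Tendsto (fun x : E => (x, (0 : ℝ≥0 →ᵇ E))) (𝓝 0) (𝓝 0) := by
    have : Continuous fun x : E => (x, (0 : ℝ≥0 →ᵇ E)) := by fun_prop
    exact this.tendsto 0
  have htarget : ∀ᶠ x : E in 𝓝 0, (x, (0 : ℝ≥0 →ᵇ E)) ∈ e.target :=
    htend.eventually (e.open_target.mem_nhds h0t)
  have hinv : ∀ᶠ x : E in 𝓝 0, (e.symm (x, 0)).1 = x ∧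
      (e.symm (x, 0)).2 = N (e.symm (x, 0)) := by
    filter_upwards [htarget] with x hx
    have := e.right_inv hx
    rw [heG] at this
    simp only [hGdef, Prod.mk.injEq] at this
    exact ⟨this.1, sub_eq_zero.1 this.2⟩
  have hfix : ∀ᶠ x : E in 𝓝 0, (e.symm (x, 0)).2 = N (x, (e.symm (x, 0)).2) := by
    filter_upwards [hinv] with x hx
    nth_rw 1 [hx.2]
    congr 1
    exact Prod.ext hx.1 rfl
  have hsmooth : ∀ᶠ x : E in 𝓝 0, ContDiffAt ℝ ∞ (fun x => (e.symm (x, 0)).2) x := by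
    filter_upwards [htarget] with x hx
    exact contDiffAt_snd.comp x ((hes _ hx).comp x (contDiffAt_id.prodMk contDiffAt_const))
  have hw0 : (e.symm ((0 : E), 0)).2 = 0 := by
    rw [show ((0 : E), (0 : ℝ≥0 →ᵇ E)) = 0 from rfl, hesymm0]
    rfl
  refine ⟨fun x => (e.symm (x, 0)).2, hw0, ?_, hsmooth, hfix, ?_⟩
  · have hwd := (hsmooth.self_of_nhds.differentiableAt (by simp)).hasFDerivAt
    have hNd' : HasFDerivAt N (0 : E × (ℝ≥0 →ᵇ E) →L[ℝ] (ℝ≥0 →ᵇ E))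
        ((0 : E), (e.symm ((0 : E), 0)).2) := by rw [hw0]; exact hNd
    have h2 := hNd'.comp (0 : E) ((hasFDerivAt_id (0 : E)).prodMk hwd)
    have h3 := h2.congr_of_eventuallyEq (f₁ := fun x => (e.symm (x, 0)).2) hfix
    rw [h3.fderiv]
    simp
  · filter_upwards [e.open_source.mem_nhds he0] with p hp hpe
    have hGp : e p = (p.1, 0) := by
      rw [heG]
      exact Prod.ext rfl (sub_eq_zero.2 hpe)
    rw [← hGp, e.left_inv hp]

theorem hasDerivWithinAt_asymptoticCurve {x : E} {w f : ℝ≥0 →ᵇ E} (h : w = decayIntegral E f)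
    {s : ℝ} (hs : 0 ≤ s) :
    HasDerivWithinAt (fun r : ℝ => x + Real.exp (-r) • w r.toNNReal)
      (Real.exp (-s) • f s.toNNReal) (Ici 0) s := by
  have h1 := hasDerivWithinAt_decayIntegral f hs
  rw [← h] at h1
  have h2 : HasDerivWithinAt (fun r : ℝ => Real.exp (-r)) (Real.exp (-s) * -1) (Ici 0) s :=
    ((hasDerivAt_neg s).exp).hasDerivWithinAt
  refine ((h2.smul h1).const_add x).congr_deriv ?_
  rw [smul_add, mul_neg_one, neg_smul]
  abel

/-- The variational equation of the fixed point equation. -/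
theorem fderiv_asymptotic_solution (hF : UniformlySmooth F) {w : E → (ℝ≥0 →ᵇ E)}
    (hsmooth : ∀ᶠ x in 𝓝 0, ContDiffAt ℝ ∞ w x)
    (hfix : ∀ᶠ x in 𝓝 0,
      w x = decayIntegral E (hF.superposition (asymptoticCurve E (x, w x)))) :
    ∀ᶠ x in 𝓝 0, ∀ u, fderiv ℝ w x u = decayIntegral E (pointwiseApply ℝ≥0 E E
      (hF.fderiv.superposition (asymptoticCurve E (x, w x)))
      (asymptoticCurve E (u, fderiv ℝ w x u))) := by
  filter_upwards [hsmooth, hfix.eventually_nhds] with x hx hfx u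
  have hwd := (hx.differentiableAt (by simp)).hasFDerivAt
  have h1 := ((decayIntegral E).hasFDerivAt.comp x ((hF.hasFDerivAt_superposition _).comp x
    ((asymptoticCurve E).hasFDerivAt.comp x ((hasFDerivAt_id x).prodMk hwd))))
  have h2 := h1.congr_of_eventuallyEq (f₁ := w) hfx
  have h3 := congrArg (fun L => L u) (hwd.unique h2)
  simpa using h3

end WaveMap

section LinearFlow

variable {E : Type u} [NormedAddCommGroup E] [NormedSpace ℝ E] [CompleteSpace E]

/-- The one-parameter group generated by a bounded operator. -/
noncomputable def linearFlow (A : E →L[ℝ] E) (s : ℝ) : E →L[ℝ] E := NormedSpace.exp (s • A)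

variable (A : E →L[ℝ] E)

@[simp]
theorem linearFlow_zero : linearFlow A 0 = ContinuousLinearMap.id ℝ E := by
  simp [linearFlow, NormedSpace.exp_zero, ContinuousLinearMap.one_def]

theorem linearFlow_add (s t : ℝ) : linearFlow A (s + t) = linearFlow A s ∘L linearFlow A t := by
  let : NormedAlgebra ℚ (E →L[ℝ] E) := NormedAlgebra.restrictScalars ℚ ℝ _
  rw [linearFlow, add_smul]
  exact NormedSpace.exp_add_of_commute (((Commute.refl A).smul_left s).smul_right t)

theorem linearFlow_add_apply (s t : ℝ) (x : E) :
    linearFlow A (s + t) x = linearFlow A s (linearFlow A t x) := by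
  rw [linearFlow_add]
  rfl

theorem hasDerivAt_linearFlow (s : ℝ) : HasDerivAt (linearFlow A) (A ∘L linearFlow A s) s :=
  hasDerivAt_exp_smul_const' A s

theorem contDiff_linearFlow : ContDiff ℝ ∞ (linearFlow A) := by
  have h1 : ContDiff ℝ ∞ (NormedSpace.exp : (E →L[ℝ] E) → (E →L[ℝ] E)) :=
    contDiff_iff_contDiffAt.2 fun x => (NormedSpace.exp_analytic (𝕂 := ℝ) x).contDiffAt
  exact h1.comp (contDiff_id.smul contDiff_const)

theorem norm_linearFlow_le (s : ℝ) : ‖linearFlow A s‖ ≤ Real.exp (|s| * ‖A‖) := by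
  have h : ∀ n : ℕ, ‖((n.factorial : ℝ)⁻¹) • (s • A) ^ n‖ ≤
      ((n.factorial : ℝ)⁻¹) • (|s| * ‖A‖) ^ n := by
    intro n
    rw [norm_smul, smul_eq_mul, Real.norm_of_nonneg (by positivity)]
    refine mul_le_mul_of_nonneg_left ?_ (by positivity)
    rw [← Real.norm_eq_abs, ← norm_smul]
    induction n with
    | zero => simpa [ContinuousLinearMap.one_def] using ContinuousLinearMap.norm_id_le (E := E)
    | succ n ih =>
      rw [pow_succ, pow_succ]
      exact (norm_mul_le _ _).trans (mul_le_mul_of_nonneg_right ih (norm_nonneg _))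
  have h2 : HasSum (fun n : ℕ => ((n.factorial : ℝ)⁻¹) • (|s| * ‖A‖) ^ n)
      (Real.exp (|s| * ‖A‖)) := by
    rw [Real.exp_eq_exp_ℝ]
    exact NormedSpace.exp_series_hasSum_exp' (𝕂 := ℝ) _
  rw [linearFlow, NormedSpace.exp_eq_tsum ℝ]
  exact tsum_of_norm_bounded h2 h

end LinearFlow

section Tools

variable {E F G : Type u} [NormedAddCommGroup E] [NormedSpace ℝ E] [NormedAddCommGroup F]
  [NormedSpace ℝ F] [NormedAddCommGroup G] [NormedSpace ℝ G]

theorem norm_iteratedFDeriv_comp_clm_le {f : E → F} (hf : ContDiff ℝ ∞ f) (L : G →L[ℝ] E) (x : G)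
    (k : ℕ) : ‖iteratedFDeriv ℝ k (fun x => f (L x)) x‖ ≤
      ‖iteratedFDeriv ℝ k f (L x)‖ * ‖L‖ ^ k := by
  have h := L.iteratedFDeriv_comp_right hf x (i := k) (by exact_mod_cast le_top)
  rw [Function.comp_def] at h
  rw [h]
  refine (ContinuousMultilinearMap.norm_compContinuousLinearMap_le _ _).trans ?_
  simp

theorem iteratedFDeriv_prodMk_left {f : ℝ × E → F} (hf : ContDiff ℝ ∞ f) (k : ℕ) (t : ℝ) (x : E) :
    iteratedFDeriv ℝ k (fun z => f (t, z)) x =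
      (iteratedFDeriv ℝ k f (t, x)).compContinuousLinearMap
        fun _ => ContinuousLinearMap.inr ℝ ℝ E := by
  have h := (ContinuousLinearMap.inr ℝ ℝ E).iteratedFDeriv_comp_right
    (f := fun p => f ((t, 0) + p)) (hf.comp (contDiff_const.add contDiff_id)) x (i := k)
    (by exact_mod_cast le_top)
  rw [iteratedFDeriv_comp_add_left] at h
  simpa [Function.comp_def] using h

theorem uniformlySmooth_of_contDiff {T : Type*} [TopologicalSpace T] {f : ℝ × E → F}
    (hf : ContDiff ℝ ∞ f) {τ : T → ℝ} (hτ : Continuous τ)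
    (hb : ∀ (k : ℕ) (R : ℝ), ∃ C, ∀ t x, ‖x‖ ≤ R →
      ‖iteratedFDeriv ℝ k (fun z => f (τ t, z)) x‖ ≤ C) :
    UniformlySmooth fun t x => f (τ t, x) where
  smooth t := hf.comp (contDiff_const.prodMk contDiff_id)
  cont k := by
    simp only [iteratedFDeriv_prodMk_left hf]
    exact (ContinuousMultilinearMap.compContinuousLinearMapL
      fun _ => ContinuousLinearMap.inr ℝ ℝ E).continuous.comp
      ((hf.continuous_iteratedFDeriv (m := k) (by exact_mod_cast le_top)).comp (by fun_prop))
  bdd := hb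

theorem uniformlySmooth_of_contDiff_of_compact [FiniteDimensional ℝ E] {T : Type*}
    [TopologicalSpace T] {f : ℝ × E → F} (hf : ContDiff ℝ ∞ f) {τ : T → ℝ} (hτ : Continuous τ)
    {a b : ℝ} (hab : ∀ t, τ t ∈ Set.Icc a b) : UniformlySmooth fun t x => f (τ t, x) := by
  refine uniformlySmooth_of_contDiff hf hτ fun k R => ?_
  have hc : Continuous fun p : ℝ × E => iteratedFDeriv ℝ k (fun z => f (p.1, z)) p.2 := by
    simp only [iteratedFDeriv_prodMk_left hf]
    exact (ContinuousMultilinearMap.compContinuousLinearMapL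
      fun _ => ContinuousLinearMap.inr ℝ ℝ E).continuous.comp
      (hf.continuous_iteratedFDeriv (m := k) (by exact_mod_cast le_top))
  obtain ⟨C, hC⟩ := ((isCompact_Icc (a := a) (b := b)).prod
    (isCompact_closedBall (0 : E) R)).exists_bound_of_continuousOn hc.continuousOn
  exact ⟨C, fun t x hx => hC (τ t, x) ⟨hab t, by simpa using hx⟩⟩

end Tools

section Conjugation

open BoundedContinuousFunction MeasureTheory Set
open scoped NNReal

variable {E : Type u} [NormedAddCommGroup E] [NormedSpace ℝ E] [FiniteDimensional ℝ E]

/-- The germ at the origin of `φ`, tangent to the identity, maps the vector field `Y` to `X`. -/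
structure Conjugates (φ X Y : E → E) : Prop where
  smooth : ContDiff ℝ ∞ φ
  map_zero : φ 0 = 0
  fderiv_zero : fderiv ℝ φ 0 = ContinuousLinearMap.id ℝ E
  eventually_eq : ∀ᶠ x in 𝓝 0, fderiv ℝ φ x (Y x) = X (φ x)

theorem Conjugates.trans {φ ψ X Y Z : E → E} (h : Conjugates φ X Y) (h' : Conjugates ψ Y Z) :
    Conjugates (φ ∘ ψ) X Z where
  smooth := h.smooth.comp h'.smooth
  map_zero := by simp [h.map_zero, h'.map_zero]
  fderiv_zero := by
    rw [fderiv_comp _ (h.smooth.differentiable (by simp) _) (h'.smooth.differentiable (by simp) _),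
      h'.map_zero, h.fderiv_zero, h'.fderiv_zero]
    rfl
  eventually_eq := by
    have ht : Filter.Tendsto ψ (𝓝 0) (𝓝 0) := by
      simpa [h'.map_zero] using h'.smooth.continuous.tendsto 0
    filter_upwards [h'.eventually_eq, ht.eventually h.eventually_eq] with x hx hx'
    rw [fderiv_comp _ (h.smooth.differentiable (by simp) _) (h'.smooth.differentiable (by simp) _),
      ContinuousLinearMap.comp_apply, hx, hx', Function.comp_apply]

theorem Conjugates.congr {φ X Y X' Y' : E → E} (h : Conjugates φ X Y) (hX : X' =ᶠ[𝓝 0] X)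
    (hY : Y' =ᶠ[𝓝 0] Y) : Conjugates φ X' Y' where
  smooth := h.smooth
  map_zero := h.map_zero
  fderiv_zero := h.fderiv_zero
  eventually_eq := by
    have ht : Filter.Tendsto φ (𝓝 0) (𝓝 0) := by
      simpa [h.map_zero] using h.smooth.continuous.tendsto 0
    filter_upwards [h.eventually_eq, ht.eventually hX, hY] with x hx h1 h2
    rw [h2, hx, h1]

/-- A perturbation of a linear vector field that decays fast enough along the linear flow is
removable: the wave map intertwines the two fields. -/
theorem exists_conjugates_of_uniformlySmooth (A : E →L[ℝ] E) {h : E → E} (h0 : h 0 = 0)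
    (hd : ContDiff ℝ ∞ h) (h1 : fderiv ℝ h 0 = 0)
    (hF : UniformlySmooth fun (s : ℝ≥0) x =>
      Real.exp (s : ℝ) • linearFlow A (-(s : ℝ)) (h (linearFlow A s x))) :
    ∃ φ : E → E, Conjugates φ (fun x => A x + h x) A := by
  set F : ℝ≥0 → E → E := fun s x =>
    Real.exp (s : ℝ) • linearFlow A (-(s : ℝ)) (h (linearFlow A s x)) with hFdef
  have hF0 : ∀ s, F s 0 = 0 := fun s => by simp [hFdef, h0]
  have hF1 : ∀ s, fderiv ℝ (F s) 0 = 0 := by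
    intro s
    have h2 : HasFDerivAt h (0 : E →L[ℝ] E) (linearFlow A s 0) := by
      rw [_root_.map_zero, ← h1]
      exact (hd.differentiable (by simp) 0).hasFDerivAt
    have h3 := (((linearFlow A (-(s : ℝ))).hasFDerivAt.comp (0 : E)
      (h2.comp (0 : E) (linearFlow A s).hasFDerivAt)).const_smul (Real.exp (s : ℝ))).fderiv
    rw [ContinuousLinearMap.zero_comp, ContinuousLinearMap.comp_zero, smul_zero] at h3
    exact h3
  obtain ⟨w, hw0, hw1, hws, hfix, huniq⟩ := exists_asymptotic_solution hF hF0 hF1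
  have hφs : ∀ᶠ x in 𝓝 (0 : E), ContDiffAt ℝ ∞ (fun x => x + w x 0) x := by
    filter_upwards [hws] with x hx
    exact contDiffAt_id.add
      ((evalCLM (β := E) ℝ (0 : ℝ≥0)).contDiff.contDiffAt.comp x hx)
  obtain ⟨φ, hφ, hφe⟩ := exists_contDiff_eventuallyEq hφs
  have hshift : ∀ᶠ x in 𝓝 (0 : E), ∀ t ∈ Icc (0 : ℝ) 1,
      w (linearFlow A t x) 0 = Real.exp (-t) • linearFlow A t (w x t.toNNReal) := by
    set M := Real.exp ‖A‖ with hM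
    have hM0 : 0 < M := Real.exp_pos _
    have hMt : ∀ t ∈ Icc (0 : ℝ) 1, ‖linearFlow A t‖ ≤ M := fun t ht =>
      (norm_linearFlow_le A t).trans (Real.exp_le_exp.2 (by
        rw [abs_of_nonneg ht.1]
        exact mul_le_of_le_one_left (norm_nonneg _) ht.2))
    obtain ⟨r, hr, hru⟩ := Metric.eventually_nhds_iff_ball.1 huniq
    have hsmall : ∀ᶠ x in 𝓝 (0 : E), ‖w x‖ < r / M := by
      have hc : ContinuousAt w 0 := hws.self_of_nhds.continuousAt
      refine hc.norm.eventually_lt continuousAt_const ?_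
      rw [hw0, norm_zero]
      positivity
    filter_upwards [hsmall, hfix, Metric.ball_mem_nhds (0 : E) (div_pos hr hM0)]
      with x hx hfx hxr t ht
    rw [mem_ball_zero_iff] at hxr
    have hbd : ∀ s : ℝ≥0, ‖Real.exp (-t) • linearFlow A t (w x (s + t.toNNReal))‖ ≤ M * ‖w x‖ := by
      intro s
      rw [norm_smul, Real.norm_eq_abs, Real.abs_exp]
      refine (mul_le_of_le_one_left (norm_nonneg _) (Real.exp_le_one_iff.2 (by linarith
          [ht.1]))).trans ?_
      exact (linearFlow A t).le_of_opNorm_le_of_le (hMt t ht) ((w x).norm_coe_le_norm _)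
    let w' : ℝ≥0 →ᵇ E := ofNormedAddCommGroup
      (fun s => Real.exp (-t) • linearFlow A t (w x (s + t.toNNReal))) (by fun_prop) _ hbd
    have hw' : ‖w'‖ ≤ M * ‖w x‖ := (norm_le (by positivity)).2 hbd
    have hmem : (linearFlow A t x, w') ∈ Metric.ball (0 : E × (ℝ≥0 →ᵇ E)) r := by
      rw [mem_ball_zero_iff, Prod.norm_def, max_lt_iff]
      have e : M * (r / M) = r := by field_simp
      constructor
      · calc ‖linearFlow A t x‖ ≤ M * ‖x‖ := (linearFlow A t).le_of_opNorm_le (hMt t ht) x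
          _ < M * (r / M) := by gcongr
          _ = r := e
      · calc ‖w'‖ ≤ M * ‖w x‖ := hw'
          _ < M * (r / M) := by gcongr
          _ = r := e
    have hkey := hru _ hmem (by
      ext s
      change Real.exp (-t) • linearFlow A t (w x (s + t.toNNReal)) = _
      conv_lhs => rw [hfx]
      rw [decayIntegral_apply, decayIntegral_apply, map_neg, smul_neg,
        ← ContinuousLinearMap.integral_comp_comm, ← integral_smul]
      · congr 1
        refine integral_congr_ae (Filter.Eventually.of_forall fun τ => ?_)
        simp only [UniformlySmooth.superposition_apply, asymptoticCurve_apply, hFdef]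
        rw [show (w' (s + τ.toNNReal)) = Real.exp (-t) • linearFlow A t
          (w x (s + τ.toNNReal + t.toNNReal)) from rfl, add_right_comm s t.toNNReal τ.toNNReal]
        set σ := s + τ.toNNReal
        have e1 : ((σ + t.toNNReal : ℝ≥0) : ℝ) = σ + t := by
          rw [NNReal.coe_add, Real.coe_toNNReal _ ht.1]
        rw [e1]
        have e2 : linearFlow A (σ + t) (x + Real.exp (-((σ : ℝ) + t)) • w x (σ + t.toNNReal)) =
            linearFlow A σ (linearFlow A t x + Real.exp (-(σ : ℝ)) • Real.exp (-t) •
              linearFlow A t (w x (σ + t.toNNReal))) := by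
          rw [linearFlow_add_apply, smul_smul, ← Real.exp_add, neg_add, map_add, map_smul]
        rw [e2]
        set y := h (linearFlow A σ (linearFlow A t x + Real.exp (-(σ : ℝ)) • Real.exp (-t) •
              linearFlow A t (w x (σ + t.toNNReal))))
        rw [map_smul, map_smul, ← linearFlow_add_apply, smul_comm (Real.exp (-t)),
          smul_smul (Real.exp (-t)), ← Real.exp_add]
        congr 3
        · ring
        · congr 1
          ring
      · exact integrableOn_exp_neg_smul (by fun_prop)
          (fun τ => (hF.superposition (asymptoticCurve E (x, w x))).norm_coe_le_norm _) _)
    rw [← hkey]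
    change Real.exp (-t) • linearFlow A t (w x (0 + t.toNNReal)) = _
    rw [zero_add]
  refine ⟨φ, hφ, ?_, ?_, ?_⟩
  · rw [hφe.self_of_nhds]
    simp [hw0]
  · rw [hφe.fderiv_eq]
    have h2 := (hasFDerivAt_id (0 : E)).add ((evalCLM (β := E) ℝ (0 : ℝ≥0)).hasFDerivAt.comp (0 : E)
      (hws.self_of_nhds.differentiableAt (by simp)).hasFDerivAt)
    rw [hw1, ContinuousLinearMap.comp_zero, add_zero] at h2
    exact h2.fderiv
  · have hφnear := hφe.eventually_nhds
    filter_upwards [hφnear, hshift, hfix] with x hx hsx hfx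
    have hcurve : Filter.Tendsto (fun t => linearFlow A t x) (𝓝 0) (𝓝 x) := by
      have : Continuous fun t => linearFlow A t x := (contDiff_linearFlow A).continuous.clm_apply
        continuous_const
      simpa using this.tendsto 0
    have hl : HasDerivAt (fun t => linearFlow A t x) (A x) 0 := by
      simpa using (hasDerivAt_linearFlow A 0).clm_apply (hasDerivAt_const (0 : ℝ) x)
    have hleft : HasDerivWithinAt (fun t => φ (linearFlow A t x)) (fderiv ℝ φ x (A x)) (Ici 0) 0 :=
        by
      have hφx : HasFDerivAt φ (fderiv ℝ φ x) (linearFlow A 0 x) := by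
        simpa using (hφ.differentiable (by simp) x).hasFDerivAt
      exact (hφx.comp_hasDerivAt (0 : ℝ) hl).hasDerivWithinAt
    have hc := hasDerivWithinAt_asymptoticCurve (x := x) hfx le_rfl
    have hright := ((hasDerivAt_linearFlow A 0).hasDerivWithinAt (s := Ici 0)).clm_apply hc
    have heq : (fun t => φ (linearFlow A t x)) =ᶠ[𝓝[≥] 0]
        fun t => linearFlow A t (x + Real.exp (-t) • w x t.toNNReal) := by
      filter_upwards [self_mem_nhdsWithin, nhdsWithin_le_nhds (hcurve.eventually hx),
        nhdsWithin_le_nhds (Iic_mem_nhds zero_lt_one)] with t ht hφt ht1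
      rw [hφt, hsx t ⟨ht, ht1⟩, map_add, map_smul]
    have hright' := hright.congr_of_eventuallyEq heq (heq.self_of_nhdsWithin self_mem_Ici)
    have huniq' := (uniqueDiffOn_Ici (0 : ℝ) 0 self_mem_Ici).eq_deriv _ hleft hright'
    rw [huniq', hx.self_of_nhds]
    simp [hFdef, asymptoticCurve_apply]

end Conjugation

section FlatConjugation

open Set
open scoped NNReal

variable {E : Type u} [NormedAddCommGroup E] [NormedSpace ℝ E] [FiniteDimensional ℝ E]

/-- A flat perturbation supported in a set where the linear flow contracts is removable. -/
theorem exists_conjugates_of_flat (A : E →L[ℝ] E) {h : E → E} (hd : ContDiff ℝ ∞ h)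
    (hflat : FlatAtZero h) {K : Set E} (hK : IsClosed K) (hhK : ∀ x, h x ≠ 0 → x ∈ K)
    {c C : ℝ} (hc : 0 < c) (hC : 0 ≤ C)
    (hdecay : ∀ (s : ℝ) (x : E), 0 ≤ s → linearFlow A s x ∈ K →
      ‖linearFlow A s x‖ ≤ C * Real.exp (-(c * s)) * ‖x‖) :
    ∃ φ : E → E, Conjugates φ (fun x => A x + h x) A := by
  refine exists_conjugates_of_uniformlySmooth A hflat.map_zero hd (hflat.fderiv_flat hd).map_zero ?_
  have hsm : ContDiff ℝ ∞ fun p : ℝ × E =>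
      Real.exp p.1 • linearFlow A (-p.1) (h (linearFlow A p.1 p.2)) := by
    have h1 : ContDiff ℝ ∞ fun p : ℝ × E => linearFlow A p.1 := (contDiff_linearFlow A).comp
      contDiff_fst
    have h2 : ContDiff ℝ ∞ fun p : ℝ × E => linearFlow A (-p.1) := (contDiff_linearFlow A).comp
      contDiff_fst.neg
    exact (Real.contDiff_exp.comp contDiff_fst).smul
      (h2.clm_apply (hd.comp (h1.clm_apply contDiff_snd)))
  have hsupp : tsupport h ⊆ K := closure_minimal (fun x hx => hhK x hx) hK
  refine uniformlySmooth_of_contDiff (τ := fun s : ℝ≥0 => (s : ℝ)) hsm NNReal.continuous_coe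
    fun k R => ?_
  obtain ⟨N, hN⟩ := exists_nat_ge ((1 + (k + 1) * ‖A‖) / c)
  rw [div_le_iff₀ hc] at hN
  obtain ⟨D, hD0, hD⟩ := hflat.exists_bound hd k N (C * |R|)
  refine ⟨D * (C * |R|) ^ N, fun s x hx => ?_⟩
  have hs : (0 : ℝ) ≤ s := s.2
  have hxR : ‖x‖ ≤ |R| := hx.trans (le_abs_self R)
  have hE : ∀ t : ℝ, |t| = s → ‖linearFlow A t‖ ≤ Real.exp (s * ‖A‖) := fun t ht => by
    have := norm_linearFlow_le A t
    rwa [ht] at this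
  have hstep : ‖iteratedFDeriv ℝ k h (linearFlow A s x)‖ ≤
      D * (C * Real.exp (-(c * s)) * |R|) ^ N := by
    by_cases hy : linearFlow A s x ∈ K
    · have h1 := hdecay s x hs hy
      have h2 : ‖linearFlow A s x‖ ≤ C * Real.exp (-(c * s)) * |R| := h1.trans (by gcongr)
      have h3 : ‖linearFlow A s x‖ ≤ C * |R| := h2.trans (by
        gcongr
        exact mul_le_of_le_one_right hC (Real.exp_le_one_iff.2 (by nlinarith)))
      exact (hD _ h3).trans (by gcongr)
    · have : linearFlow A s x ∉ tsupport (iteratedFDeriv ℝ k h) := fun hmem =>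
        hy (hsupp (tsupport_iteratedFDeriv_subset k hmem))
      rw [image_eq_zero_of_notMem_tsupport this, norm_zero]
      positivity
  have hsm1 : ContDiff ℝ ∞ fun x => h (linearFlow A s x) := hd.comp (linearFlow A s).contDiff
  have hmain : ‖iteratedFDeriv ℝ k
      (fun z => Real.exp (s : ℝ) • linearFlow A (-(s : ℝ)) (h (linearFlow A s z))) x‖ ≤
      Real.exp s * Real.exp (s * ‖A‖) *
        (D * (C * Real.exp (-(c * s)) * |R|) ^ N * Real.exp (s * ‖A‖) ^ k) := by
    have h1 := (Real.exp (s : ℝ) • linearFlow A (-(s : ℝ))).norm_iteratedFDeriv_comp_left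
      (n := k) (hsm1.contDiffAt (x := x)) (by exact_mod_cast le_top)
    refine h1.trans (mul_le_mul ?_ ?_ (norm_nonneg _) (by positivity))
    · rw [norm_smul, Real.norm_eq_abs, Real.abs_exp]
      gcongr
      exact hE _ (by rw [abs_neg, abs_of_nonneg hs])
    · refine (norm_iteratedFDeriv_comp_clm_le hd _ x k).trans ?_
      gcongr
      exact hE _ (abs_of_nonneg hs)
  refine hmain.trans ?_
  have e : Real.exp s * Real.exp (s * ‖A‖) *
        (D * (C * Real.exp (-(c * s)) * |R|) ^ N * Real.exp (s * ‖A‖) ^ k) =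
      D * (C * |R|) ^ N * Real.exp (s * ((1 + (k + 1) * ‖A‖) - N * c)) := by
    rw [show s * ((1 + (k + 1) * ‖A‖) - N * c) =
      (s : ℝ) + s * ‖A‖ + N * (-(c * s)) + k * (s * ‖A‖) by ring, Real.exp_add, Real.exp_add,
      Real.exp_add, Real.exp_nat_mul, Real.exp_nat_mul, mul_pow, mul_pow, mul_pow]
    ring
  rw [e]
  refine mul_le_of_le_one_right (by positivity) (Real.exp_le_one_iff.2 ?_)
  exact mul_nonpos_of_nonneg_of_nonpos hs (by linarith)

/-- A bilinear form which is strictly increasing along the linear flow, with a cone constant. -/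
structure IsLyapunov (A : E →L[ℝ] E) (b : E →L[ℝ] E →L[ℝ] ℝ) (m δ : ℝ) : Prop where
  symm : ∀ x y, b x y = b y x
  m_pos : 0 < m
  le : ∀ x, m * ‖x‖ ^ 2 ≤ b (A x) x
  δ_pos : 0 < δ
  cone : ∀ x, 2 * δ * |b (A (A x)) x + b (A x) (A x)| ≤ b (A x) x

theorem IsLyapunov.neg {A : E →L[ℝ] E} {b : E →L[ℝ] E →L[ℝ] ℝ} {m δ : ℝ}
    (h : IsLyapunov A b m δ) :
    IsLyapunov (-A) (-b) m δ where
  symm x y := by simp [h.symm x y]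
  m_pos := h.m_pos
  le x := by simpa using h.le x
  δ_pos := h.δ_pos
  cone x := by
    have := h.cone x
    rw [← abs_neg] at this
    simpa [add_comm] using this

theorem IsLyapunov.decay {A : E →L[ℝ] E} {b : E →L[ℝ] E →L[ℝ] ℝ} {m δ : ℝ}
    (h : IsLyapunov A b m δ) : ∃ c C : ℝ, 0 < c ∧ 0 ≤ C ∧ ∀ (s : ℝ) (x : E), 0 ≤ s →
      linearFlow A s x ∈ {x | b x x ≤ δ * b (A x) x} →
      ‖linearFlow A s x‖ ≤ C * Real.exp (-(c * s)) * ‖x‖ := by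
  have hm := h.m_pos
  have hδ := h.δ_pos
  set c₁ := ‖b‖ / m + 2 * δ with hc₁
  have hc₁0 : 0 < c₁ := by positivity
  have hS0 : ∀ x, 0 ≤ b (A x) x := fun x => le_trans (by positivity) (h.le x)
  have hR : ∀ x, |2 * δ * b (A x) x - b x x| ≤ c₁ * b (A x) x := by
    intro x
    have h1 : |b x x| ≤ ‖b‖ / m * b (A x) x := by
      calc |b x x| ≤ ‖b‖ * ‖x‖ * ‖x‖ := b.le_opNorm₂ x x
        _ = ‖b‖ / m * (m * ‖x‖ ^ 2) := by field_simp
        _ ≤ _ := by gcongr; exact h.le x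
    have h2 := hS0 x
    rw [hc₁, add_mul]
    calc |2 * δ * b (A x) x - b x x| ≤ |2 * δ * b (A x) x| + |b x x| := abs_sub _ _
      _ ≤ _ := by rw [abs_of_nonneg (by positivity)]; linarith
  refine ⟨1 / (2 * c₁), √(c₁ * (‖b‖ * ‖A‖) / (δ * m)), by positivity, by positivity, ?_⟩
  intro s x hs hK
  set y := fun r => linearFlow A r x with hy
  have hyd : ∀ r, HasDerivAt y (A (y r)) r := fun r => by
    simpa using (hasDerivAt_linearFlow A r).clm_apply (hasDerivAt_const r x)
  have hAyd : ∀ r, HasDerivAt (fun r => A (y r)) (A (A (y r))) r := fun r =>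
    A.hasFDerivAt.comp_hasDerivAt r (hyd r)
  have hbd : ∀ {f g : ℝ → E} {f' g' : E} {r : ℝ}, HasDerivAt f f' r → HasDerivAt g g' r →
      HasDerivAt (fun r => b (f r) (g r)) (b f' (g r) + b (f r) g') r := fun hf hg =>
    (b.hasFDerivAt.comp_hasDerivAt _ hf).clm_apply hg
  set p := fun r => 2 * δ * b (A (y r)) (y r) - b (y r) (y r) with hp
  have hpd : ∀ r, HasDerivAt p (2 * δ * (b (A (A (y r))) (y r) + b (A (y r)) (A (y r))) -
      (b (A (y r)) (y r) + b (y r) (A (y r)))) r := fun r =>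
    ((hbd (hAyd r) (hyd r)).const_mul (2 * δ)).sub (hbd (hyd r) (hyd r))
  have hle : ∀ r, (2 * δ * (b (A (A (y r))) (y r) + b (A (y r)) (A (y r))) -
      (b (A (y r)) (y r) + b (y r) (A (y r)))) ≤ -(1 / c₁) * p r := by
    intro r
    have h1 := h.cone (y r)
    have h1' := mul_le_mul_of_nonneg_left
      (le_abs_self (b (A (A (y r))) (y r) + b (A (y r)) (A (y r)))) (by positivity : 0 ≤ 2 * δ)
    have h2 := h.symm (y r) (A (y r))
    have h3 := (abs_le.1 (hR (y r))).2
    have h4 : 1 / c₁ * p r ≤ b (A (y r)) (y r) := by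
      rw [one_div, inv_mul_le_iff₀ hc₁0]
      exact h3
    linarith
  have hanti : Antitone fun r => Real.exp (r / c₁) * p r := by
    have hder : ∀ r, HasDerivAt (fun r => Real.exp (r / c₁) * p r) _ r := fun r =>
      ((hasDerivAt_id r).div_const c₁).exp.mul (hpd r)
    refine antitone_of_hasDerivAt_nonpos hder fun r => ?_
    have := mul_le_mul_of_nonneg_left (hle r) (Real.exp_nonneg (r / c₁))
    simp only [id, Pi.zero_apply]
    linarith
  have h1 := hanti hs
  simp only [zero_div, Real.exp_zero, one_mul] at h1
  have h2 : p 0 ≤ c₁ * (‖b‖ * ‖A‖) * ‖x‖ ^ 2 := by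
    have h3 := (abs_le.1 (hR x)).2
    have h4 : b (A x) x ≤ ‖b‖ * ‖A‖ * ‖x‖ ^ 2 := by
      calc b (A x) x ≤ ‖b‖ * ‖A x‖ * ‖x‖ := (le_abs_self _).trans (b.le_opNorm₂ _ _)
        _ ≤ ‖b‖ * (‖A‖ * ‖x‖) * ‖x‖ := by gcongr; exact A.le_opNorm x
        _ = _ := by ring
    have h5 : p 0 = 2 * δ * b (A x) x - b x x := by simp [hp, hy]
    rw [h5, mul_assoc c₁]
    exact h3.trans (by gcongr)
  have h6 : δ * m * ‖y s‖ ^ 2 ≤ p s := by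
    have h7 := h.le (y s)
    have h8 : b (y s) (y s) ≤ δ * b (A (y s)) (y s) := hK
    simp only [hp]
    nlinarith
  have h9 : ‖y s‖ ^ 2 ≤ (√(c₁ * (‖b‖ * ‖A‖) / (δ * m)) * Real.exp (-(1 / (2 * c₁) * s)) * ‖x‖) ^ 2
      := by
    rw [mul_pow, mul_pow, Real.sq_sqrt (by positivity), ← Real.exp_nat_mul]
    have e1 : ((2 : ℕ) : ℝ) * -(1 / (2 * c₁) * s) = -(s / c₁) := by
      push_cast
      field_simp
    rw [e1, div_mul_eq_mul_div, div_mul_eq_mul_div, le_div_iff₀ (by positivity), Real.exp_neg]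
    have h10 := Real.exp_pos (s / c₁)
    rw [mul_right_comm, ← div_eq_mul_inv, le_div_iff₀ h10]
    nlinarith
  exact (pow_le_pow_iff_left₀ (norm_nonneg _) (by positivity) two_ne_zero).1 h9

end FlatConjugation

section ConeCutoff

open Set

variable {E : Type u} [NormedAddCommGroup E] [NormedSpace ℝ E] [FiniteDimensional ℝ E]

theorem exists_bound_iteratedFDeriv_of_homogeneous {χ : E → ℝ} (hs : ∀ x ≠ 0, ContDiffAt ℝ ∞ χ x)
    (hh : ∀ (a : ℝ) x, 0 < a → χ (a • x) = χ x) (k : ℕ) :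
    ∃ C, 0 ≤ C ∧ ∀ x ≠ 0, ‖iteratedFDeriv ℝ k χ x‖ * ‖x‖ ^ k ≤ C := by
  have hcont : ContinuousOn (iteratedFDeriv ℝ k χ) (Metric.sphere 0 1) := fun x hx =>
    ((hs x (ne_zero_of_mem_unit_sphere ⟨x, hx⟩)).continuousAt_iteratedFDeriv
      (by exact_mod_cast le_top)).continuousWithinAt
  obtain ⟨C, hC⟩ := (isCompact_sphere (0 : E) 1).exists_bound_of_continuousOn hcont
  refine ⟨|C|, abs_nonneg _, fun x hx => ?_⟩
  have hx' : 0 < ‖x‖ := norm_pos_iff.2 hx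
  have ha : 0 < ‖x‖⁻¹ := inv_pos.2 hx'
  let g : E ≃L[ℝ] E := ContinuousLinearEquiv.smulLeft (Units.mk0 _ ha.ne')
  have hg : ∀ y, g y = ‖x‖⁻¹ • y := fun y => rfl
  have h1 : χ ∘ g = χ := funext fun y => hh _ y ha
  have h2 := g.iteratedFDerivWithin_comp_right χ (s := univ) uniqueDiffOn_univ (mem_univ (g x)) k
  rw [preimage_univ, iteratedFDerivWithin_univ, iteratedFDerivWithin_univ, h1] at h2
  have h3 : ‖iteratedFDeriv ℝ k χ (g x)‖ ≤ |C| := (hC _ (by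
    rw [mem_sphere_zero_iff_norm, hg, norm_smul, norm_inv, norm_norm,
      inv_mul_cancel₀ hx'.ne'])).trans (le_abs_self C)
  have hgn : ‖(g : E →L[ℝ] E)‖ ≤ ‖x‖⁻¹ := ContinuousLinearMap.opNorm_le_bound _ ha.le fun y => by
    rw [ContinuousLinearEquiv.coe_coe, hg, norm_smul, norm_inv, norm_norm]
  have h4 : ‖iteratedFDeriv ℝ k χ x‖ ≤ |C| * ‖x‖⁻¹ ^ k := by
    rw [h2]
    refine (ContinuousMultilinearMap.norm_compContinuousLinearMap_le _ _).trans ?_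
    rw [Finset.prod_const, Finset.card_univ, Fintype.card_fin]
    gcongr
  calc _ ≤ |C| * ‖x‖⁻¹ ^ k * ‖x‖ ^ k := by gcongr
    _ = |C| := by rw [mul_assoc, ← mul_pow, inv_mul_cancel₀ hx'.ne', one_pow, mul_one]

theorem FlatAtZero.contDiff_smul_of_homogeneous {χ : E → ℝ} (hs : ∀ x ≠ 0, ContDiffAt ℝ ∞ χ x)
    (hh : ∀ (a : ℝ) x, 0 < a → χ (a • x) = χ x) {g : E → E} (hg : FlatAtZero g)
    (hgs : ContDiff ℝ ∞ g) : ContDiff ℝ ∞ fun x => χ x • g x := by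
  refine contDiff_of_flat_derivatives (by simp [hg.map_zero])
    (fun x hx => (hs x hx).smul hgs.contDiffAt) fun k N => ?_
  choose C hC0 hC using exists_bound_iteratedFDeriv_of_homogeneous hs hh
  choose D hD0 hD using fun i => hg.exists_bound hgs (k - i) (N + i) 1
  refine Asymptotics.IsBigO.of_bound
    (∑ i ∈ Finset.range (k + 1), (k.choose i : ℝ) * C i * D i) ?_
  have hball : ∀ᶠ x : E in 𝓝[≠] 0, ‖x‖ ≤ 1 := nhdsWithin_le_nhds <| by
    filter_upwards [Metric.closedBall_mem_nhds (0 : E) one_pos] with x hx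
    simpa using hx
  filter_upwards [hball, self_mem_nhdsWithin] with x hx1 hx
  have hx' : 0 < ‖x‖ := norm_pos_iff.2 hx
  have ho : IsOpen ({0}ᶜ : Set E) := isOpen_compl_singleton
  have h1 := norm_iteratedFDerivWithin_smul_le (s := ({0}ᶜ : Set E)) (n := k) (N := ∞)
    (fun y hy => (hs y hy).contDiffWithinAt) hgs.contDiffOn ho.uniqueDiffOn hx
    (by exact_mod_cast le_top)
  simp only [iteratedFDerivWithin_of_isOpen _ ho hx] at h1
  rw [norm_norm, norm_pow, norm_norm, Finset.sum_mul]
  refine h1.trans (Finset.sum_le_sum fun i _ => ?_)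
  have h2 := hC i x hx
  have h3 := hD i x hx1
  calc _ ≤ (k.choose i : ℝ) * ‖iteratedFDeriv ℝ i χ x‖ * (D i * ‖x‖ ^ (N + i)) := by gcongr
    _ = (k.choose i : ℝ) * (‖iteratedFDeriv ℝ i χ x‖ * ‖x‖ ^ i) * D i * ‖x‖ ^ N := by ring
    _ ≤ (k.choose i : ℝ) * C i * D i * ‖x‖ ^ N := by
      have := hD0 i
      gcongr

theorem FlatAtZero.of_norm_le {f g : E → E} (hg : FlatAtZero g)
    (h : ∀ᶠ x in 𝓝 0, ‖f x‖ ≤ ‖g x‖) : FlatAtZero f := fun N =>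
  (Asymptotics.IsBigO.of_bound 1 (by simpa using h)).trans (hg N)

/-- A homogeneous cutoff separating the cones where the Lyapunov form is positive and negative. -/
theorem IsLyapunov.exists_cutoff {A : E →L[ℝ] E} {b : E →L[ℝ] E →L[ℝ] ℝ} {m δ : ℝ}
    (h : IsLyapunov A b m δ) : ∃ χ : E → ℝ, (∀ x ≠ 0, ContDiffAt ℝ ∞ χ x) ∧
      (∀ (a : ℝ) x, 0 < a → χ (a • x) = χ x) ∧ (∀ x, 0 ≤ χ x ∧ χ x ≤ 1) ∧
      (∀ x ≠ 0, χ x ≠ 0 → b x x ≤ δ * b (A x) x) ∧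
      (∀ x ≠ 0, χ x ≠ 1 → -(δ / 2 * b (A x) x) ≤ b x x) := by
  have hδ := h.δ_pos
  have hS : ∀ x ≠ 0, 0 < b (A x) x := fun x hx =>
    lt_of_lt_of_le (mul_pos h.m_pos (pow_pos (norm_pos_iff.2 hx) 2)) (h.le x)
  refine ⟨fun x => Real.smoothTransition ((δ / 2 - b x x / b (A x) x) / δ), ?_, ?_, ?_, ?_, ?_⟩
  · intro x hx
    refine Real.smoothTransition.contDiffAt.comp x (ContDiffAt.div_const (contDiffAt_const.sub ?_)
        _)
    refine ContDiffAt.div ?_ ?_ (hS x hx).ne'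
    · exact (b.contDiff.clm_apply contDiff_id).contDiffAt
    · exact ((b.contDiff.comp A.contDiff).clm_apply contDiff_id).contDiffAt
  · intro a x ha
    simp only [map_smul, smul_apply, smul_eq_mul]
    rw [mul_div_mul_left _ _ ha.ne', mul_div_mul_left _ _ ha.ne']
  · exact fun x => ⟨Real.smoothTransition.nonneg _, Real.smoothTransition.le_one _⟩
  · intro x hx h1
    have h2 : 0 < (δ / 2 - b x x / b (A x) x) / δ := by
      by_contra! h3
      exact h1 (Real.smoothTransition.zero_of_nonpos h3)
    rw [lt_div_iff₀ hδ, zero_mul, sub_pos, div_lt_iff₀ (hS x hx)] at h2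
    nlinarith [hS x hx]
  · intro x hx h1
    have h2 : (δ / 2 - b x x / b (A x) x) / δ < 1 := by
      by_contra! h3
      exact h1 (Real.smoothTransition.one_of_one_le h3)
    rw [div_lt_iff₀ hδ, sub_lt_comm, lt_div_iff₀ (hS x hx)] at h2
    linarith

end ConeCutoff

section FlatLinearization

open Set

variable {E F G : Type u} [NormedAddCommGroup E] [NormedSpace ℝ E] [FiniteDimensional ℝ E]
  [NormedAddCommGroup F] [NormedSpace ℝ F] [NormedAddCommGroup G] [NormedSpace ℝ G]

theorem eventually_contDiffAt_inverse {L : E → E →L[ℝ] E} (hL : ContDiff ℝ ∞ L)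
    (h0 : L 0 = ContinuousLinearMap.id ℝ E) :
    ∀ᶠ x in 𝓝 0, ContDiffAt ℝ ∞ (fun y => (L y).inverse) x ∧
      (∀ v, L x ((L x).inverse v) = v) ∧ ∀ v, (L x).inverse (L x v) = v := by
  have : CompleteSpace E := FiniteDimensional.complete ℝ E
  have h1 : ∀ᶠ x in 𝓝 0, L x ∈ range ((↑) : (E ≃L[ℝ] E) → E →L[ℝ] E) := by
    refine hL.continuous.continuousAt.eventually_mem (ContinuousLinearEquiv.isOpen.mem_nhds ?_)
    exact ⟨ContinuousLinearEquiv.refl ℝ E, by rw [h0]; rfl⟩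
  filter_upwards [h1] with x hx
  have hinv : (L x).IsInvertible := hx
  obtain ⟨e, he⟩ := hx
  refine ⟨?_, hinv.self_apply_inverse, fun v => ?_⟩
  · exact ContDiffAt.comp x (by rw [← he]; exact contDiffAt_map_inverse e) hL.contDiffAt
  · rw [← he]; simp

theorem FlatAtZero.comp {f : E → F} (hf : FlatAtZero f) {φ : E → E} (hφ : DifferentiableAt ℝ φ 0)
    (h0 : φ 0 = 0) : FlatAtZero (f ∘ φ) := fun N => by
  have h1 : φ =O[𝓝 0] fun x => x := by simpa [h0] using hφ.isBigO_sub
  have h2 : Filter.Tendsto φ (𝓝 0) (𝓝 0) := by simpa [h0] using hφ.continuousAt.tendsto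
  exact ((hf N).comp_tendsto h2).trans (h1.norm_norm.pow N)

theorem FlatAtZero.clm_apply {f : E → F} (hf : FlatAtZero f) {L : E → F →L[ℝ] G}
    (hL : ContinuousAt L 0) : FlatAtZero fun x => L x (f x) := fun N => by
  have h1 : (fun x => L x (f x)) =O[𝓝 0] fun x => ‖L x‖ * ‖f x‖ :=
    Asymptotics.IsBigO.of_norm_le fun x => (L x).le_opNorm _
  have h2 : (fun x => ‖L x‖) =O[𝓝 0] fun _ => (1 : ℝ) :=
    hL.norm.isBigO_one ℝ
  simpa using h1.trans (h2.mul (hf N).norm_left)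

theorem FlatAtZero.smul {f : E → F} (hf : FlatAtZero f) {c : E → ℝ} (hc : ContinuousAt c 0) :
    FlatAtZero fun x => c x • f x := fun N => by
  have h2 : c =O[𝓝 0] fun _ => (1 : ℝ) := hc.isBigO_one ℝ
  simpa using h2.smul (hf N)

theorem IsLyapunov.eventually_cone {A : E →L[ℝ] E} {b : E →L[ℝ] E →L[ℝ] ℝ} {m δ : ℝ}
    (h : IsLyapunov A b m δ) {φ : E → E} (h0 : φ 0 = 0)
    (hd : HasFDerivAt φ (ContinuousLinearMap.id ℝ E) 0) :
    ∀ᶠ x in 𝓝 0, -(δ / 2 * b (A (φ x)) (φ x)) ≤ b (φ x) (φ x) → -(δ * b (A x) x) ≤ b x x := by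
  have hδ := h.δ_pos
  have hm := h.m_pos
  set c : E →L[ℝ] E →L[ℝ] ℝ := b + (δ / 2) • b.comp A with hc
  have hcv : ∀ x y, c x y = b x y + δ / 2 * b (A x) y := fun x y => by simp [hc]
  set ε := min 1 (δ * m / (6 * (‖c‖ + 1))) with hε
  have hε0 : 0 < ε := by positivity
  have hε1 : ε ≤ 1 := min_le_left _ _
  have hε2 : 3 * ε * ‖c‖ ≤ δ / 2 * m := by
    have h1 : ε ≤ δ * m / (6 * (‖c‖ + 1)) := min_le_right _ _
    rw [le_div_iff₀ (by positivity)] at h1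
    nlinarith
  have h1 := hd.isLittleO.def hε0
  filter_upwards [h1] with x hx hpos
  simp only [h0, sub_zero, ContinuousLinearMap.id_apply] at hx
  have h2 : ‖φ x‖ ≤ 2 * ‖x‖ := by
    calc ‖φ x‖ = ‖(φ x - x) + x‖ := by rw [sub_add_cancel]
      _ ≤ ε * ‖x‖ + ‖x‖ := (norm_add_le _ _).trans (by gcongr)
      _ ≤ 2 * ‖x‖ := by nlinarith [norm_nonneg x]
  have h3 : c (φ x) (φ x) - c x x = c (φ x - x) (φ x) + c x (φ x - x) := by
    simp only [map_sub, sub_apply]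
    ring
  have h4 : |c (φ x) (φ x) - c x x| ≤ δ / 2 * b (A x) x := by
    calc |c (φ x) (φ x) - c x x| ≤ |c (φ x - x) (φ x)| + |c x (φ x - x)| := by
          rw [h3]; exact abs_add_le _ _
      _ ≤ ‖c‖ * ‖φ x - x‖ * ‖φ x‖ + ‖c‖ * ‖x‖ * ‖φ x - x‖ :=
          add_le_add (c.le_opNorm₂ _ _) (c.le_opNorm₂ _ _)
      _ ≤ ‖c‖ * (ε * ‖x‖) * (2 * ‖x‖) + ‖c‖ * ‖x‖ * (ε * ‖x‖) := by gcongr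
      _ = 3 * ε * ‖c‖ * ‖x‖ ^ 2 := by ring
      _ ≤ δ / 2 * m * ‖x‖ ^ 2 := by gcongr
      _ = δ / 2 * (m * ‖x‖ ^ 2) := by ring
      _ ≤ _ := by gcongr; exact h.le x
  have h5 := (abs_le.1 h4).2
  rw [hcv, hcv] at h5
  linarith

theorem Conjugates.hasFDerivAt {φ X Y : E → E} (h : Conjugates φ X Y) :
    HasFDerivAt φ (ContinuousLinearMap.id ℝ E) 0 :=
  h.fderiv_zero ▸ (h.smooth.differentiable (by simp) 0).hasFDerivAt

theorem Conjugates.neg {φ X Y : E → E} (h : Conjugates φ X Y) :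
    Conjugates φ (fun x => -X x) (fun x => -Y x) where
  smooth := h.smooth
  map_zero := h.map_zero
  fderiv_zero := h.fderiv_zero
  eventually_eq := by
    filter_upwards [h.eventually_eq] with x hx
    rw [map_neg, hx]

/-- Flat perturbations of a linear vector field admitting a Lyapunov form are removable. -/
theorem IsLyapunov.exists_conjugates {A : E →L[ℝ] E} {b : E →L[ℝ] E →L[ℝ] ℝ} {m δ : ℝ}
    (h : IsLyapunov A b m δ) {g : E → E} (hg : FlatAtZero g) (hgs : ContDiff ℝ ∞ g) :
    ∃ φ, Conjugates φ (fun x => A x + g x) A := by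
  obtain ⟨χ, hχs, hχh, hχ01, hχp, hχn⟩ := h.exists_cutoff
  have hclosed : ∀ (B : E →L[ℝ] E) (c : E →L[ℝ] E →L[ℝ] ℝ),
      IsClosed {x | c x x ≤ δ * c (B x) x} := fun B c => by
    refine isClosed_le ?_ ?_
    · exact (c.continuous.clm_apply continuous_id)
    · exact continuous_const.mul ((c.continuous.comp B.continuous).clm_apply continuous_id)
  have hg₁s : ContDiff ℝ ∞ fun x => χ x • g x := hg.contDiff_smul_of_homogeneous hχs hχh hgs
  have hg₁ : FlatAtZero fun x => χ x • g x := hg.of_norm_le <| Filter.Eventually.of_forall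
    fun x => by
      rw [norm_smul, Real.norm_of_nonneg (hχ01 x).1]
      exact mul_le_of_le_one_left (norm_nonneg _) (hχ01 x).2
  have hg₂ : FlatAtZero fun x => g x - χ x • g x := fun N => (hg N).sub (hg₁ N)
  have hg₂s := hgs.sub hg₁s
  obtain ⟨c, C, hc, hC, hdecay⟩ := h.decay
  obtain ⟨φ, hφ⟩ := exists_conjugates_of_flat A hg₁s hg₁ (hclosed A b) (fun x hx => by
    rcases eq_or_ne x 0 with rfl | hx0
    · simp
    · exact hχp x hx0 fun h0 => hx (by simp [h0])) hc hC hdecay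
  have hDφ : ContDiff ℝ ∞ (fderiv ℝ φ) := hφ.smooth.fderiv_right (by simp)
  have hinv := eventually_contDiffAt_inverse hDφ hφ.fderiv_zero
  obtain ⟨β, hβ, hβ1, -, hβs, -⟩ := exists_smooth_cutoff
    (hinv.and (h.eventually_cone hφ.map_zero hφ.hasFDerivAt))
  set k : E → E := fun x => (fderiv ℝ φ x).inverse (g (φ x) - χ (φ x) • g (φ x)) with hk
  have hks : ContDiff ℝ ∞ fun x => β x • k x := contDiff_cutoff_smul hβ fun x hx =>
    (hβs hx).1.1.clm_apply (hg₂s.comp hφ.smooth).contDiffAt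
  have hkf : FlatAtZero fun x => β x • k x :=
    ((hg₂.comp hφ.hasFDerivAt.differentiableAt hφ.map_zero).clm_apply
      hinv.self_of_nhds.1.continuousAt).smul hβ.continuous.continuousAt
  have hkcone : ∀ x, -(β x • k x) ≠ 0 →
      x ∈ {x | (-b) x x ≤ δ * (-b) ((-A) x) x} := by
    intro x hx
    have hβx : β x ≠ 0 := fun h0 => hx (by simp [h0])
    have hkx : g (φ x) - χ (φ x) • g (φ x) ≠ 0 := fun h0 => hx (by
      simp only [hk, h0, map_zero, smul_zero, neg_zero])
    have hx1 : φ x ≠ 0 := fun h0 => hkx (by simp [h0, hg.map_zero])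
    have hx2 : χ (φ x) ≠ 1 := fun h0 => hkx (by simp [h0])
    have := (hβs (subset_tsupport β hβx)).2 (hχn _ hx1 hx2)
    simp only [mem_ofPred_eq, neg_apply, map_neg, neg_neg]
    linarith
  obtain ⟨c', C', hc', hC', hdecay'⟩ := h.neg.decay
  obtain ⟨ψ, hψ⟩ := exists_conjugates_of_flat (-A) hks.neg (fun N => (hkf N).neg_left)
    (hclosed _ _) hkcone hc' hC' hdecay'
  have hψ' : Conjugates ψ (fun x => A x + k x) A := by
    refine hψ.neg.congr ?_ (Filter.Eventually.of_forall fun x => by simp)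
    filter_upwards [hβ1] with x hx
    rw [hx, one_smul, neg_apply, ← neg_add, neg_neg]
  refine ⟨φ ∘ ψ, Conjugates.trans ⟨hφ.smooth, hφ.map_zero, hφ.fderiv_zero, ?_⟩ hψ'⟩
  filter_upwards [hφ.eventually_eq, hinv] with x hx hx'
  rw [map_add, hx, hk, hx'.2.1]
  abel

end FlatLinearization

section Sylvester

open Polynomial Function
open scoped IsMulCommutative

theorem isUnit_of_forall_algHom_ne_zero {S : Type u} [CommRing S] [Algebra ℝ S]
    [Module.Finite ℝ S] {T : S} (h : ∀ f : S →ₐ[ℝ] ℂ, f T ≠ 0) : IsUnit T := by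
  by_contra hT
  obtain ⟨P, hP, hTP⟩ := exists_max_ideal_of_mem_nonunits (a := T) hT
  let _ : Field (S ⧸ P) := Ideal.Quotient.field P
  have : Algebra.IsAlgebraic ℝ (S ⧸ P) := Algebra.IsAlgebraic.of_finite ℝ (S ⧸ P)
  let f : S ⧸ P →ₐ[ℝ] ℂ := IsAlgClosed.lift
  refine h (f.comp (Ideal.Quotient.mkₐ ℝ P)) ?_
  have : Ideal.Quotient.mkₐ ℝ P T = 0 := Ideal.Quotient.eq_zero_iff_mem.2 hTP
  rw [AlgHom.comp_apply, this, map_zero]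

/-- Joint spectrum of finitely many commuting endomorphisms. -/
theorem isUnit_sum_sub_of_commute {M : Type u} [AddCommGroup M] [Module ℝ M]
    [FiniteDimensional ℝ M] {k : ℕ} (D : Fin k → Module.End ℝ M) (C : Module.End ℝ M)
    (hDD : ∀ i j, D i * D j = D j * D i) (hDC : ∀ i, D i * C = C * D i) {p q : ℝ[X]}
    (hp : ∀ i, aeval (D i) p = 0) (hq : aeval C q = 0)
    (hres : ∀ (z : Fin k → ℂ) (μ : ℂ), (∀ i, aeval (z i) p = 0) → aeval μ q = 0 →
      ∑ i, z i ≠ μ) : IsUnit (∑ i, D i - C) := by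
  set s : Set (Module.End ℝ M) := insert C (Set.range D) with hs
  have hcomm : ∀ x ∈ s, ∀ y ∈ s, x * y = y * x := by
    rintro x (rfl | ⟨i, rfl⟩) y (rfl | ⟨j, rfl⟩)
    · rfl
    · exact (hDC j).symm
    · exact hDC i
    · exact hDD i j
  let S := Algebra.adjoin ℝ s
  have : IsMulCommutative S := Algebra.isMulCommutative_adjoin ℝ hcomm
  let d : Fin k → S := fun i => ⟨D i, Algebra.subset_adjoin (by simp [hs])⟩
  let c : S := ⟨C, Algebra.subset_adjoin (by simp [hs])⟩
  have hd : ∀ i, aeval (d i) p = 0 := fun i => Subtype.ext <| by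
    have := aeval_algHom_apply S.val (d i) p
    exact this.symm.trans (hp i)
  have hc : aeval c q = 0 := Subtype.ext <| by
    have := aeval_algHom_apply S.val c q
    exact this.symm.trans hq
  have hu : IsUnit (∑ i, d i - c) := by
    refine isUnit_of_forall_algHom_ne_zero (S := S) fun f hf => ?_
    rw [map_sub, map_sum, sub_eq_zero] at hf
    refine hres _ _ (fun i => ?_) ?_ hf
    · rw [aeval_algHom_apply, hd, map_zero]
    · rw [aeval_algHom_apply, hc, map_zero]
  have := hu.map S.val
  simpa [d, c] using this

variable {E W : Type u} [AddCommGroup E] [Module ℝ E] [AddCommGroup W] [Module ℝ W]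

/-- Insertion of an endomorphism in one slot of a multilinear map. -/
def slotInsertion (k : ℕ) (W : Type u) [AddCommGroup W] [Module ℝ W] (A : Module.End ℝ E)
    (i : Fin k) : Module.End ℝ (MultilinearMap ℝ (fun _ : Fin k => E) W) where
  toFun m := m.compLinearMap fun j => if j = i then A else LinearMap.id
  map_add' _ _ := rfl
  map_smul' _ _ := rfl

theorem slotInsertion_apply {k : ℕ} (A : Module.End ℝ E) (i : Fin k)
    (m : MultilinearMap ℝ (fun _ : Fin k => E) W) (v : Fin k → E) :
    slotInsertion k W A i m v = m (update v i (A (v i))) := by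
  change m (fun j => (if j = i then A else LinearMap.id) (v j)) = _
  congr 1
  ext j
  rcases eq_or_ne j i with rfl | hj
  · simp
  · simp [hj]

theorem slotInsertion_pow_apply {k : ℕ} (A : Module.End ℝ E) (i : Fin k) (n : ℕ)
    (m : MultilinearMap ℝ (fun _ : Fin k => E) W) (v : Fin k → E) :
    (slotInsertion k W A i ^ n) m v = m (update v i ((A ^ n) (v i))) := by
  induction n generalizing m v with
  | zero => simp
  | succ n ih => rw [pow_succ, Module.End.mul_apply, ih, slotInsertion_apply, pow_succ']; simp

theorem aeval_slotInsertion_apply {k : ℕ} (A : Module.End ℝ E) (i : Fin k) (p : ℝ[X])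
    (m : MultilinearMap ℝ (fun _ : Fin k => E) W) (v : Fin k → E) :
    aeval (slotInsertion k W A i) p m v = m (update v i (aeval A p (v i))) := by
  simp only [aeval_eq_sum_range, LinearMap.sum_apply, LinearMap.smul_apply,
    sum_apply, smul_apply, slotInsertion_pow_apply,
    MultilinearMap.map_update_sum, MultilinearMap.map_update_smul]

theorem exists_multilinear_solution [FiniteDimensional ℝ E] [FiniteDimensional ℝ W] {k : ℕ}
    (A : Module.End ℝ E) (B : Module.End ℝ W)
    (hres : ∀ (z : Fin k → ℂ) (μ : ℂ), (∀ i, aeval (z i) A.charpoly = 0) →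
      aeval μ B.charpoly = 0 → ∑ i, z i ≠ μ)
    (q : MultilinearMap ℝ (fun _ : Fin k => E) W) :
    ∃ m : MultilinearMap ℝ (fun _ : Fin k => E) W, ∀ v,
      ∑ i, m (update v i (A (v i))) - B (m v) = q v := by
  let C : Module.End ℝ W →ₐ[ℝ] Module.End ℝ (MultilinearMap ℝ (fun _ : Fin k => E) W) :=
    { toFun := fun B =>
        { toFun := fun m => B.compMultilinearMap m
          map_add' := fun m m' => by ext; simp
          map_smul' := fun a m => by ext; simp }
      map_one' := rfl
      map_mul' := fun _ _ => rfl
      map_zero' := rfl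
      map_add' := fun _ _ => rfl
      commutes' := fun r => by ext; simp [Module.algebraMap_end_apply] }
  have hC : ∀ B m v, C B m v = B (m v) := fun _ _ _ => rfl
  have hu : IsUnit (∑ i, slotInsertion k W A i - C B) := by
    refine isUnit_sum_sub_of_commute _ _ (fun i j => ?_) (fun i => ?_) (p := A.charpoly)
      (q := B.charpoly) (fun i => ?_) ?_ hres
    · ext m v
      rcases eq_or_ne i j with rfl | hij
      · rfl
      · simp only [Module.End.mul_apply, slotInsertion_apply, update_of_ne hij,
          update_of_ne hij.symm]
        rw [update_comm hij]
    · ext m v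
      simp only [Module.End.mul_apply, slotInsertion_apply, hC]
    · ext m v
      rw [aeval_slotInsertion_apply, LinearMap.aeval_self_charpoly]
      simp
    · rw [aeval_algHom_apply, LinearMap.aeval_self_charpoly, map_zero]
  obtain ⟨m, hm⟩ := ((Module.End.isUnit_iff _).1 hu).2 q
  refine ⟨m, fun v => ?_⟩
  rw [← hm]
  simp [slotInsertion_apply, hC]

end Sylvester

section Taylor

open Filter Asymptotics
open scoped Nat

variable {E F : Type u} [NormedAddCommGroup E] [NormedSpace ℝ E] [FiniteDimensional ℝ E]
  [NormedAddCommGroup F] [NormedSpace ℝ F] [CompleteSpace F]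

theorem isBigO_sub_taylor {f : E → F} (hs : ContDiff ℝ ∞ f) (n : ℕ) :
    (fun x => f x - ∑ k ∈ Finset.range (n + 1),
      (k ! : ℝ)⁻¹ • iteratedFDeriv ℝ k f 0 (fun _ => x)) =O[𝓝 0] fun x => ‖x‖ ^ (n + 1) := by
  have hcont := hs.continuous_iteratedFDeriv (m := n + 1) (by exact_mod_cast le_top)
  obtain ⟨C, hC⟩ := (isCompact_closedBall (0 : E) 1).exists_bound_of_continuousOn hcont.continuousOn
  refine IsBigO.of_bound ((n ! : ℝ)⁻¹ * |C|) ?_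
  filter_upwards [Metric.closedBall_mem_nhds (0 : E) one_pos] with x hx
  rw [mem_closedBall_zero_iff] at hx
  have h1 := map_add_eq_sum_add_integral_iteratedFDeriv (f := f) (x := 0) (y := x) (n := n)
    fun t _ => hs.contDiffAt.of_le (by exact_mod_cast le_top)
  rw [zero_add] at h1
  rw [h1, add_sub_cancel_left, norm_smul, norm_inv, Real.norm_natCast, norm_pow, norm_norm,
    mul_assoc]
  gcongr
  have h2 : ∀ t ∈ Set.uIoc (0 : ℝ) 1, ‖(1 - t) ^ n • iteratedFDeriv ℝ (n + 1) f (0 + t • x)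
      fun _ => x‖ ≤ |C| * ‖x‖ ^ (n + 1) := by
    intro t ht
    rw [Set.uIoc_of_le zero_le_one] at ht
    rw [norm_smul, norm_pow, Real.norm_of_nonneg (by linarith [ht.2])]
    have h3 : ‖iteratedFDeriv ℝ (n + 1) f (0 + t • x)‖ ≤ |C| := by
      refine (hC _ ?_).trans (le_abs_self C)
      rw [zero_add, mem_closedBall_zero_iff, norm_smul, Real.norm_of_nonneg ht.1.le]
      exact mul_le_one₀ ht.2 (norm_nonneg x) hx
    have h4 := (iteratedFDeriv ℝ (n + 1) f (0 + t • x)).le_of_opNorm_le h3 fun _ => x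
    rw [Finset.prod_const, Finset.card_univ, Fintype.card_fin] at h4
    refine (mul_le_of_le_one_left (norm_nonneg _) ?_).trans h4
    exact pow_le_one₀ (by linarith [ht.2]) (by linarith [ht.1])
  simpa using intervalIntegral.norm_integral_le_of_norm_le_const h2

theorem isBigO_diagonal {k : ℕ} (m : E [×k]→L[ℝ] F) :
    (fun x => m fun _ => x) =O[𝓝 0] fun x => ‖x‖ ^ k :=
  IsBigO.of_bound ‖m‖ <| Eventually.of_forall fun x => by
    have := m.le_opNorm fun _ => x
    rw [Finset.prod_const, Finset.card_univ, Fintype.card_fin] at this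
    simpa using this

theorem diagonal_eq_zero_of_isBigO {k : ℕ} (m : E [×k]→L[ℝ] F)
    (h : (fun x => m fun _ => x) =O[𝓝 0] fun x => ‖x‖ ^ (k + 1)) (x : E) :
    (m fun _ => x) = 0 := by
  obtain ⟨C, hC⟩ := h.bound
  have ht : Tendsto (fun t : ℝ => t • x) (𝓝[>] 0) (𝓝 0) := by
    have : Tendsto (fun t : ℝ => t • x) (𝓝 0) (𝓝 ((0 : ℝ) • x)) :=
      (continuous_id.smul continuous_const).tendsto 0
    rw [zero_smul] at this
    exact this.mono_left nhdsWithin_le_nhds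
  have h1 : ∀ᶠ t : ℝ in 𝓝[>] 0, ‖m fun _ => x‖ ≤ t * (C * ‖x‖ ^ (k + 1)) := by
    filter_upwards [ht.eventually hC, self_mem_nhdsWithin] with t h2 (h3 : 0 < t)
    have h4 := m.map_smul_univ (fun _ => t) fun _ => x
    rw [Finset.prod_const, Finset.card_univ, Fintype.card_fin] at h4
    rw [h4, norm_smul, norm_pow, norm_pow, norm_norm, norm_smul, Real.norm_of_nonneg h3.le] at h2
    refine le_of_mul_le_mul_left ?_ (pow_pos h3 k)
    calc _ ≤ _ := h2
      _ = _ := by ring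
  have h2 : Tendsto (fun t : ℝ => t * (C * ‖x‖ ^ (k + 1))) (𝓝[>] 0) (𝓝 0) := by
    have : Tendsto (fun t : ℝ => t * (C * ‖x‖ ^ (k + 1))) (𝓝 0) (𝓝 (0 * (C * ‖x‖ ^ (k + 1)))) :=
      (continuous_id.mul continuous_const).tendsto 0
    rw [zero_mul] at this
    exact this.mono_left nhdsWithin_le_nhds
  exact norm_le_zero_iff.1 (ge_of_tendsto h2 h1)

theorem iteratedFDeriv_diagonal_eq_zero {f : E → F} (hs : ContDiff ℝ ∞ f) {n : ℕ}
    (hf : f =O[𝓝 0] fun x => ‖x‖ ^ n) (k : ℕ) (hk : k < n) (x : E) :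
    (iteratedFDeriv ℝ k f 0 fun _ => x) = 0 := by
  induction k using Nat.strong_induction_on generalizing x with
  | _ k ih =>
    refine diagonal_eq_zero_of_isBigO _ ?_ x
    have h1 := (hf.trans (isBigO_pow_norm_of_le (Nat.succ_le_of_lt hk))).sub
      (isBigO_sub_taylor hs k)
    have h2 : (fun x => f x - (f x - ∑ i ∈ Finset.range (k + 1),
        (i ! : ℝ)⁻¹ • iteratedFDeriv ℝ i f 0 fun _ => x)) =
        fun x => (k ! : ℝ)⁻¹ • iteratedFDeriv ℝ k f 0 fun _ => x := by
      ext x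
      rw [sub_sub_cancel, Finset.sum_range_succ, Finset.sum_eq_zero, zero_add]
      intro i hi
      rw [Finset.mem_range] at hi
      rw [ih i hi (hi.trans hk) x, smul_zero]
    rw [h2] at h1
    refine ((isBigO_const_smul_left (by positivity : (k ! : ℝ)⁻¹ ≠ 0)).1 h1)

/-- The leading homogeneous term of a smooth map vanishing to order `n`. -/
theorem exists_leading_term {f : E → F} (hs : ContDiff ℝ ∞ f) {n : ℕ}
    (hf : f =O[𝓝 0] fun x => ‖x‖ ^ n) :
    ∃ q : E [×n]→L[ℝ] F, (fun x => f x - q fun _ => x) =O[𝓝 0] fun x => ‖x‖ ^ (n + 1) := by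
  refine ⟨(n ! : ℝ)⁻¹ • iteratedFDeriv ℝ n f 0, (isBigO_sub_taylor hs n).congr_left fun x => ?_⟩
  rw [Finset.sum_range_succ, Finset.sum_eq_zero, zero_add]
  · rfl
  · intro i hi
    rw [iteratedFDeriv_diagonal_eq_zero hs hf i (Finset.mem_range.1 hi), smul_zero]

theorem contDiff_diagonal {k : ℕ} (m : E [×k]→L[ℝ] F) : ContDiff ℝ ∞ fun x => m fun _ => x :=
  m.contDiff.comp (contDiff_pi.2 fun _ => contDiff_id)

/-- Borel's lemma: smooth maps with prescribed homogeneous terms. -/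
theorem exists_contDiff_of_homogeneous_terms (m : ∀ j : ℕ, E [×(j + 2)]→L[ℝ] F) :
    ∃ f : E → F, ContDiff ℝ ∞ f ∧ ∀ K : ℕ, (fun x => f x - ∑ j ∈ Finset.range K, m j fun _ => x)
      =O[𝓝 0] fun x => ‖x‖ ^ (K + 1) := by
  obtain ⟨χ, hχ, hχ1, hχ01, hχs, hχc⟩ :=
    exists_smooth_cutoff (Metric.closedBall_mem_nhds (0 : E) one_pos)
  set g : ℕ → E → F := fun j x => χ x • m j fun _ => x with hg
  have hgs : ∀ j, ContDiff ℝ ∞ (g j) := fun j => hχ.smul (contDiff_diagonal _)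
  have hgc : ∀ j, HasCompactSupport (g j) := fun j => hχc.smul_right
  have hgb : ∀ j k, ∃ C, ∀ x, ‖iteratedFDeriv ℝ k (g j) x‖ ≤ C := fun j k =>
    ((hgc j).iteratedFDeriv k).exists_bound_of_continuous
      ((hgs j).continuous_iteratedFDeriv (by exact_mod_cast le_top))
  choose C hC using hgb
  have hC0 : ∀ j k, 0 ≤ C j k := fun j k => (norm_nonneg _).trans (hC j k 0)
  have hgn : ∀ j k x, k ≤ j + 2 → ‖g j x‖ ≤ ‖m j‖ * ‖x‖ ^ k := by
    intro j k x hk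
    by_cases hx : x ∈ tsupport χ
    · have hx1 : ‖x‖ ≤ 1 := by simpa using hχs hx
      have h1 := (m j).le_opNorm fun _ => x
      rw [Finset.prod_const, Finset.card_univ, Fintype.card_fin] at h1
      simp only [hg]
      rw [norm_smul, Real.norm_of_nonneg (hχ01 x).1]
      refine (mul_le_of_le_one_left (norm_nonneg _) (hχ01 x).2).trans (h1.trans ?_)
      exact mul_le_mul_of_nonneg_left (pow_le_pow_of_le_one (norm_nonneg x) hx1 hk) (norm_nonneg _)
    · simp only [hg, image_eq_zero_of_notMem_tsupport hx, zero_smul, norm_zero]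
      positivity
  set M : ℕ → ℝ := fun j => ‖m j‖ + ∑ k ∈ Finset.range (j + 1), C j k with hM
  have hM0 : ∀ j, 0 ≤ M j := fun j =>
    add_nonneg (norm_nonneg _) (Finset.sum_nonneg fun k _ => hC0 j k)
  set ε : ℕ → ℝ := fun j => (1 / 2) ^ j / (1 + M j) with hε
  have hε0 : ∀ j, 0 < ε j := fun j => div_pos (by positivity) (by linarith [hM0 j])
  have hε1 : ∀ j, ε j ≤ 1 := fun j => by
    refine div_le_one_of_le₀ ?_ (by linarith [hM0 j])
    have : ((1 : ℝ) / 2) ^ j ≤ 1 := pow_le_one₀ (by norm_num) (by norm_num)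
    linarith [hM0 j]
  have hεM : ∀ j, ε j * M j ≤ (1 / 2) ^ j := fun j => by
    simp only [hε]
    rw [div_mul_eq_mul_div, div_le_iff₀ (by linarith [hM0 j])]
    have : (0 : ℝ) < (1 / 2) ^ j := by positivity
    nlinarith [hM0 j]
  have hεpow : ∀ j k, k ≤ j + 1 → ε j ^ (j + 2) * (ε j)⁻¹ ^ k ≤ ε j := by
    intro j k hk
    have h1 : ε j ^ (j + 2) = ε j ^ (j + 2 - k) * ε j ^ k := by
      rw [← pow_add]; congr 1; omega
    rw [h1, mul_assoc, ← mul_pow, mul_inv_cancel₀ (hε0 j).ne', one_pow, mul_one]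
    exact pow_le_of_le_one (hε0 j).le (hε1 j) (by omega)
  set f : ℕ → E → F := fun j x => ε j ^ (j + 2) • g j ((ε j)⁻¹ • x) with hf
  have hfs : ∀ j, ContDiff ℝ ∞ (f j) := fun j =>
    ((hgs j).comp (contDiff_const_smul _)).const_smul _
  have hfb : ∀ j k x, k ≤ j → ‖iteratedFDeriv ℝ k (f j) x‖ ≤ (1 / 2) ^ j := by
    intro j k x hk
    have hsc : ContDiff ℝ k fun x => g j ((ε j)⁻¹ • x) :=
      ((hgs j).comp (contDiff_const_smul _)).of_le (by exact_mod_cast le_top)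
    have h1 : iteratedFDeriv ℝ k (f j) x =
        ε j ^ (j + 2) • ((ε j)⁻¹ ^ k • iteratedFDeriv ℝ k (g j) ((ε j)⁻¹ • x)) := by
      have h2 := congrFun (iteratedFDeriv_comp_const_smul (i := k) (ε j)⁻¹
        ((hgs j).of_le (by exact_mod_cast le_top))) x
      rw [← h2]
      exact iteratedFDeriv_const_smul_apply hsc.contDiffAt
    rw [h1, smul_smul, norm_smul, Real.norm_of_nonneg (by have := hε0 j; positivity)]
    have h3 : C j k ≤ M j := by
      have := Finset.single_le_sum (fun k _ => hC0 j k)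
        (Finset.mem_range.2 (Nat.lt_succ_of_le hk) : k ∈ Finset.range (j + 1))
      simp only [hM]
      linarith [norm_nonneg (m j)]
    refine le_trans ?_ (hεM j)
    exact mul_le_mul (hεpow j k (by omega)) ((hC j k _).trans h3) (norm_nonneg _) (hε0 j).le
  have hfn : ∀ j k x, k ≤ j + 1 → ‖f j x‖ ≤ (1 / 2) ^ j * ‖x‖ ^ k := by
    intro j k x hk
    have h1 := hgn j k ((ε j)⁻¹ • x) (by omega)
    rw [norm_smul (ε j)⁻¹ x, norm_inv, Real.norm_of_nonneg (hε0 j).le, mul_pow] at h1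
    simp only [hf]
    rw [norm_smul, Real.norm_of_nonneg (by have := hε0 j; positivity)]
    have h3 : ‖m j‖ ≤ M j := by
      simp only [hM]
      linarith [Finset.sum_nonneg fun k (_ : k ∈ Finset.range (j + 1)) => hC0 j k]
    have h4 := hε0 j
    calc _ ≤ ε j ^ (j + 2) * (‖m j‖ * ((ε j)⁻¹ ^ k * ‖x‖ ^ k)) := by gcongr
      _ = (ε j ^ (j + 2) * (ε j)⁻¹ ^ k) * ‖m j‖ * ‖x‖ ^ k := by ring
      _ ≤ ε j * M j * ‖x‖ ^ k := by gcongr; exact hεpow j k hk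
      _ ≤ _ := by gcongr; exact hεM j
  have hf1 : ∀ j, ∀ᶠ x in 𝓝 0, f j x = m j fun _ => x := by
    intro j
    have ht : Tendsto (fun x : E => (ε j)⁻¹ • x) (𝓝 0) (𝓝 0) := by
      simpa using (continuous_const_smul ((ε j)⁻¹)).tendsto (0 : E)
    filter_upwards [ht.eventually hχ1] with x hx
    simp only [hf, hg]
    rw [hx, one_smul]
    have h4 := (m j).map_smul_univ (fun _ => (ε j)⁻¹) fun _ => x
    rw [Finset.prod_const, Finset.card_univ, Fintype.card_fin] at h4
    rw [h4, smul_smul, ← mul_pow, mul_inv_cancel₀ (hε0 j).ne', one_pow, one_smul]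
  have hgeo : Summable fun j : ℕ => ((1 : ℝ) / 2) ^ j := summable_geometric_two
  refine ⟨fun x => ∑' j, f j x, ?_, fun K => ?_⟩
  · refine contDiff_tsum_of_eventually hfs (v := fun _ j => (1 / 2) ^ j) (fun _ _ => hgeo)
      fun k _ => ?_
    rw [Nat.cofinite_eq_atTop]
    filter_upwards [eventually_ge_atTop k] with j hj x
    exact hfb j k x hj
  · have hsum : ∀ x, Summable fun j => f j x := fun x =>
      Summable.of_norm_bounded hgeo fun j => by simpa using hfn j 0 x (by omega)
    refine IsBigO.of_bound (∑' j : ℕ, (1 / 2) ^ (j + K)) ?_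
    have hall : ∀ᶠ x in 𝓝 0, ∀ j ∈ Finset.range K, f j x = m j fun _ => x :=
      (Finset.eventually_all _).2 fun j _ => hf1 j
    filter_upwards [hall] with x hx
    rw [← (hsum x).sum_add_tsum_nat_add K, Finset.sum_congr rfl hx, add_sub_cancel_left,
      norm_pow, norm_norm, ← tsum_mul_right]
    have hg' : Summable fun j : ℕ => ((1 : ℝ) / 2) ^ (j + K) := (summable_nat_add_iff K).2 hgeo
    exact tsum_of_norm_bounded (hg'.mul_right _).hasSum fun j => hfn (j + K) (K + 1) x (by omega)

end Taylor

section Homological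

variable {E F : Type u} [NormedAddCommGroup E] [NormedSpace ℝ E] [FiniteDimensional ℝ E]
  [NormedAddCommGroup F] [NormedSpace ℝ F] [FiniteDimensional ℝ F]

theorem MultilinearMap.continuous_of_finiteDimensional_real {k : ℕ}
    (m : MultilinearMap ℝ (fun _ : Fin k => E) F) : Continuous m := by
  classical
  let b := Module.finBasis ℝ E
  have h : ⇑m = fun v => ∑ r : Fin k → Fin (Module.finrank ℝ E),
      (∏ i, b.coord (r i) (v i)) • m fun i => b (r i) := by
    funext v
    conv_lhs => rw [show v = fun i => ∑ j, b.coord j (v i) • b j from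
      funext fun i => (b.sum_repr (v i)).symm]
    rw [m.map_sum]
    exact Finset.sum_congr rfl fun r _ => m.map_smul_univ _ _
  rw [h]
  refine continuous_finsetSum _ fun r _ => (continuous_finsetProd _ fun i _ => ?_).smul
    continuous_const
  exact (LinearMap.continuous_of_finiteDimensional _).comp (continuous_apply i)

/-- The homological equation: absence of resonances makes the Lie derivative along a linear
vector field surjective on homogeneous polynomial maps. -/
theorem exists_homological_solution {k : ℕ} (A : E →L[ℝ] E) (B : F →L[ℝ] F)
    (hres : ∀ (z : Fin k → ℂ) (μ : ℂ),
      (∀ i, Polynomial.aeval (z i) (A : E →ₗ[ℝ] E).charpoly = 0) →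
      Polynomial.aeval μ (B : F →ₗ[ℝ] F).charpoly = 0 → ∑ i, z i ≠ μ)
    (q : E [×k]→L[ℝ] F) :
    ∃ m : E [×k]→L[ℝ] F, ∀ x,
      fderiv ℝ (fun y => m fun _ => y) x (A x) - B (m fun _ => x) = q fun _ => x := by
  classical
  obtain ⟨m, hm⟩ := exists_multilinear_solution (A : E →ₗ[ℝ] E) (B : F →ₗ[ℝ] F) hres
    q.toMultilinearMap
  let M : E [×k]→L[ℝ] F := ⟨m, m.continuous_of_finiteDimensional_real⟩
  refine ⟨M, fun x => ?_⟩
  have h1 : HasFDerivAt (fun y => M fun _ => y)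
      ((M.linearDeriv fun _ => x).comp (ContinuousLinearMap.pi fun _ => .id ℝ E)) x :=
    (M.hasFDerivAt (fun _ => x)).comp x
      (ContinuousLinearMap.pi fun _ : Fin k => ContinuousLinearMap.id ℝ E).hasFDerivAt
  rw [h1.fderiv]
  have h2 := hm fun _ => x
  simp only [ContinuousLinearMap.comp_apply, ContinuousMultilinearMap.linearDeriv_apply]
  exact h2

end Homological

section Formal

open Filter Asymptotics

variable {E : Type u} [NormedAddCommGroup E] [NormedSpace ℝ E] [FiniteDimensional ℝ E]

theorem isBigO_map_add_sub {F : Type*} [NormedAddCommGroup F] [NormedSpace ℝ F] {X : E → F}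
    (hX : ContDiff ℝ ∞ X) {φ h : E → E} {j : ℕ}
    (hφ : φ =O[𝓝 0] fun x => ‖x‖ ^ 1) (hh : h =O[𝓝 0] fun x => ‖x‖ ^ (j + 1)) :
    (fun x => X (φ x + h x) - X (φ x) - fderiv ℝ X 0 (h x)) =O[𝓝 0] fun x => ‖x‖ ^ (j + 2) := by
  have hh1 : h =O[𝓝 0] fun x => ‖x‖ ^ 1 := hh.trans (isBigO_pow_norm_of_le (by lia))
  obtain ⟨K, t, ht, hK⟩ := ((hX.fderiv_right (m := ∞) (by simp)).of_le (by
      simp)).contDiffAt.exists_lipschitzOnWith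
    (x := 0)
  obtain ⟨r, hr, hrt⟩ := Metric.mem_nhds_iff.mp ht
  have htend : ∀ {f : E → E}, f =O[𝓝 0] (fun x => ‖x‖ ^ 1) → Tendsto f (𝓝 0) (𝓝 0) := by
    intro f hf
    refine hf.trans_tendsto ?_
    simpa using (continuous_norm (E := E)).tendsto 0
  have hs : Tendsto (fun x => ‖φ x‖ + ‖h x‖) (𝓝 0) (𝓝 0) := by
    simpa using (htend hφ).norm.add (htend hh1).norm
  have hb : (fun x => ‖φ x‖ + ‖h x‖) =O[𝓝 0] fun x => ‖x‖ ^ 1 := hφ.norm_left.add hh1.norm_left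
  have hprod : (fun x => (‖φ x‖ + ‖h x‖) * ‖h x‖) =O[𝓝 0] fun x => ‖x‖ ^ (j + 2) := by
    refine (hb.mul hh.norm_left).congr_right fun x => ?_
    ring
  refine IsBigO.trans (IsBigO.of_bound K ?_) hprod
  filter_upwards [hs.eventually (gt_mem_nhds hr)] with x hx
  have hconv : Convex ℝ (Metric.closedBall (0 : E) (‖φ x‖ + ‖h x‖)) := convex_closedBall _ _
  have hder : ∀ y ∈ Metric.closedBall (0 : E) (‖φ x‖ + ‖h x‖),
      ‖fderiv ℝ X y - fderiv ℝ X 0‖ ≤ K * (‖φ x‖ + ‖h x‖) := by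
    intro y hy
    rw [mem_closedBall_zero_iff] at hy
    have h1 := hK.norm_sub_le (hrt (mem_ball_zero_iff.mpr (hy.trans_lt hx)))
      (hrt (Metric.mem_ball_self hr))
    rw [sub_zero] at h1
    exact h1.trans (by gcongr)
  have h2 := hconv.norm_image_sub_le_of_norm_fderiv_le'
    (fun y _ => hX.differentiable (by simp) y) hder
    (x := φ x) (y := φ x + h x)
    (mem_closedBall_zero_iff.mpr (le_add_of_nonneg_right (norm_nonneg _)))
    (mem_closedBall_zero_iff.mpr (norm_add_le _ _))
  rw [add_sub_cancel_left] at h2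
  rw [Real.norm_of_nonneg (by positivity), ← mul_assoc]
  exact h2

/-- `φ` conjugates `X` to its linear part up to order `k`. -/
structure ConjugatesToOrder (X : E → E) (k : ℕ) (φ : E → E) : Prop where
  smooth : ContDiff ℝ ∞ φ
  map_zero : φ 0 = 0
  fderiv_zero : fderiv ℝ φ 0 = ContinuousLinearMap.id ℝ E
  isBigO : (fun x => fderiv ℝ φ x (fderiv ℝ X 0 x) - X (φ x)) =O[𝓝 0] fun x => ‖x‖ ^ (k + 2)

theorem isBigO_norm_of_contDiff {F : Type*} [NormedAddCommGroup F] [NormedSpace ℝ F] {φ : E → F}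
    (hs : ContDiff ℝ ∞ φ) (h0 : φ 0 = 0) : φ =O[𝓝 0] fun x => ‖x‖ ^ 1 := by
  have h := (hs.differentiable (by simp) 0).hasFDerivAt.isBigO_sub
  simp only [h0, sub_zero] at h
  simpa using h.norm_right

theorem conjugatesToOrder_id {X : E → E} (hX : ContDiff ℝ ∞ X) (hX0 : X 0 = 0) :
    ConjugatesToOrder X 0 id where
  smooth := contDiff_id
  map_zero := rfl
  fderiv_zero := fderiv_id
  isBigO := by
    have h := isBigO_map_add_sub hX (φ := fun _ => 0) (h := id) (j := 0)
      (isBigO_zero _ _) (by simpa using (isBigO_refl (id : E → E) (𝓝 0)).norm_right)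
    refine h.neg_left.congr_left fun x => ?_
    simp [hX0]

theorem fderiv_eq_zero_of_isBigO {F : Type*} [NormedAddCommGroup F] [NormedSpace ℝ F] {f : E → F}
    (h : f =O[𝓝 0] fun x => ‖x‖ ^ 2) : fderiv ℝ f 0 = 0 := by
  have h0 : f 0 = 0 := by
    obtain ⟨C, hC⟩ := h.bound
    simpa using hC.self_of_nhds
  refine HasFDerivAt.fderiv ?_
  rw [hasFDerivAt_iff_isLittleO_nhds_zero]
  simp only [zero_add, h0, sub_zero, zero_apply]
  exact h.trans_isLittleO (isLittleO_norm_pow_id one_lt_two)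

theorem ConjugatesToOrder.exists_succ {X : E → E} (hX : ContDiff ℝ ∞ X) {k : ℕ}
    (hres : ∀ (z : Fin (k + 2) → ℂ) (μ : ℂ),
      (∀ i, Polynomial.aeval (z i) (fderiv ℝ X 0 : E →ₗ[ℝ] E).charpoly = 0) →
      Polynomial.aeval μ (fderiv ℝ X 0 : E →ₗ[ℝ] E).charpoly = 0 → ∑ i, z i ≠ μ)
    {φ : E → E} (h : ConjugatesToOrder X k φ) :
    ∃ m : E [×(k + 2)]→L[ℝ] E, ConjugatesToOrder X (k + 1) fun x => φ x + m fun _ => x := by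
  have hsmooth : ContDiff ℝ ∞ fun x => fderiv ℝ φ x (fderiv ℝ X 0 x) - X (φ x) :=
    ((h.smooth.fderiv_right (m := ∞) (by simp)).clm_apply (fderiv ℝ X 0).contDiff).sub
      (hX.comp h.smooth)
  obtain ⟨q, hq⟩ := exists_leading_term hsmooth h.isBigO
  obtain ⟨m, hm⟩ := exists_homological_solution (fderiv ℝ X 0) (fderiv ℝ X 0) hres (-q)
  have hms := contDiff_diagonal m
  have hmd : ∀ x, fderiv ℝ (fun x => φ x + m fun _ => x) x
      = fderiv ℝ φ x + fderiv ℝ (fun x => m fun _ => x) x := fun x =>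
    fderiv_add (h.smooth.differentiable (by simp) x) (hms.differentiable (by simp) x)
  have hmO := isBigO_diagonal m
  refine ⟨m, h.smooth.add hms, ?_, ?_, ?_⟩
  · simp only [h.map_zero, zero_add]
    exact m.map_coord_zero 0 rfl
  · rw [hmd, h.fderiv_zero,
      fderiv_eq_zero_of_isBigO (hmO.trans (isBigO_pow_norm_of_le (by lia))), add_zero]
  · have h1 := isBigO_map_add_sub hX (isBigO_norm_of_contDiff h.smooth h.map_zero)
      (j := k + 1) hmO
    refine (hq.sub h1).congr_left fun x => ?_
    have h2 := hm x
    rw [neg_apply] at h2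
    rw [hmd, add_apply, sub_eq_iff_eq_add.mp h2]
    abel

/-- Away from resonances, a smooth vector field is smoothly conjugate to its linear part up to a
flat error. -/
theorem exists_conjugates_linear_add_flat {X : E → E} (hX : ContDiff ℝ ∞ X) (hX0 : X 0 = 0)
    (hres : ∀ (k : ℕ) (z : Fin (k + 2) → ℂ) (μ : ℂ),
      (∀ i, Polynomial.aeval (z i) (fderiv ℝ X 0 : E →ₗ[ℝ] E).charpoly = 0) →
      Polynomial.aeval μ (fderiv ℝ X 0 : E →ₗ[ℝ] E).charpoly = 0 → ∑ i, z i ≠ μ) :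
    ∃ Φ g : E → E, ContDiff ℝ ∞ g ∧ FlatAtZero g ∧
      Conjugates Φ X fun x => fderiv ℝ X 0 x + g x := by
  choose M hM using fun (k : ℕ) (φ : E → E) (h : ConjugatesToOrder X k φ) =>
    h.exists_succ hX (hres k)
  let s : ∀ k, {φ : E → E // ConjugatesToOrder X k φ} := fun k =>
    Nat.rec ⟨id, conjugatesToOrder_id hX hX0⟩ (fun k p => ⟨_, hM k p.1 p.2⟩) k
  let m : ∀ k, E [×(k + 2)]→L[ℝ] E := fun k => M k (s k).1 (s k).2
  have hs : ∀ k x, (s k).1 x = x + ∑ j ∈ Finset.range k, m j fun _ => x := by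
    intro k
    induction k with
    | zero => intro x; simp [s]
    | succ k ih =>
      intro x
      rw [Finset.sum_range_succ, ← add_assoc, ← ih]
  obtain ⟨f, hf, hfm⟩ := exists_contDiff_of_homogeneous_terms m
  set Φ : E → E := fun x => x + f x with hΦ
  have hΦs : ContDiff ℝ ∞ Φ := contDiff_id.add hf
  have hf2 : f =O[𝓝 0] fun x => ‖x‖ ^ 2 := by
    have h1 := (hfm 1).add (isBigO_diagonal (m 0))
    simpa using h1
  have hΦ0 : Φ 0 = 0 := by
    obtain ⟨C, hC⟩ := hf2.bound
    have h1 : f 0 = 0 := by simpa using hC.self_of_nhds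
    simp [hΦ, h1]
  have hΦ1 : fderiv ℝ Φ 0 = .id ℝ E := by
    rw [hΦ, fderiv_fun_add differentiableAt_fun_id (hf.differentiable (by simp) 0),
      fderiv_eq_zero_of_isBigO hf2, add_zero]
    exact fderiv_fun_id
  have hflat : FlatAtZero fun x => fderiv ℝ Φ x (fderiv ℝ X 0 x) - X (Φ x) := by
    intro N
    have hφ := (s (2 * N + 2)).2
    set φ := (s (2 * N + 2)).1
    set h : E → E := fun x => Φ x - φ x with hh
    have hhs : ContDiff ℝ ∞ h := hΦs.sub hφ.smooth
    have hhO : h =O[𝓝 0] fun x => ‖x‖ ^ (2 * (N + 1) + 1) := by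
      refine (hfm (2 * N + 2)).congr_left fun x => ?_
      simp only [hh, hΦ, φ, hs]
      abel
    have hAb : (fun x => fderiv ℝ X 0 x) =O[𝓝 0] fun _ => (1 : ℝ) :=
      (fderiv ℝ X 0).continuous.continuousAt.norm.isBoundedUnder_le.isBigO_one ℝ
    have h1 : (fun x => fderiv ℝ h x (fderiv ℝ X 0 x)) =O[𝓝 0] fun x => ‖x‖ ^ N := by
      have h2 := (isBigO_fderiv_of_isBigO hhs
        (hhO.trans (isBigO_pow_norm_of_le (Nat.le_succ _)))).norm_left.mul hAb.norm_left
      simp only [mul_one] at h2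
      refine IsBigO.trans (IsBigO.of_norm_le fun x => ?_) h2
      exact (fderiv ℝ h x).le_opNorm _
    have h3 := (isBigO_map_add_sub hX (isBigO_norm_of_contDiff hφ.smooth hφ.map_zero) hhO).trans
      (isBigO_pow_norm_of_le (m := N) (by lia))
    have h4 : (fun x => fderiv ℝ X 0 (h x)) =O[𝓝 0] fun x => ‖x‖ ^ N :=
      ((fderiv ℝ X 0).isBigO_comp h _).trans (hhO.trans (isBigO_pow_norm_of_le (by lia)))
    have h5 := hφ.isBigO.trans (isBigO_pow_norm_of_le (m := N) (by lia))
    refine (((h5.add h1).sub h3).sub h4).congr_left fun x => ?_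
    have h6 : fderiv ℝ h x = fderiv ℝ Φ x - fderiv ℝ φ x :=
      fderiv_sub (hΦs.differentiable (by simp) x) (hφ.smooth.differentiable (by simp) x)
    have h7 : φ x + h x = Φ x := add_sub_cancel _ _
    rw [h6, h7, sub_apply]
    abel
  have hinv := eventually_contDiffAt_inverse (hΦs.fderiv_right (m := ∞) (by simp)) hΦ1
  have hdefs : ContDiff ℝ ∞ fun x => fderiv ℝ Φ x (fderiv ℝ X 0 x) - X (Φ x) :=
    ((hΦs.fderiv_right (m := ∞) (by simp)).clm_apply (fderiv ℝ X 0).contDiff).sub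
      (hX.comp hΦs)
  obtain ⟨g, hg, hgeq⟩ := exists_contDiff_eventuallyEq (f := fun x =>
    -(fderiv ℝ Φ x).inverse (fderiv ℝ Φ x (fderiv ℝ X 0 x) - X (Φ x))) (by
      filter_upwards [hinv] with x hx
      exact (hx.1.clm_apply hdefs.contDiffAt).neg)
  refine ⟨Φ, g, hg, ?_, hΦs, hΦ0, hΦ1, ?_⟩
  · refine FlatAtZero.congr ?_ hgeq
    intro N
    exact (hflat.clm_apply hinv.self_of_nhds.1.continuousAt N).neg_left
  · filter_upwards [hinv, hgeq] with x hx hgx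
    rw [map_add, hgx, map_neg, hx.2.1]
    abel

end Formal

section Spectrum

open Polynomial Matrix

variable {N : ℕ}

theorem aeval_charpoly_eq_det (A : (Fin N → ℝ) →L[ℝ] (Fin N → ℝ)) (z : ℂ) :
    aeval z (A : (Fin N → ℝ) →ₗ[ℝ] (Fin N → ℝ)).charpoly =
      (scalar (Fin N) z - (LinearMap.toMatrix' (A : (Fin N → ℝ) →ₗ[ℝ] (Fin N → ℝ))).map
        (algebraMap ℝ ℂ)).det := by
  rw [← eval_charpoly, charpoly_map, eval_map_algebraMap, ← charpoly_toLin', toLin'_toMatrix']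

/-- The spectrum of a conformally symplectic operator is invariant under `z ↦ 1 - z`. -/
theorem aeval_one_sub_charpoly_eq_zero {A : (Fin N → ℝ) →L[ℝ] (Fin N → ℝ)}
    {σ : (Fin N → ℝ) →L[ℝ] (Fin N → ℝ) →L[ℝ] ℝ} (hnd : ∀ u, (∀ v, σ u v = 0) → u = 0)
    (hA : ∀ u v, σ (A u) v + σ u (A v) = σ u v) {z : ℂ}
    (hz : aeval z (A : (Fin N → ℝ) →ₗ[ℝ] (Fin N → ℝ)).charpoly = 0) :
    aeval (1 - z) (A : (Fin N → ℝ) →ₗ[ℝ] (Fin N → ℝ)).charpoly = 0 := by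
  rw [aeval_charpoly_eq_det] at hz ⊢
  set M := LinearMap.toMatrix' (A : (Fin N → ℝ) →ₗ[ℝ] (Fin N → ℝ)) with hM
  let J : Matrix (Fin N) (Fin N) ℝ := .of fun i j => σ (Pi.single i 1) (Pi.single j 1)
  have hJ : ∀ u v, σ u v = u ⬝ᵥ J *ᵥ v := by
    intro u v
    have e : ∀ w : Fin N → ℝ, w = ∑ i, w i • (Pi.single i 1 : Fin N → ℝ) := fun w => by
      ext j
      simp [Pi.single_apply]
    conv_lhs => rw [e u, map_sum, _root_.sum_apply, e v]
    simp only [map_sum, map_smul, _root_.smul_apply, dotProduct, mulVec, J, of_apply,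
      smul_eq_mul, Finset.mul_sum]
    refine Finset.sum_congr rfl fun i _ => Finset.sum_congr rfl fun j _ => ?_
    ring
  have hAM : ∀ u, A u = M *ᵥ u := fun u => by rw [hM, LinearMap.toMatrix'_mulVec]; rfl
  have hdet : J.det ≠ 0 := by
    intro h
    obtain ⟨v, hv, hJv⟩ := exists_vecMul_eq_zero_iff.mpr h
    refine hv (hnd v fun w => ?_)
    rw [hJ, dotProduct_mulVec, hJv, zero_dotProduct]
  have hcomm : Mᵀ * J + J * M = J := by
    ext i j
    have h := hA (Pi.single i 1) (Pi.single j 1)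
    simp only [hJ, hAM] at h
    rw [← vecMul_transpose, ← dotProduct_mulVec, mulVec_mulVec, mulVec_mulVec,
      ← dotProduct_add, ← add_mulVec] at h
    simpa using h
  set Mc := M.map (algebraMap ℝ ℂ) with hMc
  set Jc := J.map (algebraMap ℝ ℂ) with hJc
  have hcommc : Mcᵀ * Jc + Jc * Mc = Jc := by
    have h := congrArg (fun B : Matrix (Fin N) (Fin N) ℝ => B.map (algebraMap ℝ ℂ)) hcomm
    simpa only [Matrix.map_add _ (map_add (algebraMap ℝ ℂ)), Matrix.map_mul,
      transpose_map] using h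
  have hdetc : Jc.det ≠ 0 := by
    rw [hJc, ← RingHom.mapMatrix_apply, ← RingHom.map_det]
    simpa using hdet
  have hprod : Jc * (scalar (Fin N) z - Mc) = -((scalar (Fin N) (1 - z) - Mcᵀ) * Jc) := by
    have h1 : Jc * Mc = Jc - Mcᵀ * Jc := eq_sub_of_add_eq' hcommc
    rw [mul_sub, h1, sub_mul, map_sub, sub_mul, map_one, one_mul,
      (scalar_commute z (fun r => mul_comm _ _) Jc).eq]
    abel
  have h2 := congrArg det hprod
  rw [det_mul, hz, mul_zero, det_neg, det_mul] at h2
  have h3 : (scalar (Fin N) (1 - z) - Mcᵀ).det = 0 := by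
    by_contra h
    exact mul_ne_zero (pow_ne_zero _ (by norm_num)) (mul_ne_zero h hdetc) h2.symm
  rw [← det_transpose, transpose_sub, transpose_transpose] at h3
  simpa using h3

theorem sum_ne_one_of_not_resonant {A : (Fin N → ℝ) →L[ℝ] (Fin N → ℝ)} {lam : Fin N → ℂ}
    (hlam : (charpoly ((LinearMap.toMatrix' (A : (Fin N → ℝ) →ₗ[ℝ] (Fin N → ℝ))).map
      (algebraMap ℝ ℂ))).roots = Multiset.map lam Finset.univ.val)
    (hres : ∀ a : Fin N → ℕ, 3 ≤ ∑ i, a i → ∑ i, (a i : ℂ) * lam i ≠ 1)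
    {k : ℕ} (hk : 3 ≤ k) (z : Fin k → ℂ)
    (hz : ∀ i, aeval (z i) (A : (Fin N → ℝ) →ₗ[ℝ] (Fin N → ℝ)).charpoly = 0) :
    ∑ i, z i ≠ 1 := by
  have hex : ∀ i, ∃ j, lam j = z i := by
    intro i
    have h : z i ∈ (charpoly ((LinearMap.toMatrix' (A : (Fin N → ℝ) →ₗ[ℝ] (Fin N → ℝ))).map
        (algebraMap ℝ ℂ))).roots := by
      rw [mem_roots (charpoly_monic _).ne_zero, IsRoot.def, eval_charpoly,
        ← aeval_charpoly_eq_det, hz]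
    rw [hlam] at h
    simpa using h
  choose j hj using hex
  have h := hres (fun l => (Finset.univ.filter fun i => j i = l).card) (by
    rw [← Finset.card_eq_sum_card_fiberwise fun i _ => Finset.mem_coe.mpr (Finset.mem_univ (j i))]
    simpa using hk)
  convert h using 1
  rw [← Finset.sum_fiberwise (s := Finset.univ) (g := j)]
  refine Finset.sum_congr rfl fun l _ => ?_
  rw [Finset.sum_congr rfl (g := fun _ => lam l), Finset.sum_const, nsmul_eq_mul]
  intro i hi
  rw [← hj, (Finset.mem_filter.mp hi).2]

theorem exists_isLyapunov {A : (Fin N → ℝ) →L[ℝ] (Fin N → ℝ)}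
    (hA : ∀ z w : ℂ, aeval z (A : (Fin N → ℝ) →ₗ[ℝ] (Fin N → ℝ)).charpoly = 0 →
      aeval w (A : (Fin N → ℝ) →ₗ[ℝ] (Fin N → ℝ)).charpoly = 0 → z + w ≠ 0) :
    ∃ b m δ, IsLyapunov A b m δ := by
  let q : MultilinearMap ℝ (fun _ : Fin 2 => Fin N → ℝ) ℝ := ∑ i : Fin N,
    (MultilinearMap.mkPiAlgebra ℝ (Fin 2) ℝ).compLinearMap fun _ => LinearMap.proj i
  obtain ⟨m, hm⟩ := exists_multilinear_solution (k := 2) (A : (Fin N → ℝ) →ₗ[ℝ] (Fin N → ℝ))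
    (0 : Module.End ℝ ℝ) (by
      intro z μ hz hμ
      have h0 : μ = 0 := by
        rw [LinearMap.charpoly_zero] at hμ
        simpa using hμ
      rw [h0, Fin.sum_univ_two]
      exact hA _ _ (hz 0) (hz 1)) q
  have hadd : ∀ x y z, m ![x + y, z] = m ![x, z] + m ![y, z] := fun x y z => m.cons_add _ x y
  have hsmul : ∀ (c : ℝ) x z, m ![c • x, z] = c • m ![x, z] := fun c x z => m.cons_smul _ c x
  have hu1 : ∀ x y z : Fin N → ℝ, Function.update ![x, y] 1 z = ![x, z] := by
    intro x y z
    ext i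
    fin_cases i <;> simp
  have hadd' : ∀ x y z, m ![x, y + z] = m ![x, y] + m ![x, z] := by
    intro x y z
    have h := m.map_update_add ![x, 0] 1 y z
    simpa only [hu1] using h
  have hsmul' : ∀ (c : ℝ) x y, m ![x, c • y] = c • m ![x, y] := by
    intro c x y
    have h := m.map_update_smul ![x, 0] 1 c y
    simpa only [hu1] using h
  let b : (Fin N → ℝ) →L[ℝ] (Fin N → ℝ) →L[ℝ] ℝ := (LinearMap.mk₂ ℝ
    (fun x y => m ![x, y] + m ![y, x])
    (fun x y z => by rw [hadd, hadd']; ring)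
    (fun c x y => by rw [hsmul, hsmul', smul_add])
    (fun x y z => by rw [hadd, hadd']; ring)
    (fun c x y => by rw [hsmul, hsmul', smul_add])).toContinuousBilinearMap
  have hb : ∀ x y, b x y = m ![x, y] + m ![y, x] := fun x y => rfl
  have hq : ∀ x, b (A x) x = ∑ i, x i ^ 2 := by
    intro x
    have h := hm ![x, x]
    have e0 : Function.update ![x, x] 0 (A x) = ![A x, x] := by
      ext i
      fin_cases i <;> simp
    simp only [Fin.sum_univ_two, cons_val_zero, cons_val_one, ContinuousLinearMap.coe_coe, e0,
      hu1, LinearMap.zero_apply, sub_zero] at h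
    rw [hb, h]
    simp [q, sq]
  have hle : ∀ x, 1 * ‖x‖ ^ 2 ≤ b (A x) x := by
    intro x
    rw [hq, one_mul]
    have h0 : 0 ≤ ∑ i, x i ^ 2 := Finset.sum_nonneg fun i _ => sq_nonneg _
    rw [← Real.le_sqrt (norm_nonneg _) h0, pi_norm_le_iff_of_nonneg (Real.sqrt_nonneg _)]
    intro i
    rw [Real.norm_eq_abs]
    refine Real.abs_le_sqrt ?_
    exact Finset.single_le_sum (f := fun i => x i ^ 2) (fun i _ => sq_nonneg _)
      (Finset.mem_univ i)
  set C := ‖b‖ * ‖A‖ * ‖A‖ + ‖b‖ * ‖A‖ * ‖A‖ + 1 with hC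
  have hCpos : 0 < C := by positivity
  refine ⟨b, 1, (2 * C)⁻¹, fun x y => ?_, one_pos, hle, by positivity, fun x => ?_⟩
  · rw [hb, hb, add_comm]
  · have h1 : |b (A (A x)) x| ≤ ‖b‖ * ‖A‖ * ‖A‖ * ‖x‖ ^ 2 := by
      rw [← Real.norm_eq_abs]
      calc ‖b (A (A x)) x‖ ≤ ‖b‖ * ‖A (A x)‖ * ‖x‖ := b.le_opNorm₂ _ _
        _ ≤ ‖b‖ * (‖A‖ * (‖A‖ * ‖x‖)) * ‖x‖ := by
          gcongr
          exact (A.le_opNorm _).trans (by gcongr; exact A.le_opNorm _)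
        _ = _ := by ring
    have h2 : |b (A x) (A x)| ≤ ‖b‖ * ‖A‖ * ‖A‖ * ‖x‖ ^ 2 := by
      rw [← Real.norm_eq_abs]
      calc ‖b (A x) (A x)‖ ≤ ‖b‖ * ‖A x‖ * ‖A x‖ := b.le_opNorm₂ _ _
        _ ≤ ‖b‖ * (‖A‖ * ‖x‖) * (‖A‖ * ‖x‖) := by
          gcongr <;> exact A.le_opNorm _
        _ = _ := by ring
    have h3 : |b (A (A x)) x + b (A x) (A x)| ≤ C * ‖x‖ ^ 2 := by
      refine (abs_add_le _ _).trans ((add_le_add h1 h2).trans ?_)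
      rw [← add_mul, hC]
      exact mul_le_mul_of_nonneg_right (le_add_of_nonneg_right zero_le_one) (sq_nonneg _)
    calc 2 * (2 * C)⁻¹ * |b (A (A x)) x + b (A x) (A x)|
        ≤ 2 * (2 * C)⁻¹ * (C * ‖x‖ ^ 2) := by gcongr
      _ = 1 * ‖x‖ ^ 2 := by field_simp
      _ ≤ _ := hle x

/-- A vector field whose linear part is conformally symplectic and nonresonant is smoothly
conjugate to its linear part. -/
theorem exists_conjugates_linear {X : (Fin N → ℝ) → (Fin N → ℝ)} (hX : ContDiff ℝ ∞ X)
    (hX0 : X 0 = 0) {σ : (Fin N → ℝ) →L[ℝ] (Fin N → ℝ) →L[ℝ] ℝ}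
    (hnd : ∀ u, (∀ v, σ u v = 0) → u = 0)
    (hA : ∀ u v, σ (fderiv ℝ X 0 u) v + σ u (fderiv ℝ X 0 v) = σ u v)
    (hres : ∀ k, 3 ≤ k → ∀ z : Fin k → ℂ, (∀ i, aeval (z i)
      (fderiv ℝ X 0 : (Fin N → ℝ) →ₗ[ℝ] (Fin N → ℝ)).charpoly = 0) → ∑ i, z i ≠ 1) :
    ∃ Φ, Conjugates Φ X (fderiv ℝ X 0) := by
  obtain ⟨Φ, g, hgs, hg, hΦ⟩ := exists_conjugates_linear_add_flat hX hX0 (by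
    intro k z μ hz hμ h
    refine hres (k + 3) (by lia) (Fin.cons (1 - μ) z) (fun i => ?_) ?_
    · refine Fin.cases ?_ (fun i => ?_) i
      · exact aeval_one_sub_charpoly_eq_zero hnd hA hμ
      · exact hz i
    · rw [Fin.sum_cons, h, sub_add_cancel])
  obtain ⟨b, m, δ, hL⟩ := exists_isLyapunov (A := fderiv ℝ X 0) (by
    intro z w hz hw h
    refine hres 4 (by lia) ![z, w, z, 1 - z] (fun i => ?_) ?_
    · have h1 := aeval_one_sub_charpoly_eq_zero hnd hA hz
      fin_cases i
      exacts [hz, hw, hz, h1]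
    · simp [Fin.sum_univ_four, h])
  obtain ⟨φ, hφ⟩ := hL.exists_conjugates hg hgs
  exact ⟨_, hΦ.trans hφ⟩

end Spectrum

section Moser

open Set Filter
open scoped NNReal BoundedContinuousFunction

variable {E : Type u} [NormedAddCommGroup E] [NormedSpace ℝ E] [FiniteDimensional ℝ E]

theorem exists_equiv_id_add {T : E →L[ℝ] E} (hT : ‖T‖ < 1) :
    ∃ e : E ≃L[ℝ] E, (e : E →L[ℝ] E) = .id ℝ E + T := by
  refine ⟨ContinuousLinearEquiv.unitsEquiv ℝ E (Units.oneSub (-T) (by rwa [norm_neg])), ?_⟩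
  ext v
  simp

theorem contDiff_inverse_id_add {G : Type*} [NormedAddCommGroup G] [NormedSpace ℝ G]
    {T : G → E →L[ℝ] E} (hT : ContDiff ℝ ∞ T) (h1 : ∀ x, ‖T x‖ < 1) :
    ContDiff ℝ ∞ fun x => (ContinuousLinearMap.id ℝ E + T x).inverse := by
  refine contDiff_iff_contDiffAt.mpr fun x => ?_
  obtain ⟨e, he⟩ := exists_equiv_id_add (h1 x)
  have h2 := contDiffAt_map_inverse (𝕜 := ℝ) (n := ∞) e
  rw [he] at h2
  exact h2.comp x (contDiff_const.add hT).contDiffAt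

theorem id_add_apply_inverse {T : E →L[ℝ] E} (hT : ‖T‖ < 1) (v : E) :
    (ContinuousLinearMap.id ℝ E + T) ((ContinuousLinearMap.id ℝ E + T).inverse v) = v := by
  obtain ⟨e, he⟩ := exists_equiv_id_add hT
  rw [← he, ContinuousLinearMap.inverse_equiv]
  exact e.apply_symm_apply v

theorem eventually_forall_asymptoticCurve_mem {F : Type u} [NormedAddCommGroup F]
    [NormedSpace ℝ F] {w : F → (ℝ≥0 →ᵇ F)} (hw : ContinuousAt w 0) (hw0 : w 0 = 0) {s : Set F}
    (hs : s ∈ 𝓝 0) : ∀ᶠ x in 𝓝 0, ∀ t, asymptoticCurve F (x, w x) t ∈ s := by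
  obtain ⟨r, hr, hrs⟩ := Metric.mem_nhds_iff.mp hs
  have h1 : ContinuousAt (fun x => asymptoticCurve F (x, w x)) 0 :=
    (asymptoticCurve F).continuous.continuousAt.comp (continuousAt_id.prodMk hw)
  have h2 : asymptoticCurve F (0, w 0) = 0 := by rw [hw0]; exact map_zero _
  have h3 := h1.eventually (Metric.ball_mem_nhds _ hr)
  filter_upwards [h3] with x hx t
  rw [h2, dist_zero_right] at hx
  exact hrs (mem_ball_zero_iff.mpr ((BoundedContinuousFunction.norm_coe_le_norm _ t).trans_lt hx))

theorem tendsto_asymptoticCurve {F : Type u} [NormedAddCommGroup F]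
    [NormedSpace ℝ F] (x : F) (w : ℝ≥0 →ᵇ F) :
    Tendsto (fun s : ℝ => x + Real.exp (-s) • w s.toNNReal) atTop (𝓝 x) := by
  have h1 : Tendsto (fun s : ℝ => Real.exp (-s)) atTop (𝓝 0) :=
    Real.tendsto_exp_neg_atTop_nhds_zero
  have h2 : Tendsto (fun s : ℝ => Real.exp (-s) • w s.toNNReal) atTop (𝓝 0) :=
    h1.zero_smul_isBoundedUnder_le
      (isBoundedUnder_of ⟨‖w‖, fun s => w.norm_coe_le_norm _⟩)
  simpa using h2.const_add x

variable {σ : E →L[ℝ] E →L[ℝ] ℝ} {A : E →L[ℝ] E} {K : E → E →L[ℝ] E} {γ : E → E →L[ℝ] ℝ}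

/-- The pointwise identity behind Moser's method: the derivative of the pulled back form along
the flow vanishes. -/
theorem moser_identity (hσ : ∀ u v, σ u v = -σ v u)
    (hA : ∀ u v, σ (A u) v + σ u (A v) = σ u v) {s : Set E} (hs : IsOpen s)
    (hγ : ContDiff ℝ ∞ γ)
    (hd : ∀ x ∈ s, ∀ u v, fderiv ℝ γ x u v - fderiv ℝ γ x v u = σ u v + σ (K x u) v)
    (hK : ∀ x ∈ s, ∀ v, γ x v = σ (A x) v + σ (K x (A x)) v)
    {Y : E → E} (hY : ContDiff ℝ ∞ Y) {t : ℝ} (hYt : ∀ x ∈ s, Y x + t • K x (Y x) = K x (A x))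
    {p : E} (hp : p ∈ s) (P : E) :
    σ (A p) P - γ p P + (1 - t) * (σ (A (Y p)) P + σ (A p) (fderiv ℝ Y p P)) +
      t * (fderiv ℝ γ p (Y p) P + γ p (fderiv ℝ Y p P)) = 0 := by
  have hKanti : ∀ x ∈ s, ∀ u v, σ (K x u) v = -σ (K x v) u := by
    intro x hx u v
    have h1 := hd x hx u v
    have h2 := hd x hx v u
    have h3 := hσ u v
    linarith
  have hzero : ∀ x ∈ s, (1 - t) * σ (A x) (Y x) + t * γ x (Y x) = 0 := by
    intro x hx
    have h1 := congrArg (fun v => σ v (A x)) (hYt x hx)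
    simp only [map_add, map_smul, add_apply, smul_apply, smul_eq_mul] at h1
    have h2 := hKanti x hx (A x) (A x)
    have h3 := hKanti x hx (A x) (Y x)
    have h4 := hσ (A x) (Y x)
    simp only [hK x hx]
    linear_combination h4 + t * h3 - h1 - h2 / 2
  have hder : HasFDerivAt (fun x => (1 - t) * σ (A x) (Y x) + t * γ x (Y x))
      ((1 - t) • ((σ (A p)).comp (fderiv ℝ Y p) + (σ.comp A).flip (Y p)) +
        t • ((γ p).comp (fderiv ℝ Y p) + (fderiv ℝ γ p).flip (Y p))) p := by
    have hYd := (hY.differentiable (by simp) p).hasFDerivAt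
    have hγd := (hγ.differentiable (by simp) p).hasFDerivAt
    exact (((σ.comp A).hasFDerivAt.clm_apply hYd).const_mul (1 - t)).add
      ((hγd.clm_apply hYd).const_mul t)
  have h0 := hder.unique ((hasFDerivAt_const (0 : ℝ) p).congr_of_eventuallyEq
    (by filter_upwards [hs.mem_nhds hp] with x hx using hzero x hx))
  have h1 := congrArg (fun L => L P) h0
  simp only [add_apply, smul_apply, ContinuousLinearMap.comp_apply, ContinuousLinearMap.flip_apply,
    smul_eq_mul, zero_apply] at h1
  have h2 := hd p hp (Y p) P
  have h3 := congrArg (fun v => σ v P) (hYt p hp)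
  simp only [map_add, map_smul, add_apply, smul_apply, smul_eq_mul] at h3
  have h4 := hA (Y p) P
  have h5 := hσ (A P) (Y p)
  simp only [hK p hp] at h1 ⊢
  linear_combination h1 + t * h2 + h3 + (1 - t) * h4 - (1 - t) * h5

/-- Moser's method: a primitive whose linear part is `σ (A x)` and which satisfies the same
algebraic relation with its own differential is smoothly linearizable. -/
theorem exists_moser (hσ : ∀ u v, σ u v = -σ v u)
    (hA : ∀ u v, σ (A u) v + σ u (A v) = σ u v) (hγ : ContDiff ℝ ∞ γ)
    (hKs : ContDiff ℝ ∞ K) (hK0 : K 0 = 0) (hK1 : ∀ x, ‖K x‖ ≤ 1 / 2)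
    (hd : ∀ᶠ x in 𝓝 0, ∀ u v,
      fderiv ℝ γ x u v - fderiv ℝ γ x v u = σ u v + σ (K x u) v)
    (hK : ∀ᶠ x in 𝓝 0, ∀ v, γ x v = σ (A x) v + σ (K x (A x)) v) :
    ∃ φ : E → E, ContDiff ℝ ∞ φ ∧ φ 0 = 0 ∧ fderiv ℝ φ 0 = .id ℝ E ∧
      ∀ᶠ x in 𝓝 0, ∀ u, γ (φ x) (fderiv ℝ φ x u) = σ (A x) u := by
  have hnorm : ∀ z : ℝ × E, ‖Real.sin z.1 • K z.2‖ < 1 := by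
    intro z
    rw [norm_smul, Real.norm_eq_abs]
    have h1 := mul_le_mul (Real.abs_sin_le_one z.1) (hK1 z.2) (norm_nonneg _) zero_le_one
    linarith
  set g : E → E := fun x => K x (A x) with hg
  have hgs : ContDiff ℝ ∞ g := hKs.clm_apply A.contDiff
  have hg0 : g 0 = 0 := by simp [hg]
  have hgd : HasFDerivAt g (0 : E →L[ℝ] E) 0 := by
    refine ((hKs.differentiable (by simp) 0).hasFDerivAt.clm_apply A.hasFDerivAt).congr_fderiv ?_
    ext u
    simp [hK0]
  set f : ℝ × E → E := fun z =>
    (ContinuousLinearMap.id ℝ E + Real.sin z.1 • K z.2).inverse (g z.2) with hf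
  have hinvs : ContDiff ℝ ∞ fun z : ℝ × E =>
      (ContinuousLinearMap.id ℝ E + Real.sin z.1 • K z.2).inverse :=
    contDiff_inverse_id_add ((Real.contDiff_sin.comp contDiff_fst).smul (hKs.comp contDiff_snd))
      hnorm
  have hfs : ContDiff ℝ ∞ f := hinvs.clm_apply (hgs.comp contDiff_snd)
  set τ : ℝ≥0 → ℝ := fun s => Real.arcsin (Real.exp (-s)) with hτ
  have hτc : Continuous τ := Real.continuous_arcsin.comp (by fun_prop)
  have hsin : ∀ s, Real.sin (τ s) = Real.exp (-s) := fun s =>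
    Real.sin_arcsin (by linarith [Real.exp_pos (-(s : ℝ))])
      (Real.exp_le_one_iff.mpr (by simp))
  have hF := uniformlySmooth_of_contDiff_of_compact hfs hτc fun s => Real.arcsin_mem_Icc _
  have hFeq : ∀ s x, f (τ s, x) + Real.exp (-s) • K x (f (τ s, x)) = K x (A x) := by
    intro s x
    have h := id_add_apply_inverse (hnorm (τ s, x)) (g x)
    simp only [hsin] at h
    simp only [hf, hsin]
    exact h
  obtain ⟨w, hw0, hw1, hws, hwfix, -⟩ := exists_asymptotic_solution hF
    (fun s => by simp [hf, hg0])
    (fun s => by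
      refine HasFDerivAt.fderiv ?_
      have h1 : HasFDerivAt (fun x =>
          (ContinuousLinearMap.id ℝ E + Real.sin (τ s) • K x).inverse) _ 0 :=
        ((hinvs.comp (contDiff_const.prodMk contDiff_id)).differentiable
          (by simp) 0).hasFDerivAt
      refine (h1.clm_apply hgd).congr_fderiv ?_
      ext u
      simp [hg0])
  have hwc : ContinuousAt w 0 := hws.self_of_nhds.continuousAt
  have hwd := fderiv_asymptotic_solution hF hws hwfix
  obtain ⟨S, hSmem, hS, hS0⟩ := eventually_nhds_iff.mp (hd.and hK)
  have hpS := eventually_forall_asymptoticCurve_mem hwc hw0 (hS.mem_nhds hS0)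
  let ev : (ℝ≥0 →ᵇ E) →L[ℝ] E := BoundedContinuousFunction.evalCLM ℝ 0
  obtain ⟨φ, hφ, hφeq⟩ := exists_contDiff_eventuallyEq (f := fun x => x + ev (w x)) (by
    filter_upwards [hws] with x hx
    exact contDiffAt_id.add (ev.contDiff.contDiffAt.comp x hx))
  have hφd : ∀ᶠ x in 𝓝 0, ∀ u, fderiv ℝ φ x u = u + fderiv ℝ w x u 0 := by
    filter_upwards [hws, hφeq.eventually_nhds] with x hx hφx u
    have h1 : HasFDerivAt (fun x => x + ev (w x)) (.id ℝ E + ev.comp (fderiv ℝ w x)) x :=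
      (hasFDerivAt_id x).add (ev.hasFDerivAt.comp x (hx.differentiableAt (by simp)).hasFDerivAt)
    rw [(h1.congr_of_eventuallyEq hφx).fderiv]
    rfl
  refine ⟨φ, hφ, ?_, ?_, ?_⟩
  · simpa [hw0] using hφeq.self_of_nhds
  · ext u
    rw [hφd.self_of_nhds, hw1]
    simp
  · filter_upwards [hφd, hφeq, hwfix, hwd, hpS] with x hdx hx hfix hdfix hS' u
    have hev : ev (w x) = w x 0 := rfl
    rw [hdx, hx, hev]
    set p : ℝ → E := fun r => x + Real.exp (-r) • w x r.toNNReal with hp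
    set P : ℝ → E := fun r => u + Real.exp (-r) • fderiv ℝ w x u r.toNNReal with hP
    have hpder : ∀ r, 0 ≤ r → HasDerivWithinAt p
        (Real.exp (-r) • f (τ r.toNNReal, p r)) (Ici 0) r := by
      intro r hr
      have h := hasDerivWithinAt_asymptoticCurve (x := x) hfix hr
      rw [UniformlySmooth.superposition_apply, asymptoticCurve_apply, Real.coe_toNNReal r hr] at h
      exact h
    have hPder : ∀ r, 0 ≤ r → HasDerivWithinAt P
        (Real.exp (-r) • fderiv ℝ (fun y => f (τ r.toNNReal, y)) (p r) (P r)) (Ici 0) r := by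
      intro r hr
      have h := hasDerivWithinAt_asymptoticCurve (x := u) (hdfix u) hr
      rw [pointwiseApply_apply, UniformlySmooth.superposition_apply, asymptoticCurve_apply,
        asymptoticCurve_apply, Real.coe_toNNReal r hr] at h
      exact h
    have hpmem : ∀ r, 0 ≤ r → p r ∈ S := by
      intro r hr
      have h := hS' r.toNNReal
      rwa [asymptoticCurve_apply, Real.coe_toNNReal r hr] at h
    set G : ℝ → ℝ := fun r =>
      (1 - Real.exp (-r)) * σ (A (p r)) (P r) + Real.exp (-r) * γ (p r) (P r) with hG
    have hGder : ∀ r, 0 ≤ r → HasDerivWithinAt G 0 (Ici 0) r := by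
      intro r hr
      have he : HasDerivWithinAt (fun r : ℝ => Real.exp (-r)) (Real.exp (-r) * -1) (Ici 0) r :=
        ((hasDerivAt_neg r).exp).hasDerivWithinAt
      have hp1 := hpder r hr
      have hP1 := hPder r hr
      have h1 := ((σ.comp A).hasFDerivAt.comp_hasDerivWithinAt r hp1).clm_apply hP1
      have h2 := ((hγ.differentiable (by simp) (p r)).hasFDerivAt.comp_hasDerivWithinAt r
        hp1).clm_apply hP1
      refine ((((hasDerivWithinAt_const r (Ici 0) (1 : ℝ)).sub he).mul h1).add
        (he.mul h2)).congr_deriv ?_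
      have key := moser_identity hσ hA hS hγ (fun y hy => (hSmem y hy).1)
        (fun y hy => (hSmem y hy).2) (hF.smooth r.toNNReal) (t := Real.exp (-r))
        (fun y _ => by
          have h3 := hFeq r.toNNReal y
          rwa [Real.coe_toNNReal r hr] at h3) (hpmem r hr) (P r)
      simp only [map_smul, smul_apply, ContinuousLinearMap.comp_apply, Function.comp_apply,
        smul_eq_mul, Pi.sub_apply]
      linear_combination Real.exp (-r) * key
    have hconst : ∀ r, 0 ≤ r → G r = G 0 := by
      intro r hr
      refine constant_of_has_deriv_right_zero (a := 0) (b := r) (fun y hy => ?_) (fun y hy => ?_)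
        r ⟨hr, le_rfl⟩
      · exact (hGder y hy.1).continuousWithinAt.mono Icc_subset_Ici_self
      · exact (hGder y hy.1).mono (Ici_subset_Ici.mpr hy.1)
    have hlim : Tendsto G atTop (𝓝 (σ (A x) u)) := by
      have hp' : Tendsto p atTop (𝓝 x) := tendsto_asymptoticCurve x (w x)
      have hP' : Tendsto P atTop (𝓝 u) := tendsto_asymptoticCurve u (fderiv ℝ w x u)
      have he := Real.tendsto_exp_neg_atTop_nhds_zero
      have h1 : Tendsto (fun r => σ (A (p r)) (P r)) atTop (𝓝 (σ (A x) u)) :=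
        ((isBoundedBilinearMap_apply (𝕜 := ℝ)).continuous.tendsto (σ (A x), u)).comp
          ((((σ.comp A).continuous.tendsto x).comp hp').prodMk_nhds hP')
      have h2 : Tendsto (fun r => γ (p r) (P r)) atTop (𝓝 (γ x u)) :=
        ((isBoundedBilinearMap_apply (𝕜 := ℝ)).continuous.tendsto (γ x, u)).comp
          (((hγ.continuous.tendsto x).comp hp').prodMk_nhds hP')
      have h3 := ((he.const_sub 1).mul h1).add (he.mul h2)
      simpa using h3
    have h4 : G 0 = σ (A x) u := by
      refine tendsto_nhds_unique (tendsto_const_nhds.congr' ?_) hlim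
      filter_upwards [eventually_ge_atTop 0] with r hr using (hconst r hr).symm
    simpa [hG, hp, hP] using h4

end Moser

section Linearization

open Filter

theorem exists_equiv_dual {E : Type u} [NormedAddCommGroup E] [NormedSpace ℝ E]
    [FiniteDimensional ℝ E] {σ : E →L[ℝ] E →L[ℝ] ℝ} (hnd : ∀ u, (∀ v, σ u v = 0) → u = 0) :
    ∃ e : E ≃L[ℝ] (E →L[ℝ] ℝ), (e : E →L[ℝ] E →L[ℝ] ℝ) = σ := by
  have hinj : Function.Injective (σ : E →ₗ[ℝ] E →L[ℝ] ℝ) := by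
    refine (injective_iff_map_eq_zero _).mpr fun u hu => hnd u fun v => ?_
    exact congrArg (fun L : E →L[ℝ] ℝ => L v) hu
  have hrank : Module.finrank ℝ E = Module.finrank ℝ (E →L[ℝ] ℝ) := by
    rw [← (LinearMap.toContinuousLinearMap (𝕜 := ℝ) (E := E) (F' := ℝ)).finrank_eq]
    exact Subspace.dual_finrank_eq.symm
  refine ⟨(LinearEquiv.ofInjectiveOfFinrankEq (σ : E →ₗ[ℝ] E →L[ℝ] ℝ) hinj
    hrank).toContinuousLinearEquiv, ?_⟩
  ext u v
  rfl

/-- The exterior derivative of a 1-form commutes with pullback. -/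
theorem fderiv_pullback_sub {E : Type u} [NormedAddCommGroup E] [NormedSpace ℝ E]
    {γ : E → E →L[ℝ] ℝ} (hγ : ContDiff ℝ ∞ γ) {Φ : E → E} (hΦ : ContDiff ℝ ∞ Φ) (x u v : E) :
    fderiv ℝ (fun x => (γ (Φ x)).comp (fderiv ℝ Φ x)) x u v -
        fderiv ℝ (fun x => (γ (Φ x)).comp (fderiv ℝ Φ x)) x v u =
      fderiv ℝ γ (Φ x) (fderiv ℝ Φ x u) (fderiv ℝ Φ x v) -
        fderiv ℝ γ (Φ x) (fderiv ℝ Φ x v) (fderiv ℝ Φ x u) := by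
  have h1 : HasFDerivAt (fun x => (γ (Φ x)).comp (fderiv ℝ Φ x)) _ x :=
    ((hγ.differentiable (by simp) (Φ x)).hasFDerivAt.comp x
      (hΦ.differentiable (by simp) x).hasFDerivAt).clm_comp
      ((hΦ.fderiv_right (m := ∞) (by simp)).differentiable (by simp) x).hasFDerivAt
  have h2 : IsSymmSndFDerivAt ℝ Φ x := hΦ.contDiffAt.isSymmSndFDerivAt (by
    rw [minSmoothness_of_isRCLikeNormedField]
    exact WithTop.coe_le_coe.mpr (le_top : (2 : ℕ∞) ≤ ⊤))
  rw [h1.fderiv]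
  simp only [Function.comp_apply, add_apply, ContinuousLinearMap.comp_apply,
    ContinuousLinearMap.compL_apply, ContinuousLinearMap.flip_apply]
  rw [h2.eq u v]
  ring

variable {E : Type u} [NormedAddCommGroup E] [NormedSpace ℝ E] [FiniteDimensional ℝ E]

theorem exists_conformal_field {σ : E →L[ℝ] E →L[ℝ] ℝ} (hnd : ∀ u, (∀ v, σ u v = 0) → u = 0)
    {γ : E → E →L[ℝ] ℝ} (hγ : ContDiff ℝ ∞ γ) :
    ∃ X : E → E, ContDiff ℝ ∞ X ∧ ∀ x v, σ (X x) v = γ x v := by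
  obtain ⟨e, he⟩ := exists_equiv_dual hnd
  refine ⟨fun x => e.symm (γ x), e.symm.contDiff.comp hγ, fun x v => ?_⟩
  rw [← he]
  simp

/-- The relation `σ (A u) v + σ u (A v) = σ u v` for the linear part of a conformal field. -/
theorem linear_part_conformal {σ : E →L[ℝ] E →L[ℝ] ℝ} (hσ : ∀ u v, σ u v = -σ v u)
    {γ : E → E →L[ℝ] ℝ} (hd : ∀ u v, fderiv ℝ γ 0 u v - fderiv ℝ γ 0 v u = σ u v)
    {X : E → E} (hXs : ContDiff ℝ ∞ X) (hX : ∀ x v, σ (X x) v = γ x v) (u v : E) :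
    σ (fderiv ℝ X 0 u) v + σ u (fderiv ℝ X 0 v) = σ u v := by
  have hγX : γ = fun x => σ (X x) := by
    funext x
    ext v
    exact (hX x v).symm
  have hγA : fderiv ℝ γ 0 = σ.comp (fderiv ℝ X 0) := by
    rw [hγX]
    exact (σ.hasFDerivAt.comp 0 (hXs.differentiable (by simp) 0).hasFDerivAt).fderiv
  have h := hd u v
  rw [hγA] at h
  simp only [ContinuousLinearMap.comp_apply] at h
  linarith [hσ (fderiv ℝ X 0 v) u]

theorem exists_contDiff_pullback_sub (σ : E →L[ℝ] E →L[ℝ] ℝ) {D : E → E →L[ℝ] E}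
    (hD : ContDiff ℝ ∞ D) :
    ∃ L : E → E →L[ℝ] E →L[ℝ] ℝ, ContDiff ℝ ∞ L ∧
      ∀ x u v, L x u v = σ (D x u) (D x v) - σ u v := by
  refine ⟨fun x => ((ContinuousLinearMap.compL ℝ E E ℝ).flip (D x)).comp (σ.comp (D x)) - σ,
    ?_, fun x u v => ?_⟩
  · have h1 : ContDiff ℝ ∞ fun x => (ContinuousLinearMap.compL ℝ E E ℝ).flip (D x) :=
      (ContinuousLinearMap.contDiff _).comp hD
    have h2 : ContDiff ℝ ∞ fun x => σ.comp (D x) := contDiff_const.clm_comp hD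
    exact (h1.clm_comp h2).sub contDiff_const
  · simp

/-- The deviation from being `σ`-symplectic of a local diffeomorphism tangent to the identity. -/
theorem exists_small_pullback_sub {σ : E →L[ℝ] E →L[ℝ] ℝ}
    (hnd : ∀ u, (∀ v, σ u v = 0) → u = 0) {D : E → E →L[ℝ] E} (hD : ContDiff ℝ ∞ D)
    (h1 : D 0 = .id ℝ E) :
    ∃ K : E → E →L[ℝ] E, ContDiff ℝ ∞ K ∧ K 0 = 0 ∧ (∀ x, ‖K x‖ ≤ 1 / 2) ∧
      ∀ᶠ x in 𝓝 0, ∀ u v, σ (K x u) v = σ (D x u) (D x v) - σ u v := by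
  obtain ⟨e, he⟩ := exists_equiv_dual hnd
  obtain ⟨L, hLs, hL⟩ := exists_contDiff_pullback_sub σ hD
  have hL0 : L 0 = 0 := by
    ext u v
    simp [hL, h1]
  have hs : ContDiff ℝ ∞ fun x => (e.symm : (E →L[ℝ] ℝ) →L[ℝ] E).comp (L x) :=
    contDiff_const.clm_comp hLs
  obtain ⟨K, hKs, hKeq, hK1⟩ := exists_contDiff_eventuallyEq_small
    (.of_forall fun x => hs.contDiffAt) (by simp [hL0]) (one_half_pos (α := ℝ))
  refine ⟨K, hKs, by simp [hKeq.self_of_nhds, hL0], hK1, ?_⟩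
  filter_upwards [hKeq] with x hx u v
  rw [hx, ← hL, ← he]
  simp

theorem exists_linearization_of_conjugates {σ : E →L[ℝ] E →L[ℝ] ℝ}
    (hσ : ∀ u v, σ u v = -σ v u) (hnd : ∀ u, (∀ v, σ u v = 0) → u = 0)
    {γ : E → E →L[ℝ] ℝ} (hγ : ContDiff ℝ ∞ γ)
    (hd : ∀ᶠ x in 𝓝 0, ∀ u v, fderiv ℝ γ x u v - fderiv ℝ γ x v u = σ u v)
    {X : E → E} (hX : ∀ x v, σ (X x) v = γ x v) {A : E →L[ℝ] E}
    (hA : ∀ u v, σ (A u) v + σ u (A v) = σ u v) {Φ : E → E} (hΦ : Conjugates Φ X A) :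
    ∃ φ : E → E, ContDiff ℝ ∞ φ ∧ φ 0 = 0 ∧ fderiv ℝ φ 0 = .id ℝ E ∧
      ∀ᶠ x in 𝓝 0, ∀ u, γ (φ x) (fderiv ℝ φ x u) = σ (A x) u := by
  have hDΦ : ContDiff ℝ ∞ (fderiv ℝ Φ) := hΦ.smooth.fderiv_right (by simp)
  obtain ⟨K, hKs, hK0, hK1, hKσ⟩ := exists_small_pullback_sub hnd hDΦ hΦ.fderiv_zero
  have hΦc : Tendsto Φ (𝓝 0) (𝓝 0) := by
    simpa [hΦ.map_zero] using hΦ.smooth.continuous.tendsto 0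
  obtain ⟨φ, hφ, hφ0, hφ1, hφγ⟩ := exists_moser (K := K)
    (γ := fun x => (γ (Φ x)).comp (fderiv ℝ Φ x)) hσ hA
    ((hγ.comp hΦ.smooth).clm_comp hDΦ) hKs hK0 hK1
    (by
      filter_upwards [hKσ, hΦc.eventually hd] with x hx hdx u v
      rw [fderiv_pullback_sub hγ hΦ.smooth, hdx, hx]
      ring)
    (by
      filter_upwards [hKσ, hΦ.eventually_eq] with x hx hcx v
      rw [hx, hcx, hX]
      simp)
  refine ⟨Φ ∘ φ, hΦ.smooth.comp hφ, by simp [hφ0, hΦ.map_zero], ?_, ?_⟩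
  · rw [fderiv_comp 0 (hΦ.smooth.differentiable (by simp) _) (hφ.differentiable (by simp) 0), hφ0,
      hΦ.fderiv_zero, hφ1, ContinuousLinearMap.id_comp]
  · filter_upwards [hφγ] with x hx u
    rw [fderiv_comp x (hΦ.smooth.differentiable (by simp) _) (hφ.differentiable (by simp) x),
      ← hx]
    rfl

end Linearization

section StandardForm

open Filter

variable {n : ℕ} {ω₀ : (Fin (n + n) → ℝ) → (Fin (n + n) → ℝ) → ℝ}

theorem exists_standard_form (hω₀ : ∀ u v : Fin (n + n) → ℝ, ω₀ u v =
      ∑ i : Fin n, (u (Fin.castAdd n i) * v (Fin.natAdd n i)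
                    - u (Fin.natAdd n i) * v (Fin.castAdd n i))) :
    ∃ σ : (Fin (n + n) → ℝ) →L[ℝ] (Fin (n + n) → ℝ) →L[ℝ] ℝ, (∀ u v, σ u v = ω₀ u v) ∧
      (∀ u v, σ u v = -σ v u) ∧ ∀ u, (∀ v, σ u v = 0) → u = 0 := by
  let B : (Fin (n + n) → ℝ) →ₗ[ℝ] (Fin (n + n) → ℝ) →ₗ[ℝ] ℝ := LinearMap.mk₂ ℝ ω₀
    (fun u v w => by
      simp only [hω₀, Pi.add_apply, ← Finset.sum_add_distrib]
      exact Finset.sum_congr rfl fun i _ => by ring)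
    (fun c u v => by
      simp only [hω₀, Pi.smul_apply, smul_eq_mul, Finset.mul_sum]
      exact Finset.sum_congr rfl fun i _ => by ring)
    (fun u v w => by
      simp only [hω₀, Pi.add_apply, ← Finset.sum_add_distrib]
      exact Finset.sum_congr rfl fun i _ => by ring)
    (fun c u v => by
      simp only [hω₀, Pi.smul_apply, smul_eq_mul, Finset.mul_sum]
      exact Finset.sum_congr rfl fun i _ => by ring)
  have hB : ∀ u v, B.toContinuousBilinearMap u v = ω₀ u v := fun u v => rfl
  refine ⟨B.toContinuousBilinearMap, hB, fun u v => ?_, fun u hu => ?_⟩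
  · rw [hB, hB, hω₀, hω₀, ← Finset.sum_neg_distrib]
    exact Finset.sum_congr rfl fun i _ => by ring
  · have hca : ∀ i j : Fin n, Fin.castAdd n i ≠ Fin.natAdd n j := fun i j h => by
      have := congrArg Fin.val h
      simp at this
      lia
    funext j
    refine Fin.addCases (fun i => ?_) (fun i => ?_) j
    · have h := hu (Pi.single (Fin.natAdd n i) 1)
      rw [hB, hω₀] at h
      simpa [Pi.single_apply, hca, (hca _ _).symm, -Fin.natAdd_eq_addNat] using h
    · have h := hu (Pi.single (Fin.castAdd n i) 1)
      rw [hB, hω₀] at h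
      simpa [Pi.single_apply, hca, (hca _ _).symm, -Fin.natAdd_eq_addNat] using h

end StandardForm

section LocalInverse

open Filter

variable {E : Type*} [NormedAddCommGroup E] [NormedSpace ℝ E] [FiniteDimensional ℝ E]

theorem exists_local_diffeomorphism {φ : E → E} (hφ : ContDiff ℝ ∞ φ) (hφ1 : fderiv ℝ φ 0 = .id ℝ E)
    {P : E → Prop} (hP : ∀ᶠ x in 𝓝 0, P x) :
    ∃ V : Set E, IsOpen V ∧ 0 ∈ V ∧ (∀ x ∈ V, P x) ∧ Set.InjOn φ V ∧ IsOpen (φ '' V) ∧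
      ∃ ψ : E → E, ContDiffOn ℝ ∞ ψ (φ '' V) ∧ (∀ x ∈ V, ψ (φ x) = x) ∧
        ∀ y ∈ φ '' V, φ (ψ y) = y := by
  obtain ⟨e, rfl, h0, hsymm⟩ := exists_openPartialHomeomorph hφ hφ1
  obtain ⟨W, hWP, hW, h0W⟩ := eventually_nhds_iff.mp hP
  have hinv : ∀ x ∈ e.source ∩ W, e.symm (e x) = x := fun x hx => e.left_inv hx.1
  refine ⟨e.source ∩ W, e.open_source.inter hW, ⟨h0, h0W⟩, fun x hx => hWP x hx.2,
    e.injOn.mono Set.inter_subset_left, e.isOpen_image_source_inter hW, e.symm, ?_, hinv, ?_⟩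
  · rintro _ ⟨x, hx, rfl⟩
    exact (hsymm _ (e.map_source hx.1)).contDiffWithinAt
  · rintro _ ⟨x, hx, rfl⟩
    rw [hinv x hx]

end LocalInverse

end Preparation

/-- A smooth primitive 1-form `γ` of the standard symplectic form `ω₀` on
`ℝ^{2n}` vanishing at `0`, whose associated conformal vector field `X` (defined by
`ω₀(X(x), ·) = γₓ`) has hyperbolic and nonresonant linear part `A = DX(0)`, is smoothly
linearizable: some local diffeomorphism `φ` fixing `0` pulls `γ` back to the linear 1-form
`x ↦ ω₀(Ax, ·)`. Here the (complex) eigenvalues of `A` are the roots `lam 1, …, lam 2n` of the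
characteristic polynomial of the complexification of `A`; hyperbolicity means no eigenvalue is
purely imaginary, and nonresonance means there is no relation `∑ αᵢ·lamᵢ = 1` with `αᵢ ∈ ℕ`,
`∑ αᵢ ≥ 3`. -/
theorem primitive_one_form_smooth_linearization
    (n : ℕ)
    (ω₀ : (Fin (n+n) → ℝ) → (Fin (n+n) → ℝ) → ℝ)
    (hω₀ : ∀ u v : Fin (n+n) → ℝ, ω₀ u v =
      ∑ i : Fin n, (u (Fin.castAdd n i) * v (Fin.natAdd n i)
                    - u (Fin.natAdd n i) * v (Fin.castAdd n i)))
    (U : Set (Fin (n+n) → ℝ)) (hU : IsOpen U) (h0U : (0 : Fin (n+n) → ℝ) ∈ U)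
    (γ : (Fin (n+n) → ℝ) → (Fin (n+n) → ℝ) →L[ℝ] ℝ)
    (hγ : ContDiffOn ℝ (⊤ : ℕ∞) γ U) (hγ0 : γ 0 = 0)
    -- dγ = ω₀ :
    (hdγ : ∀ x ∈ U, ∀ u v : Fin (n+n) → ℝ,
      fderiv ℝ γ x u v - fderiv ℝ γ x v u = ω₀ u v)
    -- the associated conformal (Liouville) vector field :
    (X : (Fin (n+n) → ℝ) → (Fin (n+n) → ℝ))
    (hX : ∀ x ∈ U, ∀ v : Fin (n+n) → ℝ, ω₀ (X x) v = γ x v)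
    -- the complex eigenvalues of A = DX(0) :
    (lam : Fin (n+n) → ℂ)
    (hlam : (Matrix.charpoly ((LinearMap.toMatrix'
        ((fderiv ℝ X 0 : (Fin (n+n) → ℝ) →L[ℝ] (Fin (n+n) → ℝ)) :
          (Fin (n+n) → ℝ) →ₗ[ℝ] (Fin (n+n) → ℝ))).map (algebraMap ℝ ℂ))).roots
      = Multiset.map lam Finset.univ.val)
    -- hyperbolicity :
    (hhyp : ∀ i, (lam i).re ≠ 0)
    -- no resonance relation ∑ αᵢ lamᵢ = 1 with ∑ αᵢ ≥ 3 :
    (hres : ∀ a : Fin (n+n) → ℕ, 3 ≤ ∑ i, a i → ∑ i, (a i : ℂ) * lam i ≠ 1) :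
    ∃ V : Set (Fin (n+n) → ℝ), IsOpen V ∧ (0 : Fin (n+n) → ℝ) ∈ V ∧
    ∃ φ ψ : (Fin (n+n) → ℝ) → (Fin (n+n) → ℝ),
      φ 0 = 0 ∧
      ContDiffOn ℝ (⊤ : ℕ∞) φ V ∧
      Set.InjOn φ V ∧ IsOpen (φ '' V) ∧
      ContDiffOn ℝ (⊤ : ℕ∞) ψ (φ '' V) ∧
      (∀ x ∈ V, ψ (φ x) = x) ∧ (∀ y ∈ φ '' V, φ (ψ y) = y) ∧
      (∀ x ∈ V, φ x ∈ U) ∧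
      -- the pullback φ*γ is the linear 1-form x ↦ ω₀(Ax, ·) :
      (∀ x ∈ V, ∀ u : Fin (n+n) → ℝ,
        γ (φ x) (fderiv ℝ φ x u) = ω₀ (fderiv ℝ X 0 x) u) := by
  obtain ⟨σ, hσω, hσ, hnd⟩ := exists_standard_form hω₀
  have hU0 : U ∈ 𝓝 0 := hU.mem_nhds h0U
  obtain ⟨γ', hγ's, hγ'⟩ := exists_contDiff_eventuallyEq (f := γ) (by
    filter_upwards [hU0] with x hx
    exact hγ.contDiffAt (hU.mem_nhds hx))
  obtain ⟨X', hX's, hX'⟩ := exists_conformal_field hnd hγ's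
  have hXX' : X' =ᶠ[𝓝 0] X := by
    filter_upwards [hγ', hU0] with x hx hxU
    refine sub_eq_zero.mp (hnd _ fun v => ?_)
    rw [map_sub, sub_apply, hX', hσω, hX x hxU, hx, sub_self]
  have hd : ∀ᶠ x in 𝓝 0, ∀ u v, fderiv ℝ γ' x u v - fderiv ℝ γ' x v u = σ u v := by
    filter_upwards [hγ'.eventuallyEq_nhds, hU0] with x hx hxU u v
    rw [hx.fderiv_eq, hdγ x hxU, hσω]
  have hX'0 : X' 0 = 0 := hnd _ fun v => by
    rw [hX', hγ'.self_of_nhds, hγ0, zero_apply]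
  rw [← hXX'.fderiv_eq] at hlam ⊢
  have hA := linear_part_conformal hσ hd.self_of_nhds hX's hX'
  obtain ⟨Φ, hΦ⟩ := exists_conjugates_linear hX's hX'0 hnd hA
    fun k hk z hz => sum_ne_one_of_not_resonant hlam hres hk z hz
  obtain ⟨φ, hφ, hφ0, hφ1, hφγ⟩ := exists_linearization_of_conjugates hσ hnd hγ's hd hX' hA hΦ
  have hφc : Filter.Tendsto φ (𝓝 0) (𝓝 0) := by
    simpa [hφ0] using hφ.continuous.tendsto 0
  obtain ⟨V, hV, h0V, hVP, hinj, hopen, ψ, hψ, hψφ, hφψ⟩ := exists_local_diffeomorphism hφ hφ1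
    ((hφc.eventually hU0).and ((hφc.eventually hγ').and hφγ))
  refine ⟨V, hV, h0V, φ, ψ, hφ0, hφ.contDiffOn, hinj, hopen, hψ, hψφ, hφψ,
    fun x hx => (hVP x hx).1, fun x hx u => ?_⟩
  obtain ⟨-, h1, h2⟩ := hVP x hx
  rw [← h1, h2, hσω]
end

section
/- Let 𝕂 = ℝ or ℂ, and let S(x) = Σ_{i=1}^m λ_i x_i e_i be a diagonal linear vector field on 𝕂^m. Let X be an analytic vector field on a neighborhood of 0 in 𝕂^m with X(0) = 0 such that: (a) DX(0) − S is nilpotent and commutes with S (so S is the semisimple part of DX(0)); (b) X commutes with S, i.e. DX(x)(Sx) = S(X(x)) for all x near 0 (X is in Poincaré–Dulac normal form). Let ω be an analytic 2-form near 0 (an analytic map from a neighborhood of 0 to the space of alternating bilinear forms on 𝕂^m) such that L_X ω = ω. Then L_S ω = ω. -/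
open scoped Topology

namespace MultilinearMap
variable {R M N : Type*} [CommRing R] [AddCommGroup M] [Module R M] [AddCommGroup N] [Module R N]
  {ι : Type*} [DecidableEq ι]

/-- Precomposition of a multilinear map with a linear endomorphism in the `i`-th argument. -/
def compSlot (i : ι) (A : M →ₗ[R] M) :
    Module.End R (MultilinearMap R (fun _ : ι ↦ M) N) :=
  compLinearMapₗ (Function.update (fun _ ↦ LinearMap.id) i A)

theorem compSlot_apply (i : ι) (A : M →ₗ[R] M) (f : MultilinearMap R (fun _ : ι ↦ M) N)
    (v : ι → M) : compSlot i A f v = f (Function.update v i (A (v i))) := by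
  simp only [compSlot, compLinearMapₗ_apply, compLinearMap_apply]
  congr 1
  ext j
  obtain rfl | h := eq_or_ne j i <;> simp [*]

theorem compSlot_pow (i : ι) (A : M →ₗ[R] M) (n : ℕ) :
    (compSlot i A : Module.End R (MultilinearMap R (fun _ : ι ↦ M) N)) ^ n =
      compSlot i (A ^ n) := by
  induction n with
  | zero => ext f v; simp [compSlot_apply]
  | succ n ih =>
    rw [pow_succ, ih, pow_succ']
    ext f v
    simp [compSlot_apply]

theorem commute_compSlot {A B : Module.End R M} (h : Commute A B) (i j : ι) :
    Commute (compSlot i A : Module.End R (MultilinearMap R (fun _ : ι ↦ M) N)) (compSlot j B) := by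
  ext f v
  obtain rfl | hij := eq_or_ne i j
  · simp [compSlot_apply, show B (A (v i)) = A (B (v i)) from (LinearMap.congr_fun h.eq (v i)).symm]
  · simp [compSlot_apply, hij, hij.symm, Function.update_comm hij]

variable [Fintype ι]

/-- The derivation on multilinear maps induced by a linear endomorphism of the source. -/
def derivationOf (A : M →ₗ[R] M) : Module.End R (MultilinearMap R (fun _ : ι ↦ M) N) :=
  ∑ i, compSlot i A

theorem derivationOf_apply (A : M →ₗ[R] M) (f : MultilinearMap R (fun _ : ι ↦ M) N)
    (v : ι → M) : derivationOf A f v = ∑ i, f (Function.update v i (A (v i))) := by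
  simp [derivationOf, compSlot_apply]

theorem derivationOf_add (A B : M →ₗ[R] M) :
    (derivationOf (A + B) : Module.End R (MultilinearMap R (fun _ : ι ↦ M) N)) =
      derivationOf A + derivationOf B := by
  ext f v
  simp [derivationOf_apply, Finset.sum_add_distrib]

theorem commute_derivationOf {A B : Module.End R M} (h : Commute A B) :
    Commute (derivationOf A : Module.End R (MultilinearMap R (fun _ : ι ↦ M) N))
      (derivationOf B) :=
  Commute.sum_left _ _ _ fun i _ ↦ Commute.sum_right _ _ _ fun j _ ↦ commute_compSlot h i j

theorem isNilpotent_derivationOf {A : Module.End R M} (h : IsNilpotent A) :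
    IsNilpotent (derivationOf A : Module.End R (MultilinearMap R (fun _ : ι ↦ M) N)) := by
  refine Commute.isNilpotent_sum (fun i _ ↦ ?_) fun i j _ _ ↦ commute_compSlot (.refl A) i j
  obtain ⟨n, hn⟩ := h
  refine ⟨n, ?_⟩
  rw [compSlot_pow, hn]
  ext f v
  rw [compSlot_apply]
  exact f.map_update_zero v i

theorem derivationOf_apply_basis {κ : Type*} (b : Module.Basis κ R M) {S : M →ₗ[R] M} {μ : κ → R}
    (hS : ∀ k, S (b k) = μ k • b k) (f : MultilinearMap R (fun _ : ι ↦ M) N) (I : ι → κ) :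
    derivationOf S f (fun i ↦ b (I i)) = (∑ i, μ (I i)) • f (fun i ↦ b (I i)) := by
  simp [derivationOf_apply, hS, Finset.sum_smul]

/-- If `S` is diagonalizable and `A - S` is nilpotent and commutes with `S`, a multilinear map which
is fixed by the derivation of `A` and lies in the range of `derivationOf S - 1` vanishes. -/
theorem eq_zero_of_derivationOf_eq_self {κ K V W : Type*} [Field K] [AddCommGroup V]
    [Module K V] [AddCommGroup W] [Module K W] (b : Module.Basis κ K V) {S A : Module.End K V}
    {μ : κ → K} (hS : ∀ k, S (b k) = μ k • b k) (hA : IsNilpotent (A - S)) (hcomm : Commute (A - S) S)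
    {f p : MultilinearMap K (fun _ : ι ↦ V) W} (hf : derivationOf A f = f)
    (hp : f = derivationOf S p - p) : f = 0 := by
  set T : Module.End K (MultilinearMap K (fun _ : ι ↦ V) W) := derivationOf S - 1
  set D : Module.End K (MultilinearMap K (fun _ : ι ↦ V) W) := derivationOf (A - S)
  have hTD : Commute T D := (commute_derivationOf hcomm.symm).sub_left (Commute.one_left _)
  have hTf : T f = (-D) f := by
    have : derivationOf A f = D f + derivationOf S f := by
      rw [← LinearMap.add_apply, ← derivationOf_add, sub_add_cancel]
    simp only [T, LinearMap.sub_apply, LinearMap.neg_apply, Module.End.one_apply]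
    rw [eq_neg_iff_add_eq_zero, sub_add_eq_add_sub, add_comm, ← this, hf, sub_self]
  have hpow (n : ℕ) : (T ^ n) f = ((-D) ^ n) f := by
    induction n with
    | zero => rfl
    | succ n ih =>
      rw [pow_succ, Module.End.mul_apply, hTf, ← Module.End.mul_apply,
        ((hTD.neg_right).pow_left n).eq, Module.End.mul_apply, ih, ← Module.End.mul_apply,
        ← pow_succ']
  obtain ⟨n, hn⟩ := (isNilpotent_derivationOf (ι := ι) (N := W) hA).neg
  have hfp : f = T p := hp
  have hTp : (T ^ (n + 1)) p = 0 := by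
    rw [pow_succ, Module.End.mul_apply, ← hfp, hpow, hn, LinearMap.zero_apply]
  have hb (q : MultilinearMap K (fun _ : ι ↦ V) W) (I : ι → κ) :
      T q (fun i ↦ b (I i)) = (∑ i, μ (I i) - 1) • q (fun i ↦ b (I i)) := by
    simp [T, derivationOf_apply_basis b hS, sub_smul]
  have hbn (k : ℕ) (I : ι → κ) :
      (T ^ k) p (fun i ↦ b (I i)) = (∑ i, μ (I i) - 1) ^ k • p (fun i ↦ b (I i)) := by
    induction k with
    | zero => simp
    | succ k ih => rw [pow_succ', Module.End.mul_apply, hb, ih, smul_smul, pow_succ']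
  refine Module.Basis.ext_multilinear (fun _ ↦ b) fun I ↦ ?_
  have h1 := hbn (n + 1) I
  rw [hTp, zero_apply, eq_comm, smul_eq_zero, pow_eq_zero_iff n.succ_ne_zero, ← smul_eq_zero] at h1
  rw [hfp, hb, h1, zero_apply]
end MultilinearMap

section

open scoped ContDiff

variable {𝕜 : Type*} [RCLike 𝕜] {E F : Type*} [NormedAddCommGroup E] [NormedSpace 𝕜 E]
  [NormedAddCommGroup F] [NormedSpace 𝕜 F]

theorem iteratedFDeriv_succ_apply_eq_fderiv_apply {f : E → F} {x : E}
    (hf : ContDiffAt 𝕜 ω f x) (n : ℕ) (v : Fin (n + 1) → E) :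
    iteratedFDeriv 𝕜 (n + 1) f x v =
      iteratedFDeriv 𝕜 n (fun y ↦ fderiv 𝕜 f y (v (Fin.last n))) x (Fin.init v) := by
  rw [iteratedFDeriv_succ_apply_right]
  have h := (ContinuousLinearMap.apply 𝕜 F (v (Fin.last n))).iteratedFDeriv_comp_left
    (hf.fderiv_right (m := ω) le_rfl) (i := n) (by exact le_top)
  exact (DFunLike.congr_fun h (Fin.init v)).symm

theorem iteratedFDeriv_fderiv_apply_eq_zero {f : E → F} {x : E} (hf : ContDiffAt 𝕜 ω f x)
    {n : ℕ} (h : iteratedFDeriv 𝕜 (n + 1) f x = 0) (w : E) :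
    iteratedFDeriv 𝕜 n (fun y ↦ fderiv 𝕜 f y w) x = 0 := by
  ext v
  have := iteratedFDeriv_succ_apply_eq_fderiv_apply hf n (Fin.snoc v w)
  rw [Fin.init_snoc, Fin.snoc_last, h] at this
  exact this.symm

theorem iteratedFDeriv_fderiv_eq_zero {f : E → F} {x : E}
    {n : ℕ} (h : iteratedFDeriv 𝕜 (n + 1) f x = 0) :
    iteratedFDeriv 𝕜 n (fderiv 𝕜 f) x = 0 := by
  rw [← norm_eq_zero, norm_iteratedFDeriv_fderiv, h, norm_zero]

/-- If `g` vanishes to order `n` at `x`, the `n`-th derivative of `y ↦ g y (Z y)` at `x` only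
involves the value of `Z` at `x`. -/
theorem iteratedFDeriv_clm_apply_of_vanishing {G : Type*} [NormedAddCommGroup G] [NormedSpace 𝕜 G]
    {x : E} (n : ℕ) : ∀ {g : E → F →L[𝕜] G} {Z : E → F}, ContDiffAt 𝕜 ω g x → ContDiffAt 𝕜 ω Z x →
    (∀ j < n, iteratedFDeriv 𝕜 j g x = 0) → ∀ v : Fin n → E,
    iteratedFDeriv 𝕜 n (fun y ↦ g y (Z y)) x v = iteratedFDeriv 𝕜 n g x v (Z x) := by
  induction n with
  | zero => intro g Z _ _ _ v; simp
  | succ n ih =>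
    intro g Z hg hZ h v
    set w := v (Fin.last n)
    have hg' : ContDiffAt 𝕜 ω (fun y ↦ fderiv 𝕜 g y w) x :=
      (hg.fderiv_right (m := ω) le_rfl).clm_apply contDiffAt_const
    have hZ' : ContDiffAt 𝕜 ω (fun y ↦ fderiv 𝕜 Z y w) x :=
      (hZ.fderiv_right (m := ω) le_rfl).clm_apply contDiffAt_const
    have e : (fun y ↦ fderiv 𝕜 (fun z ↦ g z (Z z)) y w) =ᶠ[𝓝 x]
        (fun y ↦ g y (fderiv 𝕜 Z y w)) + (fun y ↦ fderiv 𝕜 g y w (Z y)) := by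
      filter_upwards [hg.eventually (by simp), hZ.eventually (by simp)] with y hy hy'
      rw [fderiv_clm_apply (hy.differentiableAt (by simp)) (hy'.differentiableAt (by simp))]
      simp
    rw [iteratedFDeriv_succ_apply_eq_fderiv_apply (hg.clm_apply hZ),
      (e.iteratedFDeriv 𝕜 n).self_of_nhds,
      iteratedFDeriv_add_apply ((hg.clm_apply hZ').of_le le_top) ((hg'.clm_apply hZ).of_le le_top),
      add_apply, ih hg hZ' (fun j hj ↦ h j (by lia)),
      ih hg' hZ (fun j hj ↦ iteratedFDeriv_fderiv_apply_eq_zero hg (h _ (by lia)) w),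
      h n (by lia), iteratedFDeriv_succ_apply_eq_fderiv_apply hg]
    simp [w]

theorem ContDiffAt.fderiv_fderiv_apply_vectorField {f : E → F} {Y : E → E} {x : E}
    (hf : ContDiffAt 𝕜 ω f x) (hY : ContDiffAt 𝕜 ω Y x) (w : E) :
    (fun y ↦ fderiv 𝕜 (fun z ↦ fderiv 𝕜 f z (Y z)) y w) =ᶠ[𝓝 x]
      (fun y ↦ fderiv 𝕜 (fun z ↦ fderiv 𝕜 f z w) y (Y y)) +
        (fun y ↦ fderiv 𝕜 f y (fderiv 𝕜 Y y w)) := by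
  filter_upwards [hf.eventually (by simp), hY.eventually (by simp)] with y hy hy'
  have h1 : DifferentiableAt 𝕜 (fderiv 𝕜 f) y :=
    (hy.fderiv_right (m := ω) le_rfl).differentiableAt (by simp)
  have h2 : IsSymmSndFDerivAt 𝕜 f y := hy.isSymmSndFDerivAt (by simp)
  rw [fderiv_clm_apply h1 (hy'.differentiableAt (by simp))]
  simp only [Pi.add_apply]
  rw [fderiv_clm_apply h1 (differentiableAt_const w)]
  simp [h2.eq w (Y y), add_comm]

/-- The leading derivative at a zero `x` of `Y` of the derivative of `f` along `Y`. -/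
theorem iteratedFDeriv_fderiv_vectorField_of_vanishing {Y : E → E} {x : E}
    (hY : ContDiffAt 𝕜 ω Y x) (hYx : Y x = 0) (n : ℕ) : ∀ {f : E → F}, ContDiffAt 𝕜 ω f x →
    (∀ j < n, iteratedFDeriv 𝕜 j f x = 0) → ∀ v : Fin n → E,
    iteratedFDeriv 𝕜 n (fun y ↦ fderiv 𝕜 f y (Y y)) x v =
      ∑ i, iteratedFDeriv 𝕜 n f x (Function.update v i (fderiv 𝕜 Y x (v i))) := by
  induction n with
  | zero => intro f _ _ v; simp [hYx]
  | succ n ih =>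
    intro f hf h v
    set w := v (Fin.last n) with hw
    have hdf := hf.fderiv_right (m := ω) le_rfl
    have hf' : ContDiffAt 𝕜 ω (fun y ↦ fderiv 𝕜 f y w) x := hdf.clm_apply contDiffAt_const
    have hY' : ContDiffAt 𝕜 ω (fun y ↦ fderiv 𝕜 Y y w) x :=
      (hY.fderiv_right (m := ω) le_rfl).clm_apply contDiffAt_const
    rw [iteratedFDeriv_succ_apply_eq_fderiv_apply (hdf.clm_apply hY),
      ((hf.fderiv_fderiv_apply_vectorField hY w).iteratedFDeriv 𝕜 n).self_of_nhds,
      iteratedFDeriv_add_apply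
        (((hf'.fderiv_right (m := ω) le_rfl).clm_apply hY).of_le le_top)
        ((hdf.clm_apply hY').of_le le_top),
      add_apply,
      ih hf' (fun j hj ↦ iteratedFDeriv_fderiv_apply_eq_zero hf (h _ (by lia)) w),
      iteratedFDeriv_clm_apply_of_vanishing n hdf hY'
        (fun j hj ↦ iteratedFDeriv_fderiv_eq_zero (h _ (by lia))),
      Fin.sum_univ_castSucc]
    congr 1
    · refine Finset.sum_congr rfl fun i _ ↦ ?_
      rw [iteratedFDeriv_succ_apply_eq_fderiv_apply hf, Fin.init_update_castSucc,
        Function.update_of_ne (Fin.castSucc_lt_last i).ne', ← hw]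
      rfl
    · rw [iteratedFDeriv_succ_apply_right]
      simp [hw]

/-- The derivatives at `0` of the derivative of `f` along a linear vector field. -/
theorem iteratedFDeriv_fderiv_linear_vectorField (S : E →L[𝕜] E) (n : ℕ) :
    ∀ {f : E → F}, ContDiffAt 𝕜 ω f 0 → ∀ v : Fin n → E,
    iteratedFDeriv 𝕜 n (fun y ↦ fderiv 𝕜 f y (S y)) 0 v =
      ∑ i, iteratedFDeriv 𝕜 n f 0 (Function.update v i (S (v i))) := by
  induction n with
  | zero => intro f _ v; simp
  | succ n ih =>
    intro f hf v
    set w := v (Fin.last n) with hw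
    have hdf := hf.fderiv_right (m := ω) le_rfl
    have hf' (u : E) : ContDiffAt 𝕜 ω (fun y ↦ fderiv 𝕜 f y u) 0 := hdf.clm_apply contDiffAt_const
    have hS : ContDiffAt 𝕜 ω S 0 := S.contDiff.contDiffAt
    have e := hf.fderiv_fderiv_apply_vectorField hS w
    simp only [ContinuousLinearMap.fderiv] at e
    rw [iteratedFDeriv_succ_apply_eq_fderiv_apply (hdf.clm_apply hS),
      (e.iteratedFDeriv 𝕜 n).self_of_nhds,
      iteratedFDeriv_add_apply
        ((((hf' w).fderiv_right (m := ω) le_rfl).clm_apply hS).of_le le_top)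
        ((hf' (S w)).of_le le_top),
      add_apply, ih (hf' w), Fin.sum_univ_castSucc]
    congr 1
    · refine Finset.sum_congr rfl fun i _ ↦ ?_
      rw [iteratedFDeriv_succ_apply_eq_fderiv_apply hf, Fin.init_update_castSucc,
        Function.update_of_ne (Fin.castSucc_lt_last i).ne', ← hw]
      rfl
    · rw [iteratedFDeriv_succ_apply_eq_fderiv_apply hf]
      simp [hw]

theorem ContDiffAt.eventually_eq_zero_of_iteratedFDeriv_eq_zero [CompleteSpace F] {f : E → F}
    {x : E} (hf : ContDiffAt 𝕜 ω f x) (h : ∀ n, iteratedFDeriv 𝕜 n f x = 0) :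
    ∀ᶠ y in 𝓝 x, f y = 0 := by
  obtain ⟨p, r, hp⟩ := hf.analyticAt
  filter_upwards [Metric.eball_mem_nhds x hp.r_pos] with y hy
  have h1 := hp.hasSum_iteratedFDeriv (y := y - x) (by simpa [edist_eq_enorm_sub] using hy)
  simp only [h, zero_apply, smul_zero, add_sub_cancel] at h1
  exact h1.unique hasSum_zero

/-- If `f` is an eigenfunction of eigenvalue `1` of the vector field `Y`, and the linear vector
field `S` commutes with `Y` and is the semisimple part of the linearization of `Y` at its zero `0`,
then `f` is an eigenfunction of eigenvalue `1` of `S`. -/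
theorem eventually_fderiv_semisimple_eq_self [CompleteSpace F] {κ : Type*}
    (b : Module.Basis κ 𝕜 E) {S : E →L[𝕜] E} {μ : κ → 𝕜} (hS : ∀ k, S (b k) = μ k • b k)
    {Y : E → E} (hY : ContDiffAt 𝕜 ω Y 0) (hY0 : Y 0 = 0)
    (hnil : IsNilpotent ((fderiv 𝕜 Y 0 : E →ₗ[𝕜] E) - S))
    (hcomm : Commute ((fderiv 𝕜 Y 0 : E →ₗ[𝕜] E) - S) (S : E →ₗ[𝕜] E))
    (hYS : ∀ᶠ x in 𝓝 0, fderiv 𝕜 Y x (S x) = S (Y x))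
    {f : E → F} (hf : ContDiffAt 𝕜 ω f 0) (hfY : ∀ᶠ x in 𝓝 0, fderiv 𝕜 f x (Y x) = f x) :
    ∀ᶠ x in 𝓝 0, fderiv 𝕜 f x (S x) = f x := by
  have hSc : ContDiff 𝕜 ω S := S.contDiff
  have hfS : ContDiffAt 𝕜 ω (fun x ↦ fderiv 𝕜 f x (S x)) 0 :=
    (hf.fderiv_right (m := ω) le_rfl).clm_apply hSc.contDiffAt
  set g : E → F := (fun x ↦ fderiv 𝕜 f x (S x)) - f with hg_def
  have hg : ContDiffAt 𝕜 ω g 0 := hfS.sub hf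
  have hgY : (fun x ↦ fderiv 𝕜 g x (Y x)) =ᶠ[𝓝 0] g := by
    filter_upwards [hf.eventually (by simp), hY.eventually (by simp), hYS,
      hfY.eventually_nhds, hfS.eventually (by simp)] with x hfx hYx hYSx hfYx hfSx
    have h1 : DifferentiableAt 𝕜 (fderiv 𝕜 f) x :=
      (hfx.fderiv_right (m := ω) le_rfl).differentiableAt (by simp)
    have h2 : IsSymmSndFDerivAt 𝕜 f x := hfx.isSymmSndFDerivAt (by simp)
    have h3 := DFunLike.congr_fun
      (Filter.EventuallyEq.fderiv_eq (𝕜 := 𝕜) (f₁ := fun z ↦ fderiv 𝕜 f z (Y z)) hfYx) (S x)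
    rw [fderiv_clm_apply h1 (hYx.differentiableAt (by simp))] at h3
    rw [hg_def, fderiv_sub (hfSx.differentiableAt (by simp)) (hfx.differentiableAt (by simp)),
      fderiv_clm_apply h1 S.differentiableAt]
    simp only [add_apply, sub_apply, Pi.sub_apply, ContinuousLinearMap.comp_apply,
      ContinuousLinearMap.flip_apply, ContinuousLinearMap.fderiv, hYSx] at h3 ⊢
    rw [hfYx.self_of_nhds, h2.eq (Y x) (S x), h3]
  have hzero (n : ℕ) : iteratedFDeriv 𝕜 n g 0 = 0 := by
    induction n using Nat.strong_induction_on with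
    | _ n ih =>
      apply ContinuousMultilinearMap.toMultilinearMap_injective
      refine MultilinearMap.eq_zero_of_derivationOf_eq_self b hS hnil hcomm
        (p := (iteratedFDeriv 𝕜 n f 0).toMultilinearMap) ?_ ?_
      · ext v
        have := iteratedFDeriv_fderiv_vectorField_of_vanishing hY hY0 n hg ih v
        rw [(hgY.iteratedFDeriv 𝕜 n).self_of_nhds] at this
        rw [MultilinearMap.derivationOf_apply]
        exact this.symm
      · ext v
        have := iteratedFDeriv_fderiv_linear_vectorField S n hf v
        rw [sub_apply, MultilinearMap.derivationOf_apply]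
        simp only [hg_def, ContinuousMultilinearMap.coe_coe, ContinuousLinearMap.coe_coe]
        rw [iteratedFDeriv_sub_apply (hfS.of_le le_top) (hf.of_le le_top), ← this]
        rfl
  filter_upwards [hg.eventually_eq_zero_of_iteratedFDeriv_eq_zero hzero] with x hx
  exact sub_eq_zero.mp hx

end

theorem LinearMap.isNilpotent_prodMap {R M N : Type*} [CommRing R] [AddCommGroup M] [Module R M]
    [AddCommGroup N] [Module R N] {A : Module.End R M} {B : Module.End R N}
    (hA : IsNilpotent A) (hB : IsNilpotent B) :
    IsNilpotent (A.prodMap B : Module.End R (M × N)) := by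
  have h (n : ℕ) : (A.prodMap B : Module.End R (M × N)) ^ n = (A ^ n).prodMap (B ^ n) :=
    (map_pow (LinearMap.prodMapRingHom R M N) (A, B) n).symm
  obtain ⟨k, hk⟩ := hA
  obtain ⟨l, hl⟩ := hB
  refine ⟨k + l, ?_⟩
  rw [h, pow_add, hk, pow_add, hl, zero_mul, mul_zero, LinearMap.prodMap_zero]

theorem LinearMap.commute_prodMap {R M N : Type*} [CommRing R] [AddCommGroup M] [Module R M]
    [AddCommGroup N] [Module R N] {A A' : Module.End R M} {B B' : Module.End R N}
    (hA : Commute A A') (hB : Commute B B') :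
    Commute (A.prodMap B : Module.End R (M × N)) (A'.prodMap B') := by
  rw [Commute, SemiconjBy, LinearMap.prodMap_mul, LinearMap.prodMap_mul, hA.eq, hB.eq]

section

open scoped ContDiff

variable {𝕜 : Type*} [RCLike 𝕜] {E : Type*} [NormedAddCommGroup E] [NormedSpace 𝕜 E]

/-- The complete lift of the vector field `X` to pairs of tangent vectors. -/
noncomputable def completeLift (X : E → E) (p : E × E × E) : E × E × E :=
  (X p.1, fderiv 𝕜 X p.1 p.2.1, fderiv 𝕜 X p.1 p.2.2)

theorem ContDiffAt.completeLift {X : E → E} {p : E × E × E} (hX : ContDiffAt 𝕜 ω X p.1) :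
    ContDiffAt 𝕜 ω (completeLift (𝕜 := 𝕜) X) p := by
  have h : ContDiffAt 𝕜 ω (fun q : E × E × E ↦ fderiv 𝕜 X q.1) p :=
    (hX.fderiv_right (m := ω) le_rfl).comp p contDiffAt_fst
  exact (hX.comp p contDiffAt_fst).prodMk
    ((h.clm_apply contDiffAt_snd.fst).prodMk (h.clm_apply contDiffAt_snd.snd))

theorem ContDiffAt.fderiv_completeLift {X : E → E} {p : E × E × E} (hX : ContDiffAt 𝕜 ω X p.1)
    (q : E × E × E) :
    fderiv 𝕜 (_root_.completeLift (𝕜 := 𝕜) X) p q =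
      (fderiv 𝕜 X p.1 q.1,
        fderiv 𝕜 (fderiv 𝕜 X) p.1 q.1 p.2.1 + fderiv 𝕜 X p.1 q.2.1,
        fderiv 𝕜 (fderiv 𝕜 X) p.1 q.1 p.2.2 + fderiv 𝕜 X p.1 q.2.2) := by
  have h0 : HasFDerivAt (fun p : E × E × E ↦ p.1) (ContinuousLinearMap.fst 𝕜 E (E × E)) p :=
    hasFDerivAt_fst
  have h1 := (hX.differentiableAt (by simp)).hasFDerivAt.comp p h0
  have h2 := ((hX.fderiv_right (m := ω) le_rfl).differentiableAt (by simp)).hasFDerivAt.comp p h0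
  have h3 := h2.clm_apply (hasFDerivAt_snd (p := p)).fst
  have h4 := h2.clm_apply (hasFDerivAt_snd (p := p)).snd
  have h : HasFDerivAt (_root_.completeLift (𝕜 := 𝕜) X) _ p := h1.prodMk (h3.prodMk h4)
  rw [h.fderiv]
  simp [add_comm]

theorem DifferentiableAt.fderiv_bilinear_apply {F : Type*} [NormedAddCommGroup F] [NormedSpace 𝕜 F]
    {η : E → E →L[𝕜] E →L[𝕜] F} {p : E × E × E}
    (hη : DifferentiableAt 𝕜 η p.1) (q : E × E × E) :
    fderiv 𝕜 (fun p : E × E × E ↦ η p.1 p.2.1 p.2.2) p q =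
      fderiv 𝕜 η p.1 q.1 p.2.1 p.2.2 + η p.1 q.2.1 p.2.2 + η p.1 p.2.1 q.2.2 := by
  have h0 : HasFDerivAt (fun p : E × E × E ↦ p.1) (ContinuousLinearMap.fst 𝕜 E (E × E)) p :=
    hasFDerivAt_fst
  have h : HasFDerivAt (fun p : E × E × E ↦ η p.1 p.2.1 p.2.2) _ p :=
    ((hη.hasFDerivAt.comp p h0).clm_apply (hasFDerivAt_snd (𝕜 := 𝕜) (p := p)).fst).clm_apply
      (hasFDerivAt_snd (𝕜 := 𝕜) (p := p)).snd
  rw [h.fderiv]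
  simp
  abel

/-- A linear vector field commuting with `X` commutes with the complete lift of `X`. -/
theorem ContDiffAt.fderiv_completeLift_linear {X : E → E} {S : E →L[𝕜] E} {p : E × E × E}
    (hX : ContDiffAt 𝕜 ω X p.1) (hXS : ∀ᶠ x in 𝓝 p.1, fderiv 𝕜 X x (S x) = S (X x)) :
    fderiv 𝕜 (_root_.completeLift (𝕜 := 𝕜) X) p (S.prodMap (S.prodMap S) p) =
      S.prodMap (S.prodMap S) (_root_.completeLift (𝕜 := 𝕜) X p) := by
  have h1 : DifferentiableAt 𝕜 (fderiv 𝕜 X) p.1 :=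
    (hX.fderiv_right (m := ω) le_rfl).differentiableAt (by simp)
  have h2 : IsSymmSndFDerivAt 𝕜 X p.1 := hX.isSymmSndFDerivAt (by simp)
  have key (u : E) : fderiv 𝕜 (fderiv 𝕜 X) p.1 (S p.1) u + fderiv 𝕜 X p.1 (S u) =
      S (fderiv 𝕜 X p.1 u) := by
    have h3 := DFunLike.congr_fun (Filter.EventuallyEq.fderiv_eq (𝕜 := 𝕜)
      (f₁ := fun x ↦ fderiv 𝕜 X x (S x)) (f := fun x ↦ S (X x)) hXS) u
    have h4 := (S.hasFDerivAt.comp p.1 (hX.differentiableAt (by simp)).hasFDerivAt).fderiv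
    rw [fderiv_clm_apply h1 S.differentiableAt, show (fun x ↦ S (X x)) = S ∘ X from rfl, h4] at h3
    simp only [add_apply, ContinuousLinearMap.comp_apply, ContinuousLinearMap.flip_apply,
      ContinuousLinearMap.fderiv] at h3
    rw [h2.eq (S p.1) u, add_comm, h3]
  rw [hX.fderiv_completeLift]
  simp [_root_.completeLift, key, hXS.self_of_nhds]

theorem ContDiffAt.coe_fderiv_completeLift_zero {X : E → E} (hX : ContDiffAt 𝕜 ω X 0) :
    (fderiv 𝕜 (_root_.completeLift (𝕜 := 𝕜) X) 0 : E × E × E →ₗ[𝕜] E × E × E) =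
      (fderiv 𝕜 X 0 : E →ₗ[𝕜] E).prodMap
        ((fderiv 𝕜 X 0 : E →ₗ[𝕜] E).prodMap (fderiv 𝕜 X 0 : E →ₗ[𝕜] E)) := by
  refine LinearMap.ext fun q ↦ ?_
  have := ContDiffAt.fderiv_completeLift (p := 0) hX q
  simpa using this

/-- If `η` is a field of bilinear forms conformally preserved by `X`, it is conformally preserved
by any linear vector field `S` that commutes with `X` and is the semisimple part of `X` at `0`. -/
theorem eventually_lieDeriv_semisimple_eq_self {F : Type*} [NormedAddCommGroup F] [NormedSpace 𝕜 F]
    [CompleteSpace F] {κ : Type*} (b : Module.Basis κ 𝕜 E) {S : E →L[𝕜] E} {μ : κ → 𝕜}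
    (hS : ∀ k, S (b k) = μ k • b k) {X : E → E} (hX : ContDiffAt 𝕜 ω X 0) (hX0 : X 0 = 0)
    (hnil : IsNilpotent ((fderiv 𝕜 X 0 : E →ₗ[𝕜] E) - S))
    (hcomm : Commute ((fderiv 𝕜 X 0 : E →ₗ[𝕜] E) - S) (S : E →ₗ[𝕜] E))
    (hXS : ∀ᶠ x in 𝓝 0, fderiv 𝕜 X x (S x) = S (X x))
    {η : E → E →L[𝕜] E →L[𝕜] F} (hη : ContDiffAt 𝕜 ω η 0)
    (hηX : ∀ᶠ x in 𝓝 0, ∀ u v, fderiv 𝕜 η x (X x) u v + η x (fderiv 𝕜 X x u) v +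
      η x u (fderiv 𝕜 X x v) = η x u v) :
    ∀ᶠ x in 𝓝 0, ∀ u v,
      fderiv 𝕜 η x (S x) u v + η x (S u) v + η x u (S v) = η x u v := by
  have tendsto_fst : Filter.Tendsto (fun p : E × E × E ↦ p.1) (𝓝 0) (𝓝 0) :=
    continuous_fst.tendsto' _ _ rfl
  have hηd := hη.eventually (by simp)
  have hsub : (fderiv 𝕜 (completeLift (𝕜 := 𝕜) X) 0 : E × E × E →ₗ[𝕜] E × E × E) -
      ((S.prodMap (S.prodMap S) : E × E × E →L[𝕜] E × E × E) : E × E × E →ₗ[𝕜] E × E × E) =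
      ((fderiv 𝕜 X 0 : E →ₗ[𝕜] E) - (S : E →ₗ[𝕜] E)).prodMap
        (((fderiv 𝕜 X 0 : E →ₗ[𝕜] E) - (S : E →ₗ[𝕜] E)).prodMap
          ((fderiv 𝕜 X 0 : E →ₗ[𝕜] E) - (S : E →ₗ[𝕜] E))) := by
    rw [hX.coe_fderiv_completeLift_zero]
    rfl
  have key : ∀ᶠ p in 𝓝 (0 : E × E × E), fderiv 𝕜 (fun p : E × E × E ↦ η p.1 p.2.1 p.2.2) p
      (S.prodMap (S.prodMap S) p) = η p.1 p.2.1 p.2.2 := by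
    refine eventually_fderiv_semisimple_eq_self (b.prod (b.prod b))
      (μ := Sum.elim μ (Sum.elim μ μ)) (Y := completeLift (𝕜 := 𝕜) X) ?_
      (ContDiffAt.completeLift (p := 0) hX) ?_ ?_ ?_ ?_ ?_ ?_
    · rintro (k | k | k) <;> simp [hS, Prod.map]
    · simp [completeLift, hX0]
    · rw [hsub]
      exact LinearMap.isNilpotent_prodMap hnil (LinearMap.isNilpotent_prodMap hnil hnil)
    · rw [hsub]
      exact LinearMap.commute_prodMap hcomm (LinearMap.commute_prodMap hcomm hcomm)
    · filter_upwards [tendsto_fst.eventually (hX.eventually (by simp)),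
        tendsto_fst.eventually hXS.eventually_nhds] with p hp hp'
      exact hp.fderiv_completeLift_linear hp'
    · exact ((ContDiffAt.comp (0 : E × E × E) hη contDiffAt_fst).clm_apply
        contDiffAt_snd.fst).clm_apply contDiffAt_snd.snd
    · filter_upwards [tendsto_fst.eventually hηd, tendsto_fst.eventually hηX] with p hp hp'
      rw [DifferentiableAt.fderiv_bilinear_apply (hp.differentiableAt (by simp))]
      exact hp' _ _
  rw [Prod.zero_eq_mk, nhds_prod_eq] at key
  filter_upwards [key.curry, hηd] with x hx hηx u v
  have hlim : Filter.Tendsto (fun c : 𝕜 ↦ c • (u, v)) (𝓝[≠] 0) (𝓝 0) :=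
    ((continuous_id.smul continuous_const).tendsto' _ _ (zero_smul _ _)).mono_left
      nhdsWithin_le_nhds
  obtain ⟨c, hc, hc0⟩ := ((hlim.eventually hx).and self_mem_nhdsWithin).exists
  have hc0 : c ≠ 0 := hc0
  rw [DifferentiableAt.fderiv_bilinear_apply (hηx.differentiableAt (by simp))] at hc
  simpa [← smul_add, smul_right_inj hc0] using hc

end

/-- (Conservation law, analytic category; Lemma 2.1 of the paper.) Let `S` be a
diagonal linear vector field on `𝕂^m` (`𝕂 = ℝ` or `ℂ`), and let `X` be an analytic vector field
near `0` with `X(0) = 0` which is in Poincaré–Dulac normal form with semisimple linear part `S`: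
`DX(0) − S` is nilpotent and commutes with `S`, and `X` commutes with `S`. If `ω` is an analytic
field of alternating bilinear forms with `L_X ω = ω` near `0`, then `L_S ω = ω` near `0`. -/
theorem semisimple_part_conformally_preserves_analytic
    (𝕂 : Type*) [RCLike 𝕂] (m : ℕ)
    (lam : Fin m → 𝕂)
    (S : (Fin m → 𝕂) → (Fin m → 𝕂))
    (hS : ∀ (x : Fin m → 𝕂) (i : Fin m), S x i = lam i * x i)
    (U : Set (Fin m → 𝕂)) (hU : IsOpen U) (h0U : (0 : Fin m → 𝕂) ∈ U)
    (X : (Fin m → 𝕂) → (Fin m → 𝕂))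
    (hXan : AnalyticOnNhd 𝕂 X U) (hX0 : X 0 = 0)
    -- (a)  DX(0) − S is nilpotent and commutes with S (S is the semisimple part of DX(0)) :
    (hnil : IsNilpotent (LinearMap.toMatrix'
        ((fderiv 𝕂 X 0 : (Fin m → 𝕂) →L[𝕂] (Fin m → 𝕂)) :
          (Fin m → 𝕂) →ₗ[𝕂] (Fin m → 𝕂)) - Matrix.diagonal lam))
    (hcomm : Commute (LinearMap.toMatrix'
        ((fderiv 𝕂 X 0 : (Fin m → 𝕂) →L[𝕂] (Fin m → 𝕂)) :
          (Fin m → 𝕂) →ₗ[𝕂] (Fin m → 𝕂)) - Matrix.diagonal lam) (Matrix.diagonal lam))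
    -- (b)  X is in Poincaré–Dulac normal form: X commutes with S :
    (hPD : ∀ x ∈ U, fderiv 𝕂 X x (S x) = S (X x))
    -- ω is an analytic field of alternating bilinear forms with L_X ω = ω :
    (ω : (Fin m → 𝕂) → (Fin m → 𝕂) →L[𝕂] (Fin m → 𝕂) →L[𝕂] 𝕂)
    (hωan : AnalyticOnNhd 𝕂 ω U)
    (hωalt : ∀ x ∈ U, ∀ u, ω x u u = 0)
    (hLX : ∀ x ∈ U, ∀ u v,
      fderiv 𝕂 ω x (X x) u v + ω x (fderiv 𝕂 X x u) v + ω x u (fderiv 𝕂 X x v) = ω x u v) :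
    ∃ V : Set (Fin m → 𝕂), IsOpen V ∧ (0 : Fin m → 𝕂) ∈ V ∧ V ⊆ U ∧
      ∀ x ∈ V, ∀ u v,
        fderiv 𝕂 ω x (S x) u v + ω x (S u) v + ω x u (S v) = ω x u v := by
  set A : Module.End 𝕂 (Fin m → 𝕂) := (fderiv 𝕂 X 0 : (Fin m → 𝕂) →ₗ[𝕂] (Fin m → 𝕂))
  set SL : (Fin m → 𝕂) →L[𝕂] (Fin m → 𝕂) :=
    LinearMap.toContinuousLinearMap (Matrix.toLin' (Matrix.diagonal lam))
  have hSL (x : Fin m → 𝕂) : SL x = S x := by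
    ext i
    simp [SL, hS, Matrix.mulVec_diagonal]
  have hmat : LinearMap.toMatrixAlgEquiv' (A - (SL : (Fin m → 𝕂) →ₗ[𝕂] (Fin m → 𝕂))) =
      LinearMap.toMatrix' A - Matrix.diagonal lam := by
    rw [map_sub]
    congr 1
    exact LinearMap.toMatrix'_toLin' _
  have hmatS : LinearMap.toMatrixAlgEquiv' (SL : (Fin m → 𝕂) →ₗ[𝕂] (Fin m → 𝕂)) =
      Matrix.diagonal lam := LinearMap.toMatrix'_toLin' _
  have hU0 : U ∈ 𝓝 0 := hU.mem_nhds h0U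
  have main := eventually_lieDeriv_semisimple_eq_self (Pi.basisFun 𝕂 (Fin m)) (S := SL) (μ := lam)
    (fun k ↦ ?_) (hXan 0 h0U).contDiffAt hX0 ?_ ?_ ?_ (hωan 0 h0U).contDiffAt
    (Filter.eventually_of_mem hU0 hLX)
  · obtain ⟨V, hVsub, hVo, h0V⟩ := mem_nhds_iff.mp (Filter.inter_mem hU0 main)
    refine ⟨V, hVo, h0V, fun x hx ↦ (hVsub hx).1, fun x hx u v ↦ ?_⟩
    simpa only [hSL] using (hVsub hx).2 u v
  · ext i
    rw [hSL, hS]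
    obtain rfl | h := eq_or_ne i k <;> simp [*]
  · rw [← hmat] at hnil
    exact (IsNilpotent.map_iff LinearMap.toMatrixAlgEquiv'.injective).mp hnil
  · rw [← hmat, ← hmatS] at hcomm
    exact hcomm.of_map LinearMap.toMatrixAlgEquiv'.injective
  · filter_upwards [hU0] with x hx
    simpa only [hSL] using hPD x hx
end
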